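/- Let F be a finite field with q elements. The group PSL(2,F) has a string C-group representation of rank 4 if and only if q = 11 or q = 19. Moreover, for q = 11 and q = 19 this representation is unique up to isomorphism: for any two string C-group representations of rank 4 of PSL(2,F) with generating sets S and T, there is an automorphism of PSL(2,F) mapping the set S onto the set T. -/

import Mathlib

/-- A string C-group representation of rank `n` of a group `G`: a family of `n`
involutions generating `G`, satisfying the commuting (string) property and the
intersection property. -/
def IsStringCGroupRep {G : Type*} [Group G] {n : ℕ} (ρ : Fin n → G) : Prop :=
  (∀ i, orderOf (ρ i) = 2) ∧
  Subgroup.closure (Set.range ρ) = ⊤ ∧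
  (∀ i j : Fin n, i.val + 1 < j.val → Commute (ρ i) (ρ j)) ∧
  (∀ I J : Set (Fin n),
    Subgroup.closure (ρ '' I) ⊓ Subgroup.closure (ρ '' J) = Subgroup.closure (ρ '' (I ∩ J)))

/-- Arithmetic of the orbit lengths of a tame group: `c i * e i = n` and `∑ (n - c i) = 2 n - 2`. -/
theorem tame_triple {n c₁ c₂ c₃ e₁ e₂ e₃ : ℕ} (h₁ : c₁ * e₁ = n) (h₂ : c₂ * e₂ = n)
    (h₃ : c₃ * e₃ = n) (he₁ : 2 ≤ e₁) (he₂ : 2 ≤ e₂) (hc₁ : 3 ≤ c₁) (hc₂ : 3 ≤ c₂) (hc₃ : 3 ≤ c₃)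
    (hs : c₁ + c₂ + c₃ = n + 2) : e₃ ≤ 5 := by
  by_contra! h
  have h6 : c₃ * 6 ≤ n := h₃ ▸ Nat.mul_le_mul_left _ h
  have key : ∀ {c d e f : ℕ}, c * e = n → d * f = n → 2 ≤ e → 3 ≤ d → 3 ≤ c → 2 ≤ f →
      c + d + c₃ = n + 2 → ¬ e = 2 := by
    intro c d e f h1 h2 _ hd hc hf hs he
    subst he
    rcases Nat.lt_or_ge f 4 with hf4 | hf4
    · interval_cases f <;> omega
    · have : d * 4 ≤ n := h2 ▸ Nat.mul_le_mul_left _ hf4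
      omega
  have n1 := key h₁ h₂ he₁ hc₂ hc₁ he₂ hs
  have n2 := key h₂ h₁ he₂ hc₁ hc₂ he₁ (by omega)
  have a1 : c₁ * 3 ≤ n := h₁ ▸ Nat.mul_le_mul_left _ (by omega)
  have a2 : c₂ * 3 ≤ n := h₂ ▸ Nat.mul_le_mul_left _ (by omega)
  omega

/-- Arithmetic of a group with one wild orbit of length `1 + f * Q` (stabiliser of order `Q * k`)
and one tame orbit (stabiliser of order `e`). -/
theorem wild_pair {Q f k e : ℕ} (hQ : 3 ≤ Q) (hf : 1 ≤ f) (hk : k ≤ Q - 1) (hk1 : 1 ≤ k)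
    (h : k * (1 + f * Q) = e * (1 + f * (Q - 2))) :
    (f = 1 ∧ k ∣ Q - 1 ∧ Q - 1 ≤ 2 * k ∧ e ∣ Q + 1) ∨ (Q = 3 ∧ k = 2 ∧ e = 5) := by
  obtain ⟨R, rfl⟩ : ∃ R, Q = R + 2 := ⟨Q - 2, by omega⟩
  simp only [Nat.add_sub_cancel] at h
  have hke : k < e := by
    by_contra! hle
    have : e * (1 + f * R) < k * (1 + f * (R + 2)) := by
      calc e * (1 + f * R) ≤ k * (1 + f * R) := Nat.mul_le_mul_right _ hle
        _ < k * (1 + f * (R + 2)) := by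
          apply Nat.mul_lt_mul_of_pos_left _ (by omega); nlinarith
    omega
  obtain ⟨i, rfl⟩ : ∃ i, e = k + i := ⟨e - k, by omega⟩
  have h' : 2 * f * k = i * (1 + f * R) := by
    zify at h ⊢; linear_combination h
  have hfi : f ∣ i := by
    have : f ∣ i * (1 + f * R) := ⟨2 * k, by rw [← h']; ring⟩
    refine Nat.Coprime.dvd_of_dvd_mul_right ?_ this
    rw [Nat.coprime_add_mul_left_right]; exact Nat.coprime_one_right f
  obtain ⟨j, rfl⟩ := hfi
  have hk2 : 2 * k = j * (1 + f * R) := by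
    have : f * (2 * k) = f * (j * (1 + f * R)) := by rw [← mul_assoc, ← mul_assoc, ← h']; ring
    exact Nat.eq_of_mul_eq_mul_left (by omega) this
  have hj : 1 ≤ j := by
    rcases Nat.eq_zero_or_pos j with rfl | hj
    · omega
    · exact hj
  have hkR : k ≤ R + 1 := by omega
  have hj2 : j * (1 + f * R) ≤ 2 * (R + 1) := by omega
  have hR : 1 ≤ R := by omega
  have hf3 : f ≤ 3 := by
    by_contra! hf4
    have : 1 * (1 + 4 * R) ≤ j * (1 + f * R) :=
      Nat.mul_le_mul hj (Nat.add_le_add_left (Nat.mul_le_mul_right _ hf4) _)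
    omega
  have hj3 : j ≤ 2 := by
    by_contra! hj4
    have : 3 * (1 + 1 * R) ≤ j * (1 + f * R) :=
      Nat.mul_le_mul hj4 (Nat.add_le_add_left (Nat.mul_le_mul_right _ hf) _)
    omega
  interval_cases f <;> interval_cases j
  · refine Or.inl ⟨rfl, ⟨2, by omega⟩, by omega, ⟨2, by omega⟩⟩
  · refine Or.inl ⟨rfl, ⟨1, by omega⟩, by omega, ⟨1, by omega⟩⟩
  all_goals right; omega

open MulAction in
set_option maxHeartbeats 2000000 in
/-- Orbit counting for a finite group in which every nontrivial element has one or two fixed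
points; `U` singles out the identity and the elements with a single fixed point. -/
theorem counting_dichotomy {H X : Type*} [Group H] [Finite H] [MulAction H X] [Finite X]
    [Nonempty X] (U : H → Prop) {ℓ : ℕ} (hℓ : ℓ.Prime) (hℓ2 : ℓ ≠ 2) (hU1 : U 1)
    (hUfix : ∀ h ≠ 1, U h → (fixedBy X h).ncard = 1)
    (hnU : ∀ h ≠ 1, ¬ U h → (fixedBy X h).ncard = 2)
    (hUmul : ∀ (x : X) (g h : H), g • x = x → h • x = x → U g → U h → U (g * h))
    (hUpow : ∀ h, U h → h ^ ℓ = 1)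
    (horb1 : ∀ x : X, Nat.card (orbit H x) ≠ 1)
    (horb2 : ∀ x : X, Nat.card (orbit H x) ≠ 2) :
    (∀ h : H, orderOf h ≤ 5) ∨
      ∃ m : ℕ, 1 ≤ m ∧ (ℓ ^ m) * ((ℓ ^ m) ^ 2 - 1) ≤ 2 * Nat.card H ∧
        ∀ h : H, U h ∨ h ^ (ℓ ^ m - 1) = 1 ∨ h ^ (ℓ ^ m + 1) = 1 := by
  classical
  have := Fintype.ofFinite H
  have := Fintype.ofFinite X
  have hUpow' : ∀ (x : X) (h : H), h • x = x → U h → ∀ k : ℕ, U (h ^ k) ∧ h ^ k • x = x := by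
    intro x h hx hU k
    induction k with
    | zero => simp [hU1]
    | succ k ih =>
      rw [pow_succ]
      exact ⟨hUmul x _ _ ih.2 hx ih.1 hU, by rw [mul_smul, hx, ih.2]⟩
  let P : X → Subgroup H := fun x =>
    { carrier := {h | h • x = x ∧ U h}
      mul_mem' := fun {a b} ha hb =>
        ⟨by rw [mul_smul, hb.1, ha.1], hUmul x a b ha.1 hb.1 ha.2 hb.2⟩
      one_mem' := ⟨one_smul _ _, hU1⟩
      inv_mem' := fun {a} ha => by
        have h1 : a⁻¹ = a ^ (ℓ - 1) := by
          rw [inv_eq_iff_mul_eq_one, ← pow_succ', Nat.sub_add_cancel hℓ.one_le, hUpow a ha.2]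
        refine ⟨by rw [inv_smul_eq_iff, ha.1], ?_⟩
        rw [h1]; exact (hUpow' x a ha.1 ha.2 _).1 }
  have hPmem : ∀ x h, h ∈ P x ↔ h • x = x ∧ U h := fun x h => Iff.rfl
  have hPle : ∀ x, P x ≤ stabilizer H x := fun x h hh => hh.1
  set n := Nat.card H with hn
  let e : X → ℕ := fun x => Nat.card (stabilizer H x)
  let Q : X → ℕ := fun x => Nat.card (P x)
  let c : X → ℕ := fun x => Nat.card (orbit H x)
  have hce : ∀ x, c x * e x = n := by
    intro x
    simp only [c, e, hn, Nat.card_eq_fintype_card]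
    exact card_orbit_mul_card_stabilizer_eq_card_group H x
  have hepos : ∀ x, 0 < e x := fun x => Nat.card_pos
  have hQpos : ∀ x, 0 < Q x := fun x => Nat.card_pos
  have hcpos : ∀ x, 0 < c x := fun x => by
    have : Nonempty (orbit H x) := ⟨⟨x, mem_orbit_self x⟩⟩
    exact Nat.card_pos
  have hc3 : ∀ x, 3 ≤ c x := by
    intro x
    have h0 := hcpos x
    have h1 : c x ≠ 1 := horb1 x
    have h2 : c x ≠ 2 := horb2 x
    omega
  have hQe : ∀ x, Q x ∣ e x := fun x => Subgroup.card_dvd_of_le (hPle x)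
  have hQℓ : ∀ x, ∃ m, Q x = ℓ ^ m := by
    intro x
    have : Fact ℓ.Prime := ⟨hℓ⟩
    apply (IsPGroup.iff_card (p := ℓ) (G := P x)).1
    intro g
    exact ⟨1, Subtype.ext (by simpa using hUpow g g.2.2)⟩
  have hQodd : ∀ x, Odd (Q x) := by
    intro x
    obtain ⟨m, hm⟩ := hQℓ x
    rw [hm]
    exact (hℓ.odd_of_ne_two hℓ2).pow
  -- conjugation invariance of `U`
  have hfixconj : ∀ (g h : H), (fixedBy X (g * h * g⁻¹)).ncard = (fixedBy X h).ncard := by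
    intro g h
    rw [← smul_fixedBy, Set.ncard_smul_set]
  have hUconj : ∀ g h : H, U h → U (g * h * g⁻¹) := by
    intro g h hh
    by_cases h1 : h = 1
    · simpa [h1] using hU1
    · by_contra hcon
      have hne : g * h * g⁻¹ ≠ 1 := by simpa using h1
      have := hnU _ hne hcon
      rw [hfixconj, hUfix h h1 hh] at this
      omega
  -- a nontrivial element of `P x` only fixes `x`
  have hPfix : ∀ x h, h ∈ P x → h ≠ 1 → ∀ y, h • y = y → y = x := by
    intro x h hh h1 y hy
    obtain ⟨z, hz⟩ := Set.ncard_eq_one.1 (hUfix h h1 hh.2)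
    have hx : x ∈ fixedBy X h := hh.1
    have hy' : y ∈ fixedBy X h := hy
    rw [hz] at hx hy'
    rw [hy', hx]
  have hek : ∀ x, Q x ≠ 1 → e x ≤ Q x * (Q x - 1) := by
    intro x hx
    obtain ⟨u, huP, hu1⟩ : ∃ u ∈ P x, u ≠ 1 := by
      apply (P x).bot_or_exists_ne_one.resolve_left
      intro hb
      apply hx
      simp only [Q]; rw [hb]; simp
    let s : Finset H := Finset.univ.filter (fun h => h • x = x)
    have hs : s.card = e x := by
      simp only [s, e]
      rw [Nat.card_eq_fintype_card, Fintype.card_subtype]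
      rfl
    let t : Finset H := Finset.univ.filter (fun h => h ∈ P x)
    have ht : t.card = Q x := by
      simp only [t, Q]
      rw [Nat.card_eq_fintype_card, Fintype.card_subtype]
    have himg : (s.image (fun h => h * u * h⁻¹)) ⊆ t.erase 1 := by
      intro g hg
      obtain ⟨h, hh, rfl⟩ := Finset.mem_image.1 hg
      have hhx : h • x = x := by simpa [s] using hh
      rw [Finset.mem_erase]
      refine ⟨by simpa using hu1, ?_⟩
      simp only [t, Finset.mem_filter, Finset.mem_univ, true_and, hPmem]
      refine ⟨?_, hUconj _ _ huP.2⟩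
      rw [mul_smul, mul_smul, inv_smul_eq_iff.2 hhx.symm, huP.1, hhx]
    have h1t : (1 : H) ∈ t := by simp [t, (P x).one_mem]
    have hfib : ∀ a ∈ s.image (fun h => h * u * h⁻¹),
        (s.filter (fun h => h * u * h⁻¹ = a)).card ≤ Q x := by
      intro a ha
      obtain ⟨h₀, hh₀, rfl⟩ := Finset.mem_image.1 ha
      rw [← ht]
      refine Finset.card_le_card_of_injOn (fun h => h₀⁻¹ * h) ?_ ?_
      · intro h hh
        have hh' : h ∈ s ∧ h * u * h⁻¹ = h₀ * u * h₀⁻¹ := by simpa using hh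
        have hhx : h • x = x := by simpa [s] using hh'.1
        have hh₀x : h₀ • x = x := by simpa [s] using hh₀
        have hgx : (h₀⁻¹ * h) • x = x := by
          rw [mul_smul, hhx, inv_smul_eq_iff, hh₀x]
        have hcomm : u * (h₀⁻¹ * h) = (h₀⁻¹ * h) * u := by
          have : h * u = h₀ * u * h₀⁻¹ * h := by
            rw [← hh'.2]; group
          rw [mul_assoc h₀⁻¹, this]; group
        simp only [t, Finset.coe_filter, Finset.mem_univ, true_and, Set.mem_ofPred_eq, hPmem]
        refine ⟨hgx, ?_⟩
        by_contra hnu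
        have hg1 : h₀⁻¹ * h ≠ 1 := fun h => hnu (h ▸ hU1)
        have hcard := hnU _ hg1 hnu
        obtain ⟨y, z, hyz, hfix⟩ := Set.ncard_eq_two.1 hcard
        obtain ⟨w, hwx, hw⟩ : ∃ w, w ≠ x ∧ fixedBy X (h₀⁻¹ * h) = {x, w} := by
          have hx' : x ∈ fixedBy X (h₀⁻¹ * h) := hgx
          rw [hfix] at hx'
          rcases hx' with rfl | hx'
          · exact ⟨z, hyz.symm, hfix⟩
          · rw [Set.mem_singleton_iff] at hx'
            subst hx'
            exact ⟨y, hyz, by rw [hfix, Set.pair_comm]⟩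
        have hw' : w ∈ fixedBy X (h₀⁻¹ * h) := by rw [hw]; simp
        have huw : u • w ∈ fixedBy X (h₀⁻¹ * h) := by
          rw [mem_fixedBy, ← mul_smul, ← hcomm, mul_smul, hw']
        rw [hw] at huw
        rcases huw with huw | huw
        · apply hwx
          rw [← huP.1] at huw
          exact smul_left_cancel _ huw
        · exact hwx (hPfix x u huP hu1 w huw)
      · intro a _ b _ hab
        exact mul_left_cancel hab
    calc e x = s.card := hs.symm
      _ ≤ Q x * (s.image (fun h => h * u * h⁻¹)).card :=
        Finset.card_le_mul_card_image _ _ hfib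
      _ ≤ Q x * (Q x - 1) := by
        apply Nat.mul_le_mul_left
        rw [← ht, ← Finset.card_erase_of_mem h1t]
        exact Finset.card_le_card himg
  have hcQ : ∀ x, ∃ f, c x = 1 + f * Q x := by
    intro x
    let Y : SubMulAction (P x) X :=
      { carrier := {y | y ∈ orbit H x ∧ y ≠ x}
        smul_mem' := fun g y hy => by
          refine ⟨?_, ?_⟩
          · rw [← orbit_eq_iff.2 hy.1]
            exact mem_orbit_iff.2 ⟨g, rfl⟩
          · intro h
            apply hy.2
            have h' : (g : H) • y = (g : H) • x := h.trans g.2.1.symm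
            exact smul_left_cancel _ h' }
    have hfree : ∀ y : Y, stabilizer (P x) y = ⊥ := by
      intro y
      rw [eq_bot_iff]
      intro g hg
      by_contra hg1
      apply y.2.2
      refine hPfix x g g.2 (fun h => hg1 (Subtype.ext h)) _ ?_
      exact congrArg Subtype.val (mem_stabilizer_iff.1 hg)
    have heq := Nat.card_congr (selfEquivOrbitsQuotientProd hfree)
    rw [Nat.card_prod] at heq
    refine ⟨Nat.card (Quotient (orbitRel (P x) Y)), ?_⟩
    have hY : c x = 1 + Nat.card Y := by
      have h1 : (orbit H x) = insert x (Y : Set X) := by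
        ext y
        by_cases hy : y = x
        · subst hy; simp [mem_orbit_self]
        · simp only [Set.mem_insert_iff, hy, false_or]
          exact ⟨fun h => ⟨h, hy⟩, fun h => h.1⟩
      have h2 : Nat.card Y = (Y : Set X).ncard := rfl
      have h3 : c x = (orbit H x).ncard := rfl
      rw [h3, h2, h1, Set.ncard_insert_of_notMem, add_comm]
      exact fun h => h.2 rfl
    rw [hY, heq]
  -- the weight of a point
  let w : X → ℕ := fun x =>
    (Finset.univ.filter (fun h : H => h ≠ 1 ∧ h • x = x)).card +
      (Finset.univ.filter (fun h : H => h ≠ 1 ∧ h • x = x ∧ U h)).card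
  have hw : ∀ x, w x + 2 = e x + Q x := by
    intro x
    have h1 : (Finset.univ.filter (fun h : H => h ≠ 1 ∧ h • x = x)).card + 1 = e x := by
      have : Finset.univ.filter (fun h : H => h ≠ 1 ∧ h • x = x) =
        (Finset.univ.filter (fun h : H => h • x = x)).erase 1 := by
        ext; simp
      rw [this, Finset.card_erase_add_one (by simp)]
      simp only [e]
      rw [Nat.card_eq_fintype_card, Fintype.card_subtype]
      rfl
    have h2 : (Finset.univ.filter (fun h : H => h ≠ 1 ∧ h • x = x ∧ U h)).card + 1 = Q x := by
      have : Finset.univ.filter (fun h : H => h ≠ 1 ∧ h • x = x ∧ U h) =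
        (Finset.univ.filter (fun h : H => h • x = x ∧ U h)).erase 1 := by
        ext; simp
      rw [this, Finset.card_erase_add_one (by simp [hU1])]
      simp only [Q]
      rw [Nat.card_eq_fintype_card, Fintype.card_subtype]
      simp only [hPmem]
    simp only [w]
    omega
  have hsum : ∑ x, w x + 2 = 2 * n := by
    have h1 : ∑ x, w x = ∑ h ∈ Finset.univ.filter (fun h : H => h ≠ 1), 2 := by
      simp only [w, Finset.card_filter, ← Finset.sum_add_distrib]
      rw [Finset.sum_comm, Finset.sum_filter]
      refine Finset.sum_congr rfl fun h _ => ?_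
      by_cases h1 : h = 1
      · simp [h1]
      have hcard : ∑ x : X, (if h • x = x then 1 else 0) = (fixedBy X h).ncard := by
        rw [← Finset.card_filter, Set.ncard_eq_toFinset_card']
        congr 1
        ext; simp
      by_cases hu : U h
      · simp only [h1, hu, ne_eq, not_false_eq_true, true_and, and_true, if_true,
          Finset.sum_add_distrib, hcard]
        rw [hUfix h h1 hu]
      · simp only [h1, hu, ne_eq, not_false_eq_true, true_and, and_false, if_true, if_false,
          add_zero, hcard]
        rw [hnU h h1 hu]
    rw [h1, Finset.sum_const, Finset.filter_ne', Finset.card_erase_of_mem (Finset.mem_univ _),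
      Finset.card_univ, hn, Nat.card_eq_fintype_card]
    have : 0 < Fintype.card H := Fintype.card_pos
    simp only [smul_eq_mul]
    omega
  -- invariance along orbits
  have hcinv : ∀ x y, orbit H x = orbit H y → c x = c y := fun x y h => by simp only [c]; rw [h]
  have heinv : ∀ x y, orbit H x = orbit H y → e x = e y := by
    intro x y h
    have h1 := hce x
    have h2 := hce y
    rw [hcinv x y h, ← h2] at h1
    exact Nat.eq_of_mul_eq_mul_left (hcpos y) h1
  have hQle : ∀ x (g : H), Q x ≤ Q (g • x) := by
    intro x g
    refine Nat.card_le_card_of_injective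
      (fun h : P x => (⟨g * h * g⁻¹, ?_, hUconj _ _ h.2.2⟩ : P (g • x))) ?_
    · rw [mul_smul, inv_smul_smul, mul_smul, h.2.1]
    · intro a b hab
      have := congrArg Subtype.val hab
      exact Subtype.ext (by simpa using this)
  have hQinv : ∀ x y, orbit H x = orbit H y → Q x = Q y := by
    intro x y h
    obtain ⟨g, rfl⟩ := orbit_eq_iff.1 h
    refine le_antisymm ?_ (hQle _ _)
    have := hQle (g • y) g⁻¹
    rwa [inv_smul_smul] at this
  -- elements of point stabilisers
  have htame : ∀ x h, h • x = x → orderOf h ∣ e x := fun x h hx =>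
    Subgroup.orderOf_dvd_natCard _ (mem_stabilizer_iff.2 hx)
  have hwild : ∀ x h k, h • x = x → e x = Q x * k → U h ∨ h ^ k = 1 := by
    intro x h k hx hk
    by_cases hu : U h
    · exact Or.inl hu
    right
    have hnormal : ((P x).subgroupOf (stabilizer H x)).Normal := by
      refine ⟨fun a ha g => ?_⟩
      rw [Subgroup.mem_subgroupOf] at ha ⊢
      have hg : (g : H) • x = x := g.2
      refine ⟨?_, hUconj _ _ ha.2⟩
      simp only [Subgroup.coe_mul, Subgroup.coe_inv]
      rw [mul_smul, mul_smul, inv_smul_eq_iff.2 hg.symm, ha.1, hg]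
    have hindex : ((P x).subgroupOf (stabilizer H x)).index = k := by
      have h1 := Subgroup.relIndex_mul_relIndex ⊥ (P x) (stabilizer H x) bot_le (hPle x)
      rw [Subgroup.relIndex_bot_left, Subgroup.relIndex_bot_left, mul_comm] at h1
      have h2 : (P x).relIndex (stabilizer H x) * Q x = k * Q x := by
        rw [mul_comm k, ← hk]; exact h1
      exact Nat.eq_of_mul_eq_mul_right (hQpos x) h2
    have hmem := Subgroup.pow_index_mem ((P x).subgroupOf (stabilizer H x)) ⟨h, hx⟩
    rw [hindex, Subgroup.mem_subgroupOf] at hmem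
    have hmem' : h ^ k ∈ P x := hmem
    by_contra hne
    have h1 : h ≠ 1 := fun h' => hu (h' ▸ hU1)
    obtain ⟨y, z, hyz, hfix⟩ := Set.ncard_eq_two.1 (hnU h h1 hu)
    have hall : ∀ y, y ∈ fixedBy X h → y = x := fun y hy =>
      hPfix x _ hmem' hne y (by
        have : h ∈ stabilizer H y := hy
        exact mem_stabilizer_iff.1 (pow_mem this k))
    apply hyz
    rw [hall y (by rw [hfix]; simp), hall z (by rw [hfix]; simp)]
  -- summation over orbits
  let Ω := orbitRel.Quotient H X
  let π : X → Ω := fun x => Quotient.mk'' x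
  have hπ : ∀ x y, π x = π y ↔ orbit H x = orbit H y := by
    intro x y
    rw [orbit_eq_iff]
    exact Quotient.eq''
  have hπout : ∀ ω : Ω, π ω.out = ω := fun ω => Quotient.out_eq' ω
  have hout : ∀ x, orbit H (π x).out = orbit H x := fun x => (hπ _ _).1 (hπout _)
  let N : Ω → ℕ := fun ω => c ω.out * w ω.out
  have hwinv : ∀ x y, orbit H x = orbit H y → w x = w y := by
    intro x y h
    have h1 := hw x
    have h2 := hw y
    rw [heinv x y h, hQinv x y h] at h1
    omega
  have hsumN : ∑ ω, N ω + 2 = 2 * n := by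
    rw [← hsum, ← Finset.sum_fiberwise_of_maps_to (s := Finset.univ) (t := Finset.univ) (g := π)
      (fun _ _ => Finset.mem_univ _)]
    congr 1
    refine Finset.sum_congr rfl fun ω _ => ?_
    rw [Finset.sum_congr rfl (g := fun _ => w ω.out)]
    · rw [Finset.sum_const, smul_eq_mul]
      change c ω.out * w ω.out = _
      congr 1
      change Nat.card (orbit H ω.out) = _
      rw [Nat.card_eq_fintype_card, ← Set.toFinset_card]
      congr 1
      ext y
      rw [Set.mem_toFinset, ← orbit_eq_iff, ← hπ, hπout]
      simp
    · intro x hx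
      apply hwinv
      rw [← hπ, hπout]
      exact (Finset.mem_filter.1 hx).2
  have hN : ∀ ω : Ω, N ω + 2 * c ω.out = n + c ω.out * Q ω.out := by
    intro ω
    have := hw ω.out
    rw [← hce ω.out]
    simp only [N]
    linear_combination (c ω.out) * this
  let W : Finset Ω := Finset.univ.filter (fun ω => N ω ≠ 0)
  have hsumW : ∑ ω ∈ W, N ω + 2 = 2 * n := by
    rw [← hsumN, Finset.sum_filter_ne_zero]
  have hNe : ∀ ω ∈ W, 2 ≤ e ω.out := by
    intro ω hω
    by_contra! h
    have h1 : e ω.out = 1 := by have := hepos ω.out; omega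
    have h2 : Q ω.out = 1 := Nat.dvd_one.1 (h1 ▸ hQe ω.out)
    have h3 := hw ω.out
    have h4 : w ω.out = 0 := by omega
    exact (Finset.mem_filter.1 hω).2 (by simp only [N]; rw [h4, mul_zero])
  have hNhalf : ∀ ω ∈ W, n ≤ 2 * N ω := by
    intro ω hω
    have h1 := hNe ω hω
    have h2 := hN ω
    have h3 : c ω.out * 2 ≤ n := hce ω.out ▸ Nat.mul_le_mul_left _ h1
    have h4 : c ω.out * 1 ≤ c ω.out * Q ω.out := Nat.mul_le_mul_left _ (hQpos _)
    omega
  have hn3 : 3 ≤ n := by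
    obtain ⟨x⟩ := ‹Nonempty X›
    have := Nat.le_mul_of_pos_right (c x) (hepos x)
    rw [hce] at this
    exact (hc3 x).trans this
  have hWcard : W.card ≤ 3 := by
    by_contra! h
    have h1 : W.card * n ≤ ∑ ω ∈ W, 2 * N ω := by
      rw [← smul_eq_mul]
      exact Finset.card_nsmul_le_sum _ _ _ hNhalf
    rw [← Finset.mul_sum] at h1
    have h2 : 4 * n ≤ W.card * n := Nat.mul_le_mul_right _ h
    omega
  have hcover : ∀ h : H, h ≠ 1 → ∃ ω ∈ W, ∃ x, h • x = x ∧ orbit H ω.out = orbit H x := by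
    intro h h1
    have : (fixedBy X h).Nonempty := by
      rw [← Set.ncard_pos]
      by_cases hu : U h
      · rw [hUfix h h1 hu]; norm_num
      · rw [hnU h h1 hu]; norm_num
    obtain ⟨x, hx⟩ := this
    refine ⟨π x, ?_, x, hx, hout x⟩
    simp only [W, Finset.mem_filter, Finset.mem_univ, true_and, N]
    apply mul_ne_zero (hcpos _).ne'
    rw [hwinv _ _ (hout x)]
    have : 0 < (Finset.univ.filter (fun h : H => h ≠ 1 ∧ h • x = x)).card :=
      Finset.card_pos.2 ⟨h, by simpa using ⟨h1, hx⟩⟩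
    simp only [w]
    omega
  by_cases hwild_ex : ∃ ω ∈ W, Q ω.out ≠ 1
  · obtain ⟨ω, hω, hQ1⟩ := hwild_ex
    have hQ3 : 3 ≤ Q ω.out := by
      obtain ⟨t, ht⟩ := hQodd ω.out
      omega
    have hsplit : N ω + ∑ ω' ∈ W.erase ω, N ω' = ∑ ω' ∈ W, N ω' := Finset.add_sum_erase W N hω
    have hNω := hN ω
    have hc := hc3 ω.out
    have hcQ3 : c ω.out * 3 ≤ c ω.out * Q ω.out := Nat.mul_le_mul_left _ hQ3
    obtain ⟨k, hk⟩ := hQe ω.out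
    obtain ⟨f, hf⟩ := hcQ ω.out
    have hn1 : c ω.out * (Q ω.out * k) = n := by rw [← hk]; exact hce _
    have hk1 : 1 ≤ k := by
      rcases Nat.eq_zero_or_pos k with rfl | h
      · rw [mul_zero, mul_zero] at hn1; omega
      · exact h
    have hkQ : k ≤ Q ω.out - 1 := by
      have := hek ω.out hQ1
      rw [hk] at this
      exact Nat.le_of_mul_le_mul_left this (hQpos _)
    have hf1 : 1 ≤ f := by
      rcases Nat.eq_zero_or_pos f with rfl | h
      · omega
      · exact h
    have hrest1 : (W.erase ω).card = 1 := by
      have hle : (W.erase ω).card ≤ 1 := by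
        by_contra! h
        have h1 : (W.erase ω).card * n ≤ ∑ ω' ∈ W.erase ω, 2 * N ω' := by
          rw [← smul_eq_mul]
          exact Finset.card_nsmul_le_sum _ _ _ (fun ω' h' => hNhalf ω' (Finset.mem_of_mem_erase h'))
        rw [← Finset.mul_sum] at h1
        have h2 : 2 * n ≤ (W.erase ω).card * n := Nat.mul_le_mul_right _ h
        omega
      have hne : (W.erase ω).card ≠ 0 := by
        intro h
        rw [Finset.card_eq_zero] at h
        rw [h, Finset.sum_empty] at hsplit
        have h2 : c ω.out * Q ω.out ≤ c ω.out * (Q ω.out * k) :=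
          Nat.mul_le_mul_left _ (Nat.le_mul_of_pos_right _ hk1)
        omega
      omega
    obtain ⟨ω', hω'⟩ := Finset.card_eq_one.1 hrest1
    have hω'W : ω' ∈ W := Finset.mem_of_mem_erase (hω' ▸ Finset.mem_singleton_self ω')
    have hne : ω' ≠ ω := Finset.ne_of_mem_erase (hω' ▸ Finset.mem_singleton_self ω')
    rw [hω', Finset.sum_singleton] at hsplit
    have hNω' := hN ω'
    have hcQ' : c ω'.out ≤ c ω'.out * Q ω'.out := Nat.le_mul_of_pos_right _ (hQpos _)
    have hQ' : Q ω'.out = 1 := by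
      by_contra h
      have : 3 ≤ Q ω'.out := by
        obtain ⟨t, ht⟩ := hQodd ω'.out
        have := hQpos ω'.out
        omega
      have := Nat.mul_le_mul_left (c ω'.out) this
      omega
    rw [hQ', mul_one] at hNω'
    have hc' : c ω'.out = c ω.out * (Q ω.out - 2) + 2 := by
      have h1 : c ω.out * (Q ω.out - 2) + 2 * c ω.out = c ω.out * Q ω.out := by
        rw [mul_comm 2, ← mul_add, Nat.sub_add_cancel (by omega)]
      omega
    have heq : k * (1 + f * Q ω.out) = e ω'.out * (1 + f * (Q ω.out - 2)) := by
      have h1 : c ω'.out = Q ω.out * (1 + f * (Q ω.out - 2)) := by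
        rw [hc', hf]
        obtain ⟨R, hR⟩ : ∃ R, Q ω.out = R + 2 := ⟨Q ω.out - 2, by omega⟩
        rw [hR, Nat.add_sub_cancel]
        ring
      have h2 := hce ω'.out
      rw [h1, ← hn1, hf] at h2
      refine Nat.eq_of_mul_eq_mul_left (hQpos ω.out) ?_
      linear_combination -h2
    have hcov : ∀ h : H, U h ∨ h ^ k = 1 ∨ h ^ e ω'.out = 1 := by
      intro h
      by_cases h1 : h = 1
      · exact Or.inl (h1 ▸ hU1)
      obtain ⟨ω₂, hω₂, x, hx, hxo⟩ := hcover h h1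
      by_cases h2 : ω₂ = ω
      · subst h2
        rw [heinv _ _ hxo, hQinv _ _ hxo] at hk
        rcases hwild x h k hx hk with h3 | h3
        · exact Or.inl h3
        · exact Or.inr (Or.inl h3)
      · have h3 : ω₂ ∈ W.erase ω := Finset.mem_erase.2 ⟨h2, hω₂⟩
        rw [hω', Finset.mem_singleton] at h3
        subst h3
        right; right
        rw [heinv _ _ hxo]
        exact orderOf_dvd_iff_pow_eq_one.1 (htame x h hx)
    rcases wild_pair hQ3 hf1 hkQ hk1 heq with ⟨rfl, hkd, hk2, hed⟩ | ⟨hQeq, hk2, he5⟩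
    · right
      obtain ⟨m, hm⟩ := hQℓ ω.out
      have hm0 : 1 ≤ m := by
        rw [Nat.one_le_iff_ne_zero]
        rintro rfl
        rw [pow_zero] at hm
        omega
      refine ⟨m, hm0, ?_, fun h => ?_⟩
      · rw [← hm, ← hn1, hf]
        obtain ⟨R, hR⟩ : ∃ R, Q ω.out = R + 1 := ⟨Q ω.out - 1, by omega⟩
        rw [hR] at hk2 ⊢
        have h1 : (R + 1) ^ 2 - 1 = R * (R + 2) := by
          rw [Nat.sub_eq_iff_eq_add (by nlinarith)]; ring
        rw [h1]
        calc (R + 1) * (R * (R + 2)) = ((R + 1) * (R + 2)) * R := by ring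
          _ ≤ ((R + 1) * (R + 2)) * (2 * k) := Nat.mul_le_mul_left _ (by omega)
          _ = 2 * ((1 + 1 * (R + 1)) * ((R + 1) * k)) := by ring
      · rw [← hm]
        rcases hcov h with h1 | h1 | h1
        · exact Or.inl h1
        · obtain ⟨t, ht⟩ := hkd
          exact Or.inr (Or.inl (by rw [ht, pow_mul, h1, one_pow]))
        · obtain ⟨t, ht⟩ := hed
          exact Or.inr (Or.inr (by rw [ht, pow_mul, h1, one_pow]))
    · left
      intro h
      obtain ⟨m, hm⟩ := hQℓ ω.out
      have hℓ3 : ℓ = 3 := by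
        rw [hQeq] at hm
        have : ℓ ∣ 3 := by
          rw [hm]
          apply dvd_pow_self
          rintro rfl
          norm_num at hm
        exact (Nat.prime_dvd_prime_iff_eq hℓ Nat.prime_three).1 this
      rcases hcov h with h1 | h1 | h1
      · have := hUpow h h1
        rw [hℓ3] at this
        exact (orderOf_le_of_pow_eq_one (by norm_num) this).trans (by norm_num)
      · rw [hk2] at h1
        exact (orderOf_le_of_pow_eq_one (by norm_num) h1).trans (by norm_num)
      · rw [he5] at h1
        exact orderOf_le_of_pow_eq_one (by norm_num) h1
  · push Not at hwild_ex
    left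
    intro h
    by_cases h1 : h = 1
    · rw [h1, orderOf_one]; norm_num
    obtain ⟨ω₁, hω₁, x, hx, hxo⟩ := hcover h h1
    have hdvd := htame x h hx
    rw [← heinv _ _ hxo] at hdvd
    refine (Nat.le_of_dvd (hepos _) hdvd).trans ?_
    have hNt : ∀ ω ∈ W, N ω + c ω.out = n := by
      intro ω hω
      have := hN ω
      rw [hwild_ex ω hω, mul_one] at this
      omega
    have hW3 : W.card = 3 := by
      have hpos : W.card ≠ 0 := (Finset.card_pos.2 ⟨ω₁, hω₁⟩).ne'
      have hcases : W.card = 1 ∨ W.card = 2 ∨ W.card = 3 := by omega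
      rcases hcases with h | h | h
      · obtain ⟨a, ha⟩ := Finset.card_eq_one.1 h
        have h1 := hNt a (by simp [ha])
        have h2 := hc3 a.out
        rw [ha, Finset.sum_singleton] at hsumW
        omega
      · obtain ⟨a, b, hab, ha⟩ := Finset.card_eq_two.1 h
        have h1 := hNt a (by simp [ha])
        have h1' := hNt b (by simp [ha])
        have h2 := hc3 a.out
        have h3 := hc3 b.out
        rw [ha, Finset.sum_pair hab] at hsumW
        omega
      · exact h
    have hrest : (W.erase ω₁).card = 2 := by rw [Finset.card_erase_of_mem hω₁, hW3]
    obtain ⟨a, b, hab, hWab⟩ := Finset.card_eq_two.1 hrest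
    have hsplit := Finset.add_sum_erase W N hω₁
    rw [hWab, Finset.sum_pair hab] at hsplit
    have haW : a ∈ W := Finset.mem_of_mem_erase (a := ω₁) (by simp [hWab])
    have hbW : b ∈ W := Finset.mem_of_mem_erase (a := ω₁) (by simp [hWab])
    have h1 := hNt a haW
    have h2 := hNt b hbW
    have h3 := hNt ω₁ hω₁
    exact tame_triple (hce a.out) (hce b.out) (hce ω₁.out) (hNe a haW) (hNe b hbW)
      (hc3 _) (hc3 _) (hc3 _) (by omega)

section TwoByTwo

open Matrix

variable {F : Type*} [Field F]

theorem mul_self_fin_two (M : Matrix (Fin 2) (Fin 2) F) :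
    M * M = M.trace • M - M.det • 1 := by
  ext i j
  fin_cases i <;> fin_cases j <;>
    simp [Matrix.mul_apply, Fin.sum_univ_two, trace_fin_two, det_fin_two] <;> ring

theorem mul_add_mul_of_trace_eq_zero {M N : Matrix (Fin 2) (Fin 2) F} (hM : M.trace = 0)
    (hN : N.trace = 0) : M * N + N * M = (M * N).trace • 1 := by
  rw [trace_fin_two] at hM hN
  ext i j
  fin_cases i <;> fin_cases j <;>
    simp [Matrix.mul_apply, Fin.sum_univ_two, trace_fin_two] <;> grind

/-- Commuting with a nonscalar `2 × 2` matrix. -/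
theorem exists_eq_smul_add_of_commute {M N : Matrix (Fin 2) (Fin 2) F}
    (hM : ∀ r : F, M ≠ r • 1) (h : M * N = N * M) : ∃ α β : F, N = α • 1 + β • M := by
  have h00 := congrFun (congrFun h 0) 0
  have h01 := congrFun (congrFun h 0) 1
  have h10 := congrFun (congrFun h 1) 0
  simp only [Matrix.mul_apply, Fin.sum_univ_two] at h00 h01 h10
  have key : ∀ β : F, N 0 1 = β * M 0 1 → N 1 0 = β * M 1 0 →
      N 0 0 - N 1 1 = β * (M 0 0 - M 1 1) → ∃ α β : F, N = α • 1 + β • M := by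
    intro β h1 h2 h3
    refine ⟨N 0 0 - β * M 0 0, β, ?_⟩
    ext i j
    fin_cases i <;> fin_cases j <;> simp <;> grind
  by_cases hb : M 0 1 = 0
  · by_cases hc : M 1 0 = 0
    · have hd : M 0 0 - M 1 1 ≠ 0 := by
        intro hd
        apply hM (M 0 0)
        ext i j
        fin_cases i <;> fin_cases j <;> simp [hb, hc]
        grind
      refine key ((N 0 0 - N 1 1) / (M 0 0 - M 1 1)) ?_ ?_ ?_
      · field_simp
        grind
      · field_simp
        grind
      · field_simp
    · refine key (N 1 0 / M 1 0) ?_ ?_ ?_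
      · field_simp
        grind
      · field_simp
      · field_simp
        grind
  · refine key (N 0 1 / M 0 1) ?_ ?_ ?_
    · field_simp
    · field_simp
      grind
    · field_simp
      grind

theorem commute_of_commute_of_ne_smul {M N L : Matrix (Fin 2) (Fin 2) F}
    (hM : ∀ r : F, M ≠ r • 1) (hN : M * N = N * M) (hL : M * L = L * M) : N * L = L * N := by
  obtain ⟨α, β, rfl⟩ := exists_eq_smul_add_of_commute hM hN
  rw [add_mul, mul_add, smul_mul_assoc, smul_mul_assoc, mul_smul_comm, mul_smul_comm, hL, one_mul,
    mul_one]

theorem eq_or_eq_neg_of_smul_one_mul {M : Matrix (Fin 2) (Fin 2) F} {r : F} (h : M = r • 1)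
    (hdet : M.det = 1) : M = 1 ∨ M = -1 := by
  have : r * r = 1 := by
    rw [h, det_fin_two] at hdet
    simpa using hdet
  rcases mul_self_eq_one_iff.1 this with rfl | rfl
  · left; simp [h]
  · right; simp [h]

/-- The square of the trace, as a function on `PSL(2, F)`. -/
def trSq (g : ProjectiveSpecialLinearGroup (Fin 2) F) : F :=
  Quotient.liftOn' g (fun M : Matrix.SpecialLinearGroup (Fin 2) F => (M.1.trace) ^ 2) (by
    intro M N h
    rw [QuotientGroup.leftRel_apply, Matrix.SpecialLinearGroup.mem_center_iff] at h
    obtain ⟨r, hr, h⟩ := h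
    have h1 : N.1 = r • M.1 := by
      have : N = M * (M⁻¹ * N) := by group
      rw [this, Matrix.SpecialLinearGroup.coe_mul, ← h]
      simp [smul_eq_mul_diagonal, scalar_apply]
    rw [Fintype.card_fin] at hr
    simp only [h1, trace_smul, smul_eq_mul, mul_pow, hr, one_mul])

theorem trSq_mk (M : Matrix.SpecialLinearGroup (Fin 2) F) :
    trSq (M : ProjectiveSpecialLinearGroup (Fin 2) F) = M.1.trace ^ 2 := rfl

theorem psl_mk_eq_one_iff (M : Matrix.SpecialLinearGroup (Fin 2) F) :
    (M : ProjectiveSpecialLinearGroup (Fin 2) F) = 1 ↔ M.1 = 1 ∨ M.1 = -1 := by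
  rw [QuotientGroup.eq_one_iff, Matrix.SpecialLinearGroup.mem_center_iff]
  constructor
  · rintro ⟨r, hr, h⟩
    apply eq_or_eq_neg_of_smul_one_mul (r := r) _ M.2
    rw [← h]; ext i j; fin_cases i <;> fin_cases j <;> simp
  · rintro (h | h)
    · exact ⟨1, by simp, by simp [h]⟩
    · exact ⟨-1, by simp, by rw [h]; ext i j; fin_cases i <;> fin_cases j <;> simp⟩

theorem psl_mk_eq_iff (M N : Matrix.SpecialLinearGroup (Fin 2) F) :
    (M : ProjectiveSpecialLinearGroup (Fin 2) F) = N ↔ N.1 = M.1 ∨ N.1 = -M.1 := by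
  rw [← inv_mul_eq_one]
  have : (M : ProjectiveSpecialLinearGroup (Fin 2) F)⁻¹ * N = ((M⁻¹ * N : Matrix.SpecialLinearGroup _ F) :
    ProjectiveSpecialLinearGroup (Fin 2) F) := rfl
  rw [this, psl_mk_eq_one_iff]
  have h : N.1 = M.1 * (M⁻¹ * N).1 := by
    rw [← Matrix.SpecialLinearGroup.coe_mul, mul_inv_cancel_left]
  constructor
  · rintro (h1 | h1)
    · left; rw [h, h1, mul_one]
    · right; rw [h, h1, mul_neg, mul_one]
  · rintro (h1 | h1)
    · left
      have : N = M := Subtype.ext h1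
      rw [this]; simp
    · right
      have : N = -M := Subtype.ext h1
      rw [this]; simp

theorem ne_smul_one_of_psl_ne_one {M : Matrix.SpecialLinearGroup (Fin 2) F}
    (h : (M : ProjectiveSpecialLinearGroup (Fin 2) F) ≠ 1) (r : F) : M.1 ≠ r • 1 :=
  fun hr => h ((psl_mk_eq_one_iff M).2 (eq_or_eq_neg_of_smul_one_mul hr M.2))

theorem psl_commute_iff (M N : Matrix.SpecialLinearGroup (Fin 2) F) :
    Commute (M : ProjectiveSpecialLinearGroup (Fin 2) F) N ↔
      M.1 * N.1 = N.1 * M.1 ∨ M.1 * N.1 = -(N.1 * M.1) := by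
  have h := psl_mk_eq_iff (N * M) (M * N)
  rw [Matrix.SpecialLinearGroup.coe_mul, Matrix.SpecialLinearGroup.coe_mul] at h
  rw [← h]
  exact eq_comm

theorem trSq_one : trSq (1 : ProjectiveSpecialLinearGroup (Fin 2) F) = 4 := by
  have := trSq_mk (1 : Matrix.SpecialLinearGroup (Fin 2) F)
  rw [QuotientGroup.mk_one] at this
  rw [this]
  simp [trace_one]; norm_num

theorem trace_eq_zero_of_orderOf_eq_two {M : Matrix.SpecialLinearGroup (Fin 2) F}
    (h : orderOf (M : ProjectiveSpecialLinearGroup (Fin 2) F) = 2) :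
    M.1.trace = 0 := by
  obtain ⟨h2, h1⟩ := orderOf_eq_prime_iff.1 h
  rw [← QuotientGroup.mk_pow, psl_mk_eq_one_iff, Matrix.SpecialLinearGroup.coe_pow, pow_two,
    mul_self_fin_two, M.2, one_smul] at h2
  by_contra ht
  have key : ∀ s : F, M.1.trace • M.1 = s • 1 → False := by
    intro s hs
    apply ne_smul_one_of_psl_ne_one h1 (M.1.trace⁻¹ * s)
    rw [mul_smul, ← hs, smul_smul, inv_mul_cancel₀ ht, one_smul]
  rcases h2 with h2 | h2
  · apply key 2
    rw [sub_eq_iff_eq_add.1 h2, two_smul]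
  · apply key 0
    rw [sub_eq_iff_eq_add.1 h2]; simp

theorem mul_self_eq_neg_one {M : Matrix (Fin 2) (Fin 2) F} (hdet : M.det = 1)
    (htr : M.trace = 0) : M * M = -1 := by
  rw [mul_self_fin_two, hdet, htr]; simp

/-- The possible values of `trSq` on nontrivial elements of small order. -/
theorem trSq_of_orderOf_le {g : ProjectiveSpecialLinearGroup (Fin 2) F} [Finite F] (hg : g ≠ 1)
    (h : orderOf g ≤ 5) :
    trSq g = 0 ∨ trSq g = 1 ∨ trSq g = 2 ∨ trSq g ^ 2 - 3 * trSq g + 1 = 0 := by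
  induction g using QuotientGroup.induction_on with | H M =>
  have hns := ne_smul_one_of_psl_ne_one hg
  rw [trSq_mk]
  set t := M.1.trace with ht
  have hpow : (M : ProjectiveSpecialLinearGroup (Fin 2) F) ^
    orderOf (M : ProjectiveSpecialLinearGroup (Fin 2) F) = 1 := pow_orderOf_eq_one _
  have hpos : 0 < orderOf (M : ProjectiveSpecialLinearGroup (Fin 2) F) := orderOf_pos _
  have h1 : orderOf (M : ProjectiveSpecialLinearGroup (Fin 2) F) ≠ 1 := by
    rwa [Ne, orderOf_eq_one_iff]
  generalize orderOf (M : ProjectiveSpecialLinearGroup (Fin 2) F) = n at *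
  rw [← QuotientGroup.mk_pow, psl_mk_eq_one_iff, Matrix.SpecialLinearGroup.coe_pow] at hpow
  have hsq : M.1 * M.1 = t • M.1 - 1 := by rw [mul_self_fin_two, M.2, one_smul]
  have hscal : ∃ s : F, M.1 ^ n = s • 1 := by
    rcases hpow with h | h
    · exact ⟨1, by rw [h, one_smul]⟩
    · exact ⟨-1, by rw [h]; simp⟩
  obtain ⟨s, hs⟩ := hscal
  have key : ∀ p q : F, M.1 ^ n = p • M.1 - q • 1 → p = 0 := by
    intro p q hpq
    by_contra hp
    apply hns (p⁻¹ * (s + q))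
    rw [mul_smul, add_smul, ← hs, hpq, sub_add_cancel, smul_smul, inv_mul_cancel₀ hp, one_smul]
  have hstep : ∀ (k : ℕ) (p q : F), M.1 ^ k = p • M.1 - q • 1 →
      M.1 ^ (k + 1) = (p * t - q) • M.1 - p • 1 := by
    intro k p q hk
    rw [pow_succ, hk, sub_mul, smul_mul_assoc, hsq, smul_mul_assoc, one_mul, smul_sub, sub_smul,
      smul_smul]
    abel
  have e1 : M.1 ^ 1 = (1 : F) • M.1 - (0 : F) • 1 := by simp
  have e2 := hstep _ _ _ e1
  have e3 := hstep _ _ _ e2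
  have e4 := hstep _ _ _ e3
  have e5 := hstep _ _ _ e4
  have hn : n = 2 ∨ n = 3 ∨ n = 4 ∨ n = 5 := by omega
  rcases hn with rfl | rfl | rfl | rfl
  · have := key _ _ e2
    left; grind
  · have := key _ _ e3
    right; left; grind
  · have := key _ _ e4
    have h0 : t * (t ^ 2 - 2) = 0 := by linear_combination this
    rcases mul_eq_zero.1 h0 with h | h
    · left; grind
    · right; right; left; grind
  · have := key _ _ e5
    right; right; right; linear_combination this

end TwoByTwo

section Quad

open Matrix

variable {F : Type*} [Field F]

/-- Lifts to `SL(2, F)` of four involutions satisfying the string condition. -/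
structure IsStringQuad (A B C D : Matrix (Fin 2) (Fin 2) F) : Prop where
  detA : A.det = 1
  detB : B.det = 1
  detC : C.det = 1
  detD : D.det = 1
  trA : A.trace = 0
  trB : B.trace = 0
  trC : C.trace = 0
  trD : D.trace = 0
  trAC : (A * C).trace = 0
  trAD : (A * D).trace = 0
  trBD : (B * D).trace = 0

theorem mul_eq_neg_mul_of_trace {M N : Matrix (Fin 2) (Fin 2) F} (hM : M.trace = 0)
    (hN : N.trace = 0) (h : (M * N).trace = 0) : N * M = -(M * N) := by
  have := mul_add_mul_of_trace_eq_zero hM hN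
  rw [h, zero_smul] at this
  exact eq_neg_of_add_eq_zero_right this

theorem IsStringQuad.reverse {A B C D : Matrix (Fin 2) (Fin 2) F} (h : IsStringQuad A B C D) :
    IsStringQuad D C B A where
  detA := h.detD
  detB := h.detC
  detC := h.detB
  detD := h.detA
  trA := h.trD
  trB := h.trC
  trC := h.trB
  trD := h.trA
  trAC := by rw [trace_mul_comm, h.trBD]
  trAD := by rw [trace_mul_comm, h.trAD]
  trBD := by rw [trace_mul_comm, h.trAC]

theorem IsStringQuad.map {E : Type*} [Field E] (f : F →+* E) {A B C D : Matrix (Fin 2) (Fin 2) F}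
    (h : IsStringQuad A B C D) :
    IsStringQuad (A.map f) (B.map f) (C.map f) (D.map f) := by
  have hd : ∀ M : Matrix (Fin 2) (Fin 2) F, M.det = 1 → (M.map f).det = 1 := fun M hM => by
    rw [← RingHom.mapMatrix_apply, ← RingHom.map_det, hM, map_one]
  have ht : ∀ M : Matrix (Fin 2) (Fin 2) F, M.trace = 0 → (M.map f).trace = 0 := fun M hM => by
    rw [trace_fin_two] at hM ⊢
    simp only [map_apply, ← map_add, hM, map_zero]
  have htt : ∀ M N : Matrix (Fin 2) (Fin 2) F, (M * N).trace = 0 →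
      (M.map f * N.map f).trace = 0 := fun M N hM => by
    rw [← Matrix.map_mul]; exact ht _ hM
  exact ⟨hd _ h.detA, hd _ h.detB, hd _ h.detC, hd _ h.detD, ht _ h.trA, ht _ h.trB, ht _ h.trC,
    ht _ h.trD, htt _ _ h.trAC, htt _ _ h.trAD, htt _ _ h.trBD⟩

/-- If `A` and `D` are anticommuting square roots of `-1`, then every traceless matrix orthogonal
to `D` is a combination of `A` and `A * D`. -/
theorem exists_eq_smul_add_smul_mul (h2 : (2 : F) ≠ 0) {A B D : Matrix (Fin 2) (Fin 2) F}
    (hA : A.det = 1) (hB : B.det = 1) (hD : D.det = 1)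
    (tA : A.trace = 0) (tB : B.trace = 0) (tD : D.trace = 0)
    (tAD : (A * D).trace = 0) (tBD : (B * D).trace = 0) :
    ∃ x s : F, B = x • A + s • (A * D) ∧ x ^ 2 + s ^ 2 = 1 ∧ (A * B).trace = -2 * x := by
  have hAA := mul_self_eq_neg_one hA tA
  have hDD := mul_self_eq_neg_one hD tD
  have hBB := mul_self_eq_neg_one hB tB
  have hDA := mul_eq_neg_mul_of_trace tA tD tAD
  have hDB := mul_eq_neg_mul_of_trace tB tD tBD
  have hAB := mul_add_mul_of_trace_eq_zero tA tB
  have hBJ := mul_add_mul_of_trace_eq_zero tB tAD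
  set t := (A * B).trace with ht
  set s := (B * (A * D)).trace
  have hJJ : A * D * (A * D) = -1 := by
    rw [mul_assoc, ← mul_assoc D, hDA, neg_mul, mul_assoc, hDD]; simp [hAA]
  have h1 : A * D * B = B * (A * D) - t • D := by
    have : B * A = t • 1 - A * B := by rw [← hAB]; abel
    rw [← mul_assoc, this, sub_mul, smul_mul_assoc, one_mul, mul_assoc A B D, mul_assoc A D B, hDB,
      mul_neg]
    abel
  rw [h1] at hBJ
  have h3 : (2 : F) • (B * (A * D)) = s • 1 + t • D := by
    rw [← hBJ, two_smul]; abel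
  have hDJ : D * (A * D) = A := by
    rw [← mul_assoc, hDA, neg_mul, mul_assoc, hDD]; simp
  have h4 : (-2 : F) • B = t • A + s • (A * D) := by
    have := congrArg (· * (A * D)) h3
    simp only [smul_mul_assoc, add_mul, one_mul, hDJ] at this
    rw [mul_assoc, hJJ, mul_neg, mul_one, smul_neg, ← neg_smul] at this
    rw [this, add_comm]
  have h5 : B = (-t / 2) • A + (-s / 2) • (A * D) := by
    have : B = (-2 : F)⁻¹ • ((-2 : F) • B) := by
      rw [smul_smul, inv_mul_cancel₀ (neg_ne_zero.2 h2), one_smul]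
    rw [this, h4, smul_add, smul_smul, smul_smul]
    congr 2 <;> field_simp
  refine ⟨-t / 2, -s / 2, h5, ?_, by field_simp⟩
  generalize -t / 2 = x at *
  generalize -s / 2 = y at *
  have hAJ : A * (A * D) = -D := by rw [← mul_assoc, hAA, neg_one_mul]
  have hJA : A * D * A = D := by rw [mul_assoc, hDA, mul_neg, hAJ, neg_neg]
  rw [h5] at hBB
  simp only [add_mul, mul_add, smul_mul_assoc, mul_smul_comm, hAA, hAJ, hJA, hJJ] at hBB
  have := congrFun (congrFun hBB 0) 0
  simp at this
  linear_combination -this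

theorem IsStringQuad.exists_coords (h2 : (2 : F) ≠ 0) {A B C D : Matrix (Fin 2) (Fin 2) F}
    (h : IsStringQuad A B C D) :
    ∃ x s z w : F, B = x • A + s • (A * D) ∧ C = z • D + w • (A * D) ∧
      x ^ 2 + s ^ 2 = 1 ∧ z ^ 2 + w ^ 2 = 1 ∧ (A * B).trace = -2 * x ∧ (C * D).trace = -2 * z ∧
      (B * C).trace = -2 * s * w := by
  have hDA := mul_eq_neg_mul_of_trace h.trA h.trD h.trAD
  have hAA := mul_self_eq_neg_one h.detA h.trA
  have hDD := mul_self_eq_neg_one h.detD h.trD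
  obtain ⟨x, s, hB, hxs, hx⟩ := exists_eq_smul_add_smul_mul h2 h.detA h.detB h.detD h.trA h.trB
    h.trD h.trAD h.trBD
  obtain ⟨z, w, hC, hzw, hz⟩ := exists_eq_smul_add_smul_mul h2 h.detD h.detC h.detA h.trD h.trC
    h.trA (by rw [trace_mul_comm, h.trAD]) (by rw [trace_mul_comm, h.trAC])
  rw [hDA, smul_neg, ← neg_smul] at hC
  refine ⟨x, s, z, -w, hB, hC, hxs, by rw [neg_sq, hzw], hx, by rw [trace_mul_comm, hz], ?_⟩
  have hJJ : A * D * (A * D) = -1 := by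
    rw [mul_assoc, ← mul_assoc D, hDA, neg_mul, mul_assoc, hDD]; simp [hAA]
  have hAJ : A * (A * D) = -D := by rw [← mul_assoc, hAA, neg_one_mul]
  have hJD : A * D * D = -A := by rw [mul_assoc, hDD, mul_neg, mul_one]
  rw [hB, hC]
  simp only [add_mul, mul_add, smul_mul_assoc, mul_smul_comm, hAJ, hJD, hJJ, trace_add, trace_smul,
    trace_neg, h.trA, h.trD, h.trAD, trace_one, smul_eq_mul, Fintype.card_fin]
  push_cast
  ring

theorem exists_mul_eq_mul_rotation (h2 : (2 : F) ≠ 0) {A : Matrix (Fin 2) (Fin 2) F}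
    (hA : A.det = 1) (tA : A.trace = 0) :
    ∃ g : (Matrix (Fin 2) (Fin 2) F)ˣ, A * g.1 = g.1 * !![0, -1; 1, 0] := by
  rw [det_fin_two] at hA
  rw [trace_fin_two] at tA
  have key : ∀ v w : F, v * (A 1 0 * v + A 1 1 * w) - w * (A 0 0 * v + A 0 1 * w) ≠ 0 →
      ∃ g : (Matrix (Fin 2) (Fin 2) F)ˣ, A * g.1 = g.1 * !![0, -1; 1, 0] := by
    intro v w hvw
    have hu : IsUnit (!![v, A 0 0 * v + A 0 1 * w; w, A 1 0 * v + A 1 1 * w] :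
        Matrix (Fin 2) (Fin 2) F) := by
      rw [isUnit_iff_isUnit_det, det_fin_two_of, isUnit_iff_ne_zero]
      convert hvw using 1
      ring
    obtain ⟨g, hg⟩ := hu
    refine ⟨g, ?_⟩
    rw [hg]
    ext i j
    fin_cases i <;> fin_cases j <;> simp [Matrix.mul_apply, Fin.sum_univ_two] <;> grind
  by_cases hr : A 1 0 = 0
  · by_cases hq : A 0 1 = 0
    · refine key 1 1 ?_
      intro h
      have : 2 * A 0 0 = 0 := by grind
      have h0 : A 0 0 = 0 := by simpa [h2] using this
      grind
    · refine key 0 1 ?_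
      grind
  · refine key 1 0 ?_
    grind

theorem exists_unit_intertwining (h2 : (2 : F) ≠ 0) {A D A' D' : Matrix (Fin 2) (Fin 2) F}
    (hA : A.det = 1) (hD : D.det = 1) (tA : A.trace = 0) (tD : D.trace = 0)
    (tAD : (A * D).trace = 0)
    (hA' : A'.det = 1) (hD' : D'.det = 1) (tA' : A'.trace = 0) (tD' : D'.trace = 0)
    (tAD' : (A' * D').trace = 0) :
    ∃ u : (Matrix (Fin 2) (Fin 2) F)ˣ, u.1 * A = A' * u.1 ∧ u.1 * D = D' * u.1 := by
  obtain ⟨g, hg⟩ := exists_mul_eq_mul_rotation h2 hA tA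
  obtain ⟨g', hg'⟩ := exists_mul_eq_mul_rotation h2 hA' tA'
  have form : ∀ (g : (Matrix (Fin 2) (Fin 2) F)ˣ) (A D : Matrix (Fin 2) (Fin 2) F),
      A * g.1 = g.1 * !![0, -1; 1, 0] → D.det = 1 → A.trace = 0 → D.trace = 0 → (A * D).trace = 0 →
      ∃ s t : F, s ^ 2 + t ^ 2 = -1 ∧ D * g.1 = g.1 * !![s, t; t, -s] := by
    intro g A D hg hD tA tD tAD
    set E := (g⁻¹).1 * D * g.1 with hE
    have hDg : D * g.1 = g.1 * E := by rw [hE, mul_assoc, Units.mul_inv_cancel_left]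
    have hdE : E.det = 1 := by
      have := congrArg det hDg
      rw [det_mul, det_mul, hD, one_mul] at this
      have hu : (g : Matrix (Fin 2) (Fin 2) F).det ≠ 0 :=
        ((isUnit_iff_isUnit_det _).1 g.isUnit).ne_zero
      exact mul_left_cancel₀ hu (by rw [← this, mul_one])
    have htE : E.trace = 0 := by
      rw [hE, trace_mul_comm, ← mul_assoc, Units.mul_inv, one_mul, tD]
    have hanti : E * !![0, -1; 1, 0] = -(!![0, -1; 1, 0] * E) := by
      have hDA := mul_eq_neg_mul_of_trace tA tD tAD
      have h1 : (g : Matrix (Fin 2) (Fin 2) F) * (E * !![0, -1; 1, 0]) =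
          g.1 * -(!![0, -1; 1, 0] * E) := by
        rw [← mul_assoc, ← hDg, mul_assoc, ← hg, mul_neg, ← mul_assoc, ← mul_assoc, ← hg,
          mul_assoc A, ← hDg, hDA, neg_mul, mul_assoc]
      exact g.isUnit.mul_left_cancel h1
    rw [det_fin_two] at hdE
    rw [trace_fin_two] at htE
    have h00 := congrFun (congrFun hanti 0) 0
    simp [Matrix.mul_apply, Fin.sum_univ_two, vecMul, dotProduct] at h00
    refine ⟨E 0 0, E 0 1, by grind, ?_⟩
    rw [hDg]
    congr 1
    ext i j
    fin_cases i <;> fin_cases j <;> simp <;> grind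
  obtain ⟨s, t, hst, hDg⟩ := form g A D hg hD tA tD tAD
  obtain ⟨s', t', hst', hDg'⟩ := form g' A' D' hg' hD' tA' tD' tAD'
  have transfer : ∀ k : (Matrix (Fin 2) (Fin 2) F)ˣ,
      ∀ A A' R R' : Matrix (Fin 2) (Fin 2) F, A * g.1 = g.1 * R → A' * g'.1 = g'.1 * R' →
      k.1 * R = R' * k.1 → (g' * k * g⁻¹ : (Matrix (Fin 2) (Fin 2) F)ˣ).1 * A =
        A' * (g' * k * g⁻¹ : (Matrix (Fin 2) (Fin 2) F)ˣ).1 := by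
    intro k A A' R R' h h' hk
    have h1 : (g⁻¹).1 * A = R * (g⁻¹).1 := by
      rw [Units.inv_mul_eq_iff_eq_mul, ← mul_assoc, ← h, mul_assoc, Units.mul_inv, mul_one]
    simp only [Units.val_mul]
    rw [mul_assoc, h1, ← mul_assoc, mul_assoc _ (k : Matrix (Fin 2) (Fin 2) F), hk, ← mul_assoc,
      ← h']
    simp only [mul_assoc]
  suffices ∃ k : (Matrix (Fin 2) (Fin 2) F)ˣ, k.1 * !![0, -1; 1, 0] = !![0, -1; 1, 0] * k.1 ∧
      k.1 * !![s, t; t, -s] = !![s', t'; t', -s'] * k.1 by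
    obtain ⟨k, hk1, hk2⟩ := this
    exact ⟨g' * k * g⁻¹, transfer k _ _ _ _ hg hg' hk1, transfer k _ _ _ _ hDg hDg' hk2⟩
  by_cases hp : s * s' + t * t' = 1
  · have hs : s' = -s := by grind
    have ht : t' = -t := by grind
    have hu : IsUnit (!![0, -1; 1, 0] : Matrix (Fin 2) (Fin 2) F) := by
      rw [isUnit_iff_isUnit_det, det_fin_two_of]; simp
    obtain ⟨k, hk⟩ := hu
    refine ⟨k, by rw [hk], ?_⟩
    rw [hk, hs, ht]
    ext i j
    fin_cases i <;> fin_cases j <;> simp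
  · have hu : IsUnit (!![1 - (s * s' + t * t'), t' * s - s' * t;
        s' * t - t' * s, 1 - (s * s' + t * t')] : Matrix (Fin 2) (Fin 2) F) := by
      rw [isUnit_iff_isUnit_det, det_fin_two_of, isUnit_iff_ne_zero]
      intro h
      have : (2 : F) * (1 - (s * s' + t * t')) = 0 := by grind
      rcases mul_eq_zero.1 this with h | h
      · exact h2 h
      · exact hp (by linear_combination -h)
    obtain ⟨k, hk⟩ := hu
    refine ⟨k, ?_, ?_⟩
    · rw [hk]
      ext i j
      fin_cases i <;> fin_cases j <;> simp
    · rw [hk]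
      ext i j
      fin_cases i <;> fin_cases j <;> simp <;> grind

/-- Two string quadruples with the same invariants are conjugate up to signs. -/
theorem IsStringQuad.exists_conj (h2 : (2 : F) ≠ 0) {A B C D A' B' C' D' : Matrix (Fin 2) (Fin 2) F}
    (h : IsStringQuad A B C D) (h' : IsStringQuad A' B' C' D')
    (hX : (A * B).trace ^ 2 = (A' * B').trace ^ 2) (hZ : (C * D).trace ^ 2 = (C' * D').trace ^ 2) :
    ∃ u : (Matrix (Fin 2) (Fin 2) F)ˣ,
      (u.1 * A = A' * u.1 ∨ u.1 * A = -(A' * u.1)) ∧ (u.1 * B = B' * u.1 ∨ u.1 * B = -(B' * u.1)) ∧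
      (u.1 * C = C' * u.1 ∨ u.1 * C = -(C' * u.1)) ∧ (u.1 * D = D' * u.1 ∨ u.1 * D = -(D' * u.1)) := by
  obtain ⟨x, s, z, w, hB, hC, hxs, hzw, hx, hz, -⟩ := h.exists_coords h2
  obtain ⟨x', s', z', w', hB', hC', hxs', hzw', hx', hz', -⟩ := h'.exists_coords h2
  obtain ⟨u, huA, huD⟩ := exists_unit_intertwining h2 h.detA h.detD h.trA h.trD h.trAD h'.detA
    h'.detD h'.trA h'.trD h'.trAD
  have hDA := mul_eq_neg_mul_of_trace h'.trA h'.trD h'.trAD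
  have h4 : (4 : F) ≠ 0 := by
    have : (4 : F) = 2 * 2 := by norm_num
    rw [this]; exact mul_ne_zero h2 h2
  have hx2 : x ^ 2 = x' ^ 2 := by
    rw [hx, hx'] at hX
    exact mul_left_cancel₀ h4 (by linear_combination hX)
  have hz2 : z ^ 2 = z' ^ 2 := by
    rw [hz, hz'] at hZ
    exact mul_left_cancel₀ h4 (by linear_combination hZ)
  have hs2 : s ^ 2 = s' ^ 2 := by linear_combination hxs - hxs' - hx2
  have hw2 : w ^ 2 = w' ^ 2 := by linear_combination hzw - hzw' - hz2
  have finish : ∀ (v : (Matrix (Fin 2) (Fin 2) F)ˣ) (a d : F), (a = 1 ∨ a = -1) →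
      (d = 1 ∨ d = -1) → v.1 * A = a • (A' * v.1) → v.1 * D = d • (D' * v.1) →
      ((x * a = x' ∧ s * (a * d) = s') ∨ (x * a = -x' ∧ s * (a * d) = -s')) →
      ((z * d = z' ∧ w * (a * d) = w') ∨ (z * d = -z' ∧ w * (a * d) = -w')) →
      ∃ u : (Matrix (Fin 2) (Fin 2) F)ˣ,
      (u.1 * A = A' * u.1 ∨ u.1 * A = -(A' * u.1)) ∧ (u.1 * B = B' * u.1 ∨ u.1 * B = -(B' * u.1)) ∧
      (u.1 * C = C' * u.1 ∨ u.1 * C = -(C' * u.1)) ∧ (u.1 * D = D' * u.1 ∨ u.1 * D = -(D' * u.1)) := by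
    intro v a d ha hd hvA hvD h1 h3
    have hvJ : v.1 * (A * D) = (a * d) • (A' * D' * v.1) := by
      rw [← mul_assoc, hvA, smul_mul_assoc, mul_assoc, hvD, mul_smul_comm, smul_smul, mul_assoc]
    refine ⟨v, ?_, ?_, ?_, ?_⟩
    · rw [hvA]
      rcases ha with rfl | rfl
      · left; simp
      · right; simp
    · have : v.1 * B = ((x * a) • A' + (s * (a * d)) • (A' * D')) * v.1 := by
        rw [hB, mul_add, mul_smul_comm, mul_smul_comm, hvA, hvJ, add_mul, smul_mul_assoc,
          smul_mul_assoc, smul_smul, smul_smul]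
      rw [this, hB']
      rcases h1 with ⟨e1, e2⟩ | ⟨e1, e2⟩
      · left; rw [e1, e2]
      · right; rw [e1, e2, ← neg_mul, neg_add, neg_smul, neg_smul]
    · have : v.1 * C = ((z * d) • D' + (w * (a * d)) • (A' * D')) * v.1 := by
        rw [hC, mul_add, mul_smul_comm, mul_smul_comm, hvD, hvJ, add_mul, smul_mul_assoc,
          smul_mul_assoc, smul_smul, smul_smul]
      rw [this, hC']
      rcases h3 with ⟨e1, e2⟩ | ⟨e1, e2⟩
      · left; rw [e1, e2]
      · right; rw [e1, e2, ← neg_mul, neg_add, neg_smul, neg_smul]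
    · rw [hvD]
      rcases hd with rfl | rfl
      · left; simp
      · right; simp
  have uA : IsUnit A' := by rw [isUnit_iff_isUnit_det, h'.detA]; exact isUnit_one
  have uD : IsUnit D' := by rw [isUnit_iff_isUnit_det, h'.detD]; exact isUnit_one
  obtain ⟨α, hα⟩ := uA
  obtain ⟨δ, hδ⟩ := uD
  have f1 := finish u 1 1 (Or.inl rfl) (Or.inl rfl) (by rw [one_smul, huA]) (by rw [one_smul, huD])
  have f2 := finish (α * u) 1 (-1) (Or.inl rfl) (Or.inr rfl)
    (by rw [Units.val_mul, mul_assoc, huA, hα, one_smul])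
    (by rw [Units.val_mul, mul_assoc, huD, hα, ← mul_assoc, ← mul_assoc, hDA, neg_mul, smul_neg,
          neg_smul, one_smul, neg_neg])
  have f3 := finish (δ * u) (-1) 1 (Or.inr rfl) (Or.inl rfl)
    (by rw [Units.val_mul, mul_assoc, huA, hδ, ← mul_assoc, hDA, ← mul_assoc, neg_mul, neg_smul,
          one_smul])
    (by rw [Units.val_mul, mul_assoc, huD, hδ, one_smul])
  have f4 := finish (α * (δ * u)) (-1) (-1) (Or.inr rfl) (Or.inr rfl)
    (by rw [Units.val_mul, Units.val_mul, hα, hδ, mul_assoc, mul_assoc, huA, ← mul_assoc D', hDA,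
          neg_mul, mul_neg, neg_smul, one_smul, mul_assoc])
    (by rw [Units.val_mul, Units.val_mul, hα, hδ, mul_assoc, mul_assoc, huD, ← mul_assoc D' A',
          hDA, neg_mul, neg_smul, one_smul, neg_neg, mul_assoc])
  rcases sq_eq_sq_iff_eq_or_eq_neg.1 hx2 with rfl | rfl <;>
  rcases sq_eq_sq_iff_eq_or_eq_neg.1 hs2 with rfl | rfl <;>
  rcases sq_eq_sq_iff_eq_or_eq_neg.1 hz2 with rfl | rfl <;>
  rcases sq_eq_sq_iff_eq_or_eq_neg.1 hw2 with rfl | rfl <;>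
  first
  | (refine f1 ?_ ?_ <;> simp; done)
  | (refine f2 ?_ ?_ <;> simp; done)
  | (refine f3 ?_ ?_ <;> simp; done)
  | (refine f4 ?_ ?_ <;> simp)

end Quad

section Generation

open Matrix

variable {F : Type*} [Field F]

/-- Four elements of `SL(2, F)` whose images in `PSL(2, F)` are involutions satisfying the string
condition, generate, and are such that neither end is generated by the other three. -/
structure IsGenQuad (A B C D : Matrix.SpecialLinearGroup (Fin 2) F) : Prop where
  quad : IsStringQuad A.1 B.1 C.1 D.1
  gen : Subgroup.closure {(A : ProjectiveSpecialLinearGroup (Fin 2) F),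
    (B : ProjectiveSpecialLinearGroup (Fin 2) F), (C : ProjectiveSpecialLinearGroup (Fin 2) F),
    (D : ProjectiveSpecialLinearGroup (Fin 2) F)} = ⊤
  last : (D : ProjectiveSpecialLinearGroup (Fin 2) F) ∉
    Subgroup.closure {(A : ProjectiveSpecialLinearGroup (Fin 2) F),
      (B : ProjectiveSpecialLinearGroup (Fin 2) F), (C : ProjectiveSpecialLinearGroup (Fin 2) F)}
  first : (A : ProjectiveSpecialLinearGroup (Fin 2) F) ∉
    Subgroup.closure {(D : ProjectiveSpecialLinearGroup (Fin 2) F),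
      (C : ProjectiveSpecialLinearGroup (Fin 2) F), (B : ProjectiveSpecialLinearGroup (Fin 2) F)}

theorem IsGenQuad.reverse {A B C D : Matrix.SpecialLinearGroup (Fin 2) F} (h : IsGenQuad A B C D) :
    IsGenQuad D C B A where
  quad := h.quad.reverse
  gen := by
    rw [← h.gen]
    congr 1
    ext x
    simp only [Set.mem_insert_iff, Set.mem_singleton_iff]
    tauto
  last := h.first
  first := h.last

/-- A twisted conjugation up to sign extends from generators of `PSL(2, F)` to everything. -/
theorem forall_mul_eq_or_of_closure_eq_top {s : Set (Matrix.SpecialLinearGroup (Fin 2) F)}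
    (hs : Subgroup.closure
      ((fun M : Matrix.SpecialLinearGroup (Fin 2) F =>
        (M : ProjectiveSpecialLinearGroup (Fin 2) F)) '' s) = ⊤)
    (σ : F →+* F) (u : (Matrix (Fin 2) (Fin 2) F)ˣ)
    (h : ∀ M ∈ s, u.1 * M.1 = σ.mapMatrix M.1 * u.1 ∨ u.1 * M.1 = -(σ.mapMatrix M.1 * u.1))
    (M : Matrix.SpecialLinearGroup (Fin 2) F) :
    u.1 * M.1 = σ.mapMatrix M.1 * u.1 ∨ u.1 * M.1 = -(σ.mapMatrix M.1 * u.1) := by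
  suffices H : ∀ g ∈ Subgroup.closure
      ((fun M : Matrix.SpecialLinearGroup (Fin 2) F =>
        (M : ProjectiveSpecialLinearGroup (Fin 2) F)) '' s),
      ∀ M : Matrix.SpecialLinearGroup (Fin 2) F, (M : ProjectiveSpecialLinearGroup (Fin 2) F) = g →
        u.1 * M.1 = σ.mapMatrix M.1 * u.1 ∨ u.1 * M.1 = -(σ.mapMatrix M.1 * u.1) from
    H _ (by rw [hs]; trivial) M rfl
  have ind : ∀ M N : Matrix.SpecialLinearGroup (Fin 2) F,
      (M : ProjectiveSpecialLinearGroup (Fin 2) F) = N →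
      (u.1 * N.1 = σ.mapMatrix N.1 * u.1 ∨ u.1 * N.1 = -(σ.mapMatrix N.1 * u.1)) →
      (u.1 * M.1 = σ.mapMatrix M.1 * u.1 ∨ u.1 * M.1 = -(σ.mapMatrix M.1 * u.1)) := by
    intro M N hMN hN
    rcases (psl_mk_eq_iff M N).1 hMN with h | h
    · rwa [h] at hN
    · rw [h, map_neg, mul_neg, neg_mul, neg_inj, neg_neg] at hN
      rcases hN with hN | hN
      · exact Or.inl hN
      · right; rw [← hN, neg_neg]
  intro g hg
  induction hg using Subgroup.closure_induction with
  | mem g hg =>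
    obtain ⟨N, hN, rfl⟩ := hg
    exact fun M hM => ind M N hM (h N hN)
  | one =>
    refine fun M hM => ind M 1 (by rw [hM]; rfl) (Or.inl ?_)
    simp
  | mul x y _ _ hx hy =>
    intro M hM
    obtain ⟨K, rfl⟩ := QuotientGroup.mk_surjective x
    obtain ⟨L, rfl⟩ := QuotientGroup.mk_surjective y
    refine ind M (K * L) hM ?_
    have e : u.1 * (K * L).1 = u.1 * K.1 * L.1 := by
      rw [Matrix.SpecialLinearGroup.coe_mul, mul_assoc]
    have e' : σ.mapMatrix (K * L).1 * u.1 = σ.mapMatrix K.1 * (σ.mapMatrix L.1 * u.1) := by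
      rw [Matrix.SpecialLinearGroup.coe_mul, map_mul, mul_assoc]
    rw [e, e']
    rcases hx K rfl with h1 | h1 <;> rcases hy L rfl with h2 | h2 <;>
      rw [h1] <;> simp only [neg_mul, mul_assoc, h2, mul_neg, neg_neg] <;> simp
  | inv x _ hx =>
    intro M hM
    have h1 := hx M⁻¹ (by rw [QuotientGroup.mk_inv, hM, inv_inv])
    have i1 : σ.mapMatrix M.1 * σ.mapMatrix (M⁻¹).1 = 1 := by
      rw [← map_mul, ← Matrix.SpecialLinearGroup.coe_mul, mul_inv_cancel]
      simp
    have i2 : (M⁻¹).1 * M.1 = 1 := by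
      rw [← Matrix.SpecialLinearGroup.coe_mul, inv_mul_cancel]
      simp
    rcases h1 with h1 | h1
    · left
      have := congrArg (fun K => σ.mapMatrix M.1 * K * M.1) h1
      simp only [← mul_assoc, i1, one_mul] at this
      rw [mul_assoc, mul_assoc, i2, mul_one] at this
      exact this.symm
    · right
      have := congrArg (fun K => σ.mapMatrix M.1 * K * M.1) h1
      simp only [← mul_assoc, mul_neg, neg_mul, i1, one_mul] at this
      rw [mul_assoc, mul_assoc, i2, mul_one] at this
      rw [this, neg_neg]

theorem trace_sq_eq_of_unit_mul (u : (Matrix (Fin 2) (Fin 2) F)ˣ) {M N : Matrix (Fin 2) (Fin 2) F}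
    (h : u.1 * M = N * u.1 ∨ u.1 * M = -(N * u.1)) : M.trace ^ 2 = N.trace ^ 2 := by
  have e : M = (u⁻¹).1 * (u.1 * M) := by rw [← mul_assoc, Units.inv_mul, one_mul]
  rcases h with h | h
  · rw [e, h, trace_mul_comm, mul_assoc, Units.mul_inv, mul_one]
  · rw [e, h, mul_neg, trace_neg, trace_mul_comm, mul_assoc, Units.mul_inv, mul_one, neg_sq]

/-- A field endomorphism fixing the invariants of a generating quadruple is trivial. -/
theorem IsGenQuad.ringHom_eq (h2 : (2 : F) ≠ 0) {A B C D : Matrix.SpecialLinearGroup (Fin 2) F}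
    (h : IsGenQuad A B C D) (σ : F →+* F)
    (hX : σ ((A.1 * B.1).trace ^ 2) = (A.1 * B.1).trace ^ 2)
    (hZ : σ ((C.1 * D.1).trace ^ 2) = (C.1 * D.1).trace ^ 2) (t : F) : σ t = t := by
  have htr : ∀ M : Matrix (Fin 2) (Fin 2) F, (M.map σ).trace = σ M.trace := fun M => by
    simp [trace_fin_two]
  obtain ⟨u, hA, hB, hC, hD⟩ := h.quad.exists_conj h2 (h.quad.map σ)
    (by rw [← Matrix.map_mul, htr, ← map_pow, hX]) (by rw [← Matrix.map_mul, htr, ← map_pow, hZ])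
  have key := forall_mul_eq_or_of_closure_eq_top (s := {A, B, C, D})
    (by rw [← h.gen]; simp only [Set.image_insert_eq, Set.image_singleton]) σ u (by
      rintro M (rfl | rfl | rfl | rfl) <;> assumption)
  have sq : ∀ t : F, t ^ 2 = (σ t) ^ 2 := by
    intro t
    have := trace_sq_eq_of_unit_mul u (key ⟨!![t, -1; 1, 0], by simp [det_fin_two_of]⟩)
    rw [RingHom.mapMatrix_apply, htr] at this
    simpa [trace_fin_two] using this
  have h1 := sq t
  have h3 := sq (t + 1)
  rw [map_add, map_one] at h3
  exact mul_left_cancel₀ h2 (by linear_combination h1 - h3)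

end Generation

section Lift

open Matrix

theorem IsStringCGroupRep.notMem_closure {G : Type*} [Group G] {n : ℕ} {ρ : Fin n → G}
    (h : IsStringCGroupRep ρ) {i : Fin n} {J : Set (Fin n)} (hi : i ∉ J) :
    ρ i ∉ Subgroup.closure (ρ '' J) := by
  intro hmem
  have h1 : ρ i ∈ Subgroup.closure (ρ '' {i}) ⊓ Subgroup.closure (ρ '' J) :=
    ⟨Subgroup.subset_closure ⟨i, rfl, rfl⟩, hmem⟩
  rw [h.2.2.2, Set.singleton_inter_eq_empty.2 hi, Set.image_empty, Subgroup.closure_empty,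
    Subgroup.mem_bot] at h1
  have := h.1 i
  rw [h1, orderOf_one] at this
  omega

theorem IsStringCGroupRep.injective {G : Type*} [Group G] {n : ℕ} {ρ : Fin n → G}
    (h : IsStringCGroupRep ρ) : Function.Injective ρ := by
  intro i j hij
  by_contra hne
  refine h.notMem_closure (i := i) (J := {j}) hne ?_
  rw [hij]
  exact Subgroup.subset_closure ⟨j, rfl, rfl⟩

variable {F : Type*} [Field F]

theorem psl_exists_not_commute {g : ProjectiveSpecialLinearGroup (Fin 2) F} (hg : g ≠ 1) :
    ∃ h, ¬ Commute g h := by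
  by_contra! hc
  obtain ⟨M, rfl⟩ := QuotientGroup.mk_surjective g
  have h1 := (psl_commute_iff M ⟨!![1, 1; 0, 1], by simp [det_fin_two_of]⟩).1 (hc _)
  have h2 := (psl_commute_iff M ⟨!![1, 0; 1, 1], by simp [det_fin_two_of]⟩).1 (hc _)
  refine ne_smul_one_of_psl_ne_one hg (M.1 0 0) ?_
  have hd := M.2
  rw [det_fin_two] at hd
  rw [← Matrix.ext_iff, ← Matrix.ext_iff] at h1 h2
  simp [Matrix.mul_apply, Fin.sum_univ_two, Fin.forall_fin_two, vecMul, dotProduct] at h1 h2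
  have h01 : M.1 0 1 = 0 := by grind
  have h10 : M.1 1 0 = 0 := by grind
  have h11 : M.1 1 1 = M.1 0 0 := by grind
  ext i j
  fin_cases i <;> fin_cases j <;> simp [h01, h10, h11]

theorem psl_exists_mem_not_commute {S : Set (ProjectiveSpecialLinearGroup (Fin 2) F)}
    (hS : Subgroup.closure S = ⊤) {g : ProjectiveSpecialLinearGroup (Fin 2) F} (hg : g ≠ 1) :
    ∃ s ∈ S, ¬ Commute g s := by
  by_contra! hc
  obtain ⟨h, hh⟩ := psl_exists_not_commute hg
  refine hh ?_
  have : Subgroup.closure S ≤ Subgroup.centralizer {g} := by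
    rw [Subgroup.closure_le]
    intro s hs
    exact Subgroup.mem_centralizer_singleton_iff.2 (hc s hs).eq.symm
  rw [hS] at this
  exact (Subgroup.mem_centralizer_singleton_iff.1 (this (Subgroup.mem_top h))).symm

theorem psl_mk_eq_of_mul_comm (h2 : (2 : F) ≠ 0) {M N : Matrix.SpecialLinearGroup (Fin 2) F}
    (hM : M.1.trace = 0) (hN : N.1.trace = 0)
    (hM1 : (M : ProjectiveSpecialLinearGroup (Fin 2) F) ≠ 1) (h : M.1 * N.1 = N.1 * M.1) :
    (M : ProjectiveSpecialLinearGroup (Fin 2) F) = N := by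
  obtain ⟨α, β, hαβ⟩ := exists_eq_smul_add_of_commute (ne_smul_one_of_psl_ne_one hM1) h
  have ht := hN
  rw [hαβ, trace_add, trace_smul, trace_smul, hM, trace_one] at ht
  have hα : α = 0 := by simpa [h2] using ht
  rw [hα, zero_smul, zero_add] at hαβ
  have hMM := mul_self_eq_neg_one M.2 hM
  have hNN := mul_self_eq_neg_one N.2 hN
  rw [hαβ, smul_mul_smul_comm, hMM] at hNN
  have := congrFun (congrFun hNN 0) 0
  simp at this
  have hb : β = 1 ∨ β = -1 := mul_self_eq_one_iff.1 this
  refine (psl_mk_eq_iff M N).2 ?_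
  rcases hb with rfl | rfl
  · left; rw [hαβ, one_smul]
  · right; rw [hαβ, neg_one_smul]

theorem trace_mul_eq_zero_of_commute (h2 : (2 : F) ≠ 0) {M N : Matrix.SpecialLinearGroup (Fin 2) F}
    (hM : M.1.trace = 0) (hN : N.1.trace = 0)
    (hM1 : (M : ProjectiveSpecialLinearGroup (Fin 2) F) ≠ 1)
    (hne : (M : ProjectiveSpecialLinearGroup (Fin 2) F) ≠ N)
    (hc : Commute (M : ProjectiveSpecialLinearGroup (Fin 2) F) N) : (M.1 * N.1).trace = 0 := by
  rcases (psl_commute_iff M N).1 hc with h | h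
  · exact (hne (psl_mk_eq_of_mul_comm h2 hM hN hM1 h)).elim
  · have := mul_add_mul_of_trace_eq_zero hM hN
    rw [h, neg_add_cancel] at this
    have h3 := congrFun (congrFun this 0) 0
    rw [h, trace_neg]
    simpa using h3

theorem IsStringCGroupRep.exists_isGenQuad {ρ : Fin 4 → ProjectiveSpecialLinearGroup (Fin 2) F}
    (h : IsStringCGroupRep ρ) : (2 : F) ≠ 0 ∧
      ∃ A B C D : Matrix.SpecialLinearGroup (Fin 2) F, IsGenQuad A B C D ∧
        ρ 0 = A ∧ ρ 1 = B ∧ ρ 2 = C ∧ ρ 3 = D := by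
  obtain ⟨A, hA⟩ := QuotientGroup.mk_surjective (ρ 0)
  obtain ⟨B, hB⟩ := QuotientGroup.mk_surjective (ρ 1)
  obtain ⟨C, hC⟩ := QuotientGroup.mk_surjective (ρ 2)
  obtain ⟨D, hD⟩ := QuotientGroup.mk_surjective (ρ 3)
  have ne1 : ∀ i, ρ i ≠ 1 := fun i hi => by
    have := h.1 i
    rw [hi, orderOf_one] at this
    omega
  have cAC : Commute (ρ 0) (ρ 2) := h.2.2.1 0 2 (by decide)
  have cAD : Commute (ρ 0) (ρ 3) := h.2.2.1 0 3 (by decide)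
  have cBD : Commute (ρ 1) (ρ 3) := h.2.2.1 1 3 (by decide)
  have hrange : Set.range ρ = {ρ 0, ρ 1, ρ 2, ρ 3} := by
    ext x
    simp [Fin.exists_fin_succ, eq_comm]
  have hgen := h.2.1
  rw [hrange] at hgen
  have h2 : (2 : F) ≠ 0 := by
    intro h2
    have hneg : ∀ M : Matrix (Fin 2) (Fin 2) F, -M = M := fun M => by
      ext i j
      rw [Matrix.neg_apply]
      linear_combination -M i j * h2
    have comm_iff : ∀ M N : Matrix.SpecialLinearGroup (Fin 2) F,
        Commute (M : ProjectiveSpecialLinearGroup (Fin 2) F) N ↔ M.1 * N.1 = N.1 * M.1 := by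
      intro M N
      rw [psl_commute_iff, hneg, or_self]
    rw [← hA, ← hC, comm_iff] at cAC
    rw [← hA, ← hD, comm_iff] at cAD
    rw [← hB, ← hD, comm_iff] at cBD
    have cAB : A.1 * B.1 = B.1 * A.1 := commute_of_commute_of_ne_smul
      (ne_smul_one_of_psl_ne_one (by rw [hD]; exact ne1 3)) cAD.symm cBD.symm
    obtain ⟨s, hs, hns⟩ := psl_exists_mem_not_commute hgen (ne1 0)
    rcases hs with rfl | rfl | rfl | rfl
    · exact hns rfl
    · rw [← hA, ← hB, comm_iff] at hns; exact hns cAB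
    · rw [← hA, ← hC, comm_iff] at hns; exact hns cAC
    · rw [← hA, ← hD, comm_iff] at hns; exact hns cAD
  have tr0 : ∀ (M : Matrix.SpecialLinearGroup (Fin 2) F) i,
      (M : ProjectiveSpecialLinearGroup (Fin 2) F) = ρ i → M.1.trace = 0 := fun M i hM =>
    trace_eq_zero_of_orderOf_eq_two (M := M) (by rw [hM]; exact h.1 i)
  have key : ∀ (M N : Matrix.SpecialLinearGroup (Fin 2) F) i j,
      (M : ProjectiveSpecialLinearGroup (Fin 2) F) = ρ i →
      (N : ProjectiveSpecialLinearGroup (Fin 2) F) = ρ j → i ≠ j → Commute (ρ i) (ρ j) →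
      (M.1 * N.1).trace = 0 := fun M N i j hM hN hij hc =>
    trace_mul_eq_zero_of_commute h2 (tr0 M i hM) (tr0 N j hN) (by rw [hM]; exact ne1 i)
      (by rw [hM, hN]; exact fun e => hij (h.injective e)) (by rw [hM, hN]; exact hc)
  refine ⟨h2, A, B, C, D, ⟨⟨A.2, B.2, C.2, D.2, tr0 A 0 hA, tr0 B 1 hB, tr0 C 2 hC, tr0 D 3 hD,
    key A C 0 2 hA hC (by decide) cAC, key A D 0 3 hA hD (by decide) cAD,
    key B D 1 3 hB hD (by decide) cBD⟩, ?_, ?_, ?_⟩, hA.symm, hB.symm, hC.symm, hD.symm⟩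
  · rw [hA, hB, hC, hD, hgen]
  · have := h.notMem_closure (i := 3) (J := {0, 1, 2}) (by decide)
    rwa [Set.image_insert_eq, Set.image_insert_eq, Set.image_singleton, ← hA, ← hB, ← hC,
      ← hD] at this
  · have := h.notMem_closure (i := 0) (J := {3, 2, 1}) (by decide)
    rwa [Set.image_insert_eq, Set.image_insert_eq, Set.image_singleton, ← hA, ← hB, ← hC,
      ← hD] at this

end Lift

section Invariants

open Matrix

variable {F : Type*} [Field F] {A B C D : Matrix.SpecialLinearGroup (Fin 2) F}

theorem psl_commute_of_trace_mul_eq_zero {M N : Matrix.SpecialLinearGroup (Fin 2) F}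
    (hM : M.1.trace = 0) (hN : N.1.trace = 0) (h : (M.1 * N.1).trace = 0) :
    Commute (M : ProjectiveSpecialLinearGroup (Fin 2) F) N := by
  rw [psl_commute_iff, mul_eq_neg_mul_of_trace hM hN h, neg_neg]
  exact Or.inr rfl

namespace IsGenQuad

theorem mk_ne_one (h : IsGenQuad A B C D) : (A : ProjectiveSpecialLinearGroup (Fin 2) F) ≠ 1 :=
  fun e => h.first (by rw [e]; exact Subgroup.one_mem _)

theorem mk_ne_second (h : IsGenQuad A B C D) :
    (A : ProjectiveSpecialLinearGroup (Fin 2) F) ≠ B :=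
  fun e => h.first (by rw [e]; exact Subgroup.subset_closure (by simp))

theorem trace_ne_zero (h : IsGenQuad A B C D) : (A.1 * B.1).trace ≠ 0 := by
  intro h0
  obtain ⟨s, hs, hns⟩ := psl_exists_mem_not_commute h.gen h.mk_ne_one
  have q := h.quad
  rcases hs with rfl | rfl | rfl | rfl
  · exact hns rfl
  · exact hns (psl_commute_of_trace_mul_eq_zero q.trA q.trB h0)
  · exact hns (psl_commute_of_trace_mul_eq_zero q.trA q.trC q.trAC)
  · exact hns (psl_commute_of_trace_mul_eq_zero q.trA q.trD q.trAD)

theorem not_commute_last (h2 : (2 : F) ≠ 0) (h : IsGenQuad A B C D) :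
    ¬ Commute (C : ProjectiveSpecialLinearGroup (Fin 2) F) D := fun hc =>
  h.reverse.trace_ne_zero (by
    rw [trace_mul_comm]
    refine trace_mul_eq_zero_of_commute h2 h.quad.trC h.quad.trD ?_
      h.reverse.mk_ne_second.symm hc
    intro e
    apply h.reverse.trace_ne_zero
    have := (psl_mk_eq_one_iff C).1 e
    rcases this with hh | hh <;> rw [hh] <;> simp [h.quad.trD])

theorem second_ne_third (h2 : (2 : F) ≠ 0) (h : IsGenQuad A B C D) :
    (B : ProjectiveSpecialLinearGroup (Fin 2) F) ≠ C := fun e =>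
  h.not_commute_last h2 (by
    rw [← e]
    exact psl_commute_of_trace_mul_eq_zero h.quad.trB h.quad.trD h.quad.trBD)

theorem trace_middle_ne_zero (h2 : (2 : F) ≠ 0) (h : IsGenQuad A B C D) :
    (B.1 * C.1).trace ≠ 0 := by
  intro h0
  have q := h.quad
  have eCA := mul_eq_neg_mul_of_trace q.trA q.trC q.trAC
  have eCB := mul_eq_neg_mul_of_trace q.trB q.trC h0
  have eDA := mul_eq_neg_mul_of_trace q.trA q.trD q.trAD
  have eDB := mul_eq_neg_mul_of_trace q.trB q.trD q.trBD
  have key : ∀ N : Matrix (Fin 2) (Fin 2) F, N * A.1 = -(A.1 * N) → N * B.1 = -(B.1 * N) →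
      A.1 * B.1 * N = N * (A.1 * B.1) := by
    intro N h1 h2
    rw [← mul_assoc, h1, neg_mul, mul_assoc A.1 N, h2, mul_neg, neg_neg, mul_assoc]
  have hAB : ∀ r : F, A.1 * B.1 ≠ r • 1 := by
    rw [← Matrix.SpecialLinearGroup.coe_mul]
    refine ne_smul_one_of_psl_ne_one ?_
    intro e
    refine h.mk_ne_second ?_
    have e1 : (A : ProjectiveSpecialLinearGroup (Fin 2) F) * B = 1 := e
    have e2 : (B : ProjectiveSpecialLinearGroup (Fin 2) F) * B = 1 := by
      have : ((B * B : Matrix.SpecialLinearGroup (Fin 2) F) :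
        ProjectiveSpecialLinearGroup (Fin 2) F) = 1 := by
        rw [psl_mk_eq_one_iff, Matrix.SpecialLinearGroup.coe_mul,
          mul_self_eq_neg_one B.2 q.trB]
        exact Or.inr rfl
      exact this
    exact mul_right_cancel (e1.trans e2.symm)
  refine h.not_commute_last h2 ((psl_commute_iff C D).2 (Or.inl ?_))
  exact commute_of_commute_of_ne_smul hAB (key _ eCA eCB) (key _ eDA eDB)

theorem four_mul_trace_sq (h2 : (2 : F) ≠ 0) (h : IsGenQuad A B C D) :
    4 * (B.1 * C.1).trace ^ 2 = (4 - (A.1 * B.1).trace ^ 2) * (4 - (C.1 * D.1).trace ^ 2) := by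
  obtain ⟨x, s, z, w, -, -, hxs, hzw, hx, hz, hy⟩ := h.quad.exists_coords h2
  rw [hx, hy, hz]
  linear_combination 16 * s ^ 2 * hzw + 16 * (1 - z ^ 2) * hxs

theorem isSquare_sub (h2 : (2 : F) ≠ 0) (h : IsGenQuad A B C D) :
    IsSquare (4 - (A.1 * B.1).trace ^ 2) := by
  obtain ⟨x, s, z, w, -, -, hxs, hzw, hx, hz, hy⟩ := h.quad.exists_coords h2
  refine ⟨2 * s, ?_⟩
  rw [hx]
  linear_combination (-4) * hxs

theorem trace_sq_ne_four (h2 : (2 : F) ≠ 0) (h : IsGenQuad A B C D) :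
    (A.1 * B.1).trace ^ 2 ≠ 4 := by
  intro e
  have := h.four_mul_trace_sq h2
  rw [e, sub_self, zero_mul] at this
  have h4 : (4 : F) ≠ 0 := by
    have : (4 : F) = 2 * 2 := by norm_num
    rw [this]; exact mul_ne_zero h2 h2
  exact mul_ne_zero h4 (pow_ne_zero 2 (h.trace_middle_ne_zero h2)) this

theorem trace_sq_ne_two (h2 : (2 : F) ≠ 0) (h : IsGenQuad A B C D) :
    (A.1 * B.1).trace ^ 2 ≠ 2 := by
  intro e
  obtain ⟨x, s, z, w, hB, -, hxs, -, hx, -, -⟩ := h.quad.exists_coords h2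
  have hAA := mul_self_eq_neg_one A.2 h.quad.trA
  have hDD := mul_self_eq_neg_one D.2 h.quad.trD
  have hAB : A.1 * B.1 = -(x • 1 + s • D.1) := by
    rw [hB, mul_add, mul_smul_comm, mul_smul_comm, ← mul_assoc, hAA]
    simp only [neg_mul, one_mul, smul_neg]
    abel
  have hx2 : 2 * x ^ 2 = 1 := by
    rw [hx] at e
    exact mul_left_cancel₀ h2 (by linear_combination e)
  have hs2 : 2 * s ^ 2 = 1 := by linear_combination 2 * hxs - hx2
  have hsq : A.1 * B.1 * (A.1 * B.1) = (2 * x * s) • D.1 := by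
    rw [hAB, neg_mul_neg]
    simp only [add_mul, mul_add, smul_mul_smul_comm, hDD, one_mul, mul_one]
    have e1 : x * x = s * s := by
      exact mul_left_cancel₀ h2 (by linear_combination hx2 - hs2)
    rw [e1]
    module
  have hr : (2 * x * s) * (2 * x * s) = 1 := by linear_combination 2 * s ^ 2 * hx2 + hs2
  refine h.last ?_
  have : (D : ProjectiveSpecialLinearGroup (Fin 2) F) =
      (A : ProjectiveSpecialLinearGroup (Fin 2) F) * B *
        ((A : ProjectiveSpecialLinearGroup (Fin 2) F) * B) := by
    refine (psl_mk_eq_iff D (A * B * (A * B))).2 ?_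
    simp only [Matrix.SpecialLinearGroup.coe_mul]
    rw [hsq]
    rcases mul_self_eq_one_iff.1 hr with h | h
    · left; rw [h, one_smul]
    · right; rw [h, neg_one_smul]
  rw [this]
  have hA : (A : ProjectiveSpecialLinearGroup (Fin 2) F) ∈ Subgroup.closure
      {(A : ProjectiveSpecialLinearGroup (Fin 2) F),
      (B : ProjectiveSpecialLinearGroup (Fin 2) F), (C : ProjectiveSpecialLinearGroup (Fin 2) F)} :=
    Subgroup.subset_closure (by simp)
  have hB : (B : ProjectiveSpecialLinearGroup (Fin 2) F) ∈ Subgroup.closure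
      {(A : ProjectiveSpecialLinearGroup (Fin 2) F),
      (B : ProjectiveSpecialLinearGroup (Fin 2) F), (C : ProjectiveSpecialLinearGroup (Fin 2) F)} :=
    Subgroup.subset_closure (by simp)
  exact mul_mem (mul_mem hA hB) (mul_mem hA hB)

theorem trace_conj_mul (h : IsGenQuad A B C D) :
    (A.1 * (B.1 * C.1 * B.1)).trace = (A.1 * B.1).trace * (B.1 * C.1).trace := by
  have q := h.quad
  have h1 := mul_add_mul_of_trace_eq_zero q.trB q.trC
  have hBB := mul_self_eq_neg_one B.2 q.trB
  have h3 : C.1 * B.1 = (B.1 * C.1).trace • 1 - B.1 * C.1 := by rw [← h1]; abel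
  rw [mul_assoc B.1, h3, mul_sub, ← mul_assoc B.1, hBB, mul_smul_comm, mul_one, neg_one_mul,
    sub_neg_eq_add, mul_add, trace_add, q.trAC, add_zero, mul_smul_comm, trace_smul, smul_eq_mul,
    mul_comm]

theorem conj_ne (h2 : (2 : F) ≠ 0) (h : IsGenQuad A B C D) :
    ((A * (B * C * B) : Matrix.SpecialLinearGroup (Fin 2) F) :
      ProjectiveSpecialLinearGroup (Fin 2) F) ≠ 1 := by
  intro e
  have q := h.quad
  have inv : ∀ M : Matrix.SpecialLinearGroup (Fin 2) F, M.1.trace = 0 →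
      (M : ProjectiveSpecialLinearGroup (Fin 2) F) * M = 1 := fun M hM => by
    have : ((M * M : Matrix.SpecialLinearGroup (Fin 2) F) :
      ProjectiveSpecialLinearGroup (Fin 2) F) = 1 := by
      rw [psl_mk_eq_one_iff, Matrix.SpecialLinearGroup.coe_mul, mul_self_eq_neg_one M.2 hM]
      exact Or.inr rfl
    exact this
  have iA := inv A q.trA
  have iB := inv B q.trB
  have cA := psl_commute_of_trace_mul_eq_zero q.trA q.trD q.trAD
  have cB := psl_commute_of_trace_mul_eq_zero q.trB q.trD q.trBD
  have cne := h.not_commute_last h2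
  replace e : (A : ProjectiveSpecialLinearGroup (Fin 2) F) *
    ((B : ProjectiveSpecialLinearGroup (Fin 2) F) * C * B) = 1 := e
  generalize (A : ProjectiveSpecialLinearGroup (Fin 2) F) = a at *
  generalize (B : ProjectiveSpecialLinearGroup (Fin 2) F) = b at *
  generalize (C : ProjectiveSpecialLinearGroup (Fin 2) F) = c at *
  generalize (D : ProjectiveSpecialLinearGroup (Fin 2) F) = d at *
  have ia : a⁻¹ = a := inv_eq_of_mul_eq_one_left iA
  have ib : b⁻¹ = b := inv_eq_of_mul_eq_one_left iB
  have h1 : b * c * b = a := by rw [← ia]; exact (inv_eq_of_mul_eq_one_right e).symm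
  have h3 : c = b * a * b := by
    rw [← h1]
    calc c = (b * b) * c * (b * b) := by rw [iB]; simp
      _ = _ := by group
  rw [h3] at cne
  exact cne ((cB.mul_left cA).mul_left cB)

theorem trace_sq_mem [Finite F] (h2 : (2 : F) ≠ 0) (h : IsGenQuad A B C D)
    (hord : ∀ g ∈ Subgroup.closure {(A : ProjectiveSpecialLinearGroup (Fin 2) F),
      (B : ProjectiveSpecialLinearGroup (Fin 2) F), (C : ProjectiveSpecialLinearGroup (Fin 2) F)},
      orderOf g ≤ 5) :
    (((A.1 * B.1).trace ^ 2 = 1 ∨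
        ((A.1 * B.1).trace ^ 2) ^ 2 - 3 * (A.1 * B.1).trace ^ 2 + 1 = 0) ∧
      ((B.1 * C.1).trace ^ 2 = 1 ∨ (B.1 * C.1).trace ^ 2 = 2 ∨
        ((B.1 * C.1).trace ^ 2) ^ 2 - 3 * (B.1 * C.1).trace ^ 2 + 1 = 0)) ∧
      ((A.1 * B.1).trace ^ 2 * (B.1 * C.1).trace ^ 2 = 1 ∨
        (A.1 * B.1).trace ^ 2 * (B.1 * C.1).trace ^ 2 = 2 ∨
        ((A.1 * B.1).trace ^ 2 * (B.1 * C.1).trace ^ 2) ^ 2 -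
          3 * ((A.1 * B.1).trace ^ 2 * (B.1 * C.1).trace ^ 2) + 1 = 0) := by
  set S := Subgroup.closure {(A : ProjectiveSpecialLinearGroup (Fin 2) F),
      (B : ProjectiveSpecialLinearGroup (Fin 2) F), (C : ProjectiveSpecialLinearGroup (Fin 2) F)}
    with hS
  have mA : (A : ProjectiveSpecialLinearGroup (Fin 2) F) ∈ S := Subgroup.subset_closure (by simp)
  have mB : (B : ProjectiveSpecialLinearGroup (Fin 2) F) ∈ S := Subgroup.subset_closure (by simp)
  have mC : (C : ProjectiveSpecialLinearGroup (Fin 2) F) ∈ S := Subgroup.subset_closure (by simp)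
  have iB : (B : ProjectiveSpecialLinearGroup (Fin 2) F) * B = 1 := by
    have : ((B * B : Matrix.SpecialLinearGroup (Fin 2) F) :
      ProjectiveSpecialLinearGroup (Fin 2) F) = 1 := by
      rw [psl_mk_eq_one_iff, Matrix.SpecialLinearGroup.coe_mul,
        mul_self_eq_neg_one B.2 h.quad.trB]
      exact Or.inr rfl
    exact this
  have key : ∀ M : Matrix.SpecialLinearGroup (Fin 2) F,
      (M : ProjectiveSpecialLinearGroup (Fin 2) F) ∈ S →
      (M : ProjectiveSpecialLinearGroup (Fin 2) F) ≠ 1 → M.1.trace ≠ 0 →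
      M.1.trace ^ 2 = 1 ∨ M.1.trace ^ 2 = 2 ∨ (M.1.trace ^ 2) ^ 2 - 3 * M.1.trace ^ 2 + 1 = 0 := by
    intro M hM hM1 hM0
    have := trSq_of_orderOf_le hM1 (hord _ hM)
    rw [trSq_mk] at this
    exact this.resolve_left (pow_ne_zero 2 hM0)
  have nAB := h.trace_ne_zero
  have nBC := h.trace_middle_ne_zero h2
  have kAB := key (A * B) (mul_mem mA mB)
    (fun e => h.mk_ne_second (mul_right_cancel (Eq.trans e iB.symm))) nAB
  have kBC := key (B * C) (mul_mem mB mC)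
    (fun e => h.second_ne_third h2 (mul_left_cancel (iB.trans (Eq.symm e)))) nBC
  have e3 : (A * (B * C * B)).1.trace = (A.1 * B.1).trace * (B.1 * C.1).trace :=
    h.trace_conj_mul
  have kABCB := key (A * (B * C * B)) (mul_mem mA (mul_mem (mul_mem mB mC) mB)) (h.conj_ne h2)
    (by rw [e3]; exact mul_ne_zero nAB nBC)
  rw [e3, mul_pow] at kABCB
  exact ⟨⟨kAB.imp_right fun hh => hh.resolve_left (h.trace_sq_ne_two h2), kBC⟩, kABCB⟩

end IsGenQuad

end Invariants

section Arithmetic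

variable {F : Type*} [Field F]

theorem false_of_coprime_cast_eq_zero {m n : ℕ} (hmn : m.Coprime n) (hm : (m : F) = 0)
    (hn : (n : F) = 0) : False := by
  obtain ⟨a, b, hab⟩ := Nat.isCoprime_iff_coprime.2 hmn
  have := congrArg (Int.cast : ℤ → F) hab
  push_cast at this
  rw [hm, hn] at this
  simp at this

theorem card_le_of_forall_pow_eq [Fintype F] {n : ℕ} (hn : 2 ≤ n) (h : ∀ t : F, t ^ n = t) :
    Fintype.card F ≤ n := by
  classical
  have h1 : Fintype.card F - 1 ∣ n - 1 := by
    rw [← FiniteField.forall_pow_eq_one_iff F]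
    intro x
    have := h x
    refine Units.ext (mul_right_cancel₀ x.ne_zero ?_)
    rw [Units.val_pow_eq_pow_val, ← pow_succ, Nat.sub_add_cancel (by omega), this, Units.val_one,
      one_mul]
  have := Nat.le_of_dvd (by omega) h1
  omega

theorem card_eq_of_forall_pow_eq [Fintype F] {p : ℕ} (hp : p.Prime) (hpF : (p : F) = 0)
    (h : ∀ t : F, t ^ p = t) : Fintype.card F = p := by
  have h1 := card_le_of_forall_pow_eq hp.two_le h
  have : Fact p.Prime := ⟨hp⟩
  have : CharP F p := (CharP.charP_iff_prime_eq_zero hp).2 hpF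
  obtain ⟨n, -, hn⟩ := FiniteField.card F p
  refine le_antisymm h1 ?_
  rw [hn]
  exact Nat.le_self_pow n.ne_zero p

theorem forall_pow_eq_of_rigid {p : ℕ} (hp : p.Prime) (hpF : (p : F) = 0) {X Z : F}
    (hrig : ∀ σ : F →+* F, σ X = X → σ Z = Z → ∀ t, σ t = t) {a b : ℕ} (hX : X = a) (hZ : Z = b)
    (t : F) : t ^ p = t := by
  have : Fact p.Prime := ⟨hp⟩
  have : CharP F p := (CharP.charP_iff_prime_eq_zero hp).2 hpF
  exact hrig (frobenius F p) (by rw [hX, map_natCast]) (by rw [hZ, map_natCast]) t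

theorem two_pow_five_ne_neg_one (h2 : (2 : F) ≠ 0) (h11 : (11 : F) = 0)
    (hF : ∀ t : F, t ^ 11 = t) : ¬ IsSquare (2 : F) := by
  rintro ⟨y, hy⟩
  have h1 := hF y
  have hy0 : y ≠ 0 := by
    rintro rfl
    exact h2 (by simpa using hy)
  have h10 : y ^ 10 = 1 := mul_right_cancel₀ hy0 (by rw [← pow_succ, h1, one_mul])
  have : (2 : F) ^ 5 = 1 := by rw [hy, ← h10]; ring
  exact false_of_coprime_cast_eq_zero (F := F) (m := 11) (n := 31) (by norm_num)
    (by exact_mod_cast h11) (by push_cast; linear_combination this)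

theorem not_isSquare_of_three_eq_zero (h3 : (3 : F) = 0) {X Z : F}
    (hrig : ∀ σ : F →+* F, σ X = X → σ Z = Z → ∀ t, σ t = t)
    (hX : X ^ 2 - 3 * X + 1 = 0) (hZ : Z ^ 2 - 3 * Z + 1 = 0) : ¬ IsSquare (4 - X) := by
  have : Fact (Nat.Prime 3) := ⟨Nat.prime_three⟩
  have : CharP F 3 := (CharP.charP_iff_prime_eq_zero Nat.prime_three).2 (by exact_mod_cast h3)
  have fix : ∀ W : F, W ^ 2 - 3 * W + 1 = 0 → W ^ 9 = W := by
    intro W hW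
    have hW2 : W ^ 2 = -1 := by linear_combination hW + W * h3
    calc W ^ 9 = (W ^ 2) ^ 4 * W := by ring
      _ = W := by rw [hW2]; ring
  have hF : ∀ t : F, t ^ 9 = t := fun t => by
    have := hrig (iterateFrobenius F 3 2) (by rw [iterateFrobenius_def]; exact fix X hX)
      (by rw [iterateFrobenius_def]; exact fix Z hZ) t
    rwa [iterateFrobenius_def] at this
  rintro ⟨s, hs⟩
  have hX2 : X ^ 2 = -1 := by linear_combination hX + X * h3
  have e4 : (4 - X) ^ 4 = -1 := by
    have : (4 - X) ^ 2 = X := by linear_combination hX2 + (5 - 3 * X) * h3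
    calc (4 - X) ^ 4 = ((4 - X) ^ 2) ^ 2 := by ring
      _ = -1 := by rw [this, hX2]
  have h1 := hF s
  have hs0 : s ≠ 0 := by
    rintro rfl
    rw [hs] at e4
    simp at e4
  have h8 : s ^ 8 = 1 := mul_right_cancel₀ hs0 (by rw [← pow_succ, h1, one_mul])
  have : (1 : F) = -1 := by
    rw [← e4, hs, ← h8]; ring
  exact false_of_coprime_cast_eq_zero (F := F) (m := 2) (n := 3) (by norm_num)
    (by push_cast; linear_combination this) (by exact_mod_cast h3)

theorem not_isSquare_three_of_five_eq_zero (h5 : (5 : F) = 0) (hF : ∀ t : F, t ^ 5 = t) :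
    ¬ IsSquare (3 : F) := by
  rintro ⟨s, hs⟩
  have h1 := hF s
  have hs0 : s ≠ 0 := by
    rintro rfl
    exact false_of_coprime_cast_eq_zero (F := F) (m := 3) (n := 5) (by norm_num)
      (by push_cast; rw [hs]; simp) (by exact_mod_cast h5)
  have h4 : s ^ 4 = 1 := mul_right_cancel₀ hs0 (by rw [← pow_succ, h1, one_mul])
  have : (3 : F) ^ 2 = 1 := by rw [hs, ← h4]; ring
  exact false_of_coprime_cast_eq_zero (F := F) (m := 8) (n := 5) (by norm_num)
    (by push_cast; linear_combination this) (by exact_mod_cast h5)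

/-- The case of the diophantine analysis in which one of the outer invariants is `1`. -/
theorem false_of_one_of_root (h2 : (2 : F) ≠ 0) {X Y Z : F} (hX : X = 1)
    (hrig : ∀ σ : F →+* F, σ X = X → σ Z = Z → ∀ t, σ t = t)
    (hZ : Z ^ 2 - 3 * Z + 1 = 0) (hY : Y = 1 ∨ Y = 2 ∨ Y ^ 2 - 3 * Y + 1 = 0)
    (hZY : Z * Y = 1 ∨ Z * Y = 2 ∨ (Z * Y) ^ 2 - 3 * (Z * Y) + 1 = 0)
    (h4 : 4 * Y = (4 - X) * (4 - Z)) (sY : IsSquare Y) : False := by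
  subst hX
  rcases hY with rfl | rfl | hY
  · have : (1 : F) = 0 := by linear_combination 9 * hZ + (-(3 * Z - 1)) * h4
    exact one_ne_zero this
  · have h11 : (11 : F) = 0 := by linear_combination (-9) * hZ + (3 * Z - 5) * h4
    have hZ5 : Z = (5 : ℕ) := by
      push_cast
      linear_combination (4 * h4) - (Z - 1) * h11
    refine two_pow_five_ne_neg_one h2 h11 (forall_pow_eq_of_rigid (by norm_num)
      (by exact_mod_cast h11) hrig (a := 1) (by simp) hZ5) sY
  · have hYZ : (Y - Z) * (Y - (3 - Z)) = 0 := by linear_combination hY - hZ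
    rcases mul_eq_zero.1 hYZ with h | h
    · obtain rfl : Y = Z := by linear_combination h
      have h59 : (59 : F) = 0 := by
        linear_combination (-49) * hZ + (7 * Y - 9) * h4
      have h59' : ((59 : ℕ) : F) = 0 := by exact_mod_cast h59
      rcases hZY with h | h | h
      · refine false_of_coprime_cast_eq_zero (F := F) (m := 59) (n := 95) (by norm_num) h59' ?_
        push_cast
        linear_combination (49) * h - (7 * Y + 12) * h4
      · refine false_of_coprime_cast_eq_zero (F := F) (m := 59) (n := 46) (by norm_num) h59' ?_
        push_cast
        linear_combination (49) * h - (7 * Y + 12) * h4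
      · refine false_of_coprime_cast_eq_zero (F := F) (m := 59) (n := 29) (by norm_num) h59' ?_
        push_cast
        grind
    · grind

/-- The case of the diophantine analysis in which the outer invariants agree and are not `1`. -/
theorem eq_six_of_root {X Y : F}
    (hrig : ∀ σ : F →+* F, σ X = X → σ X = X → ∀ t, σ t = t)
    (hX : X ^ 2 - 3 * X + 1 = 0) (hY : Y = 1 ∨ Y = 2 ∨ Y ^ 2 - 3 * Y + 1 = 0)
    (hXY : X * Y = 1 ∨ X * Y = 2 ∨ (X * Y) ^ 2 - 3 * (X * Y) + 1 = 0)
    (h4 : 4 * Y = (4 - X) * (4 - X)) (sX : IsSquare (4 - X)) : (19 : F) = 0 ∧ X = 6 := by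
  rcases hY with rfl | rfl | hY
  · have h5 : 5 * X = 11 := by linear_combination hX + h4
    have h19 : (19 : F) = 0 := by linear_combination (-25) * hX + (5 * X - 4) * h5
    exact ⟨h19, by linear_combination 4 * h5 + (2 - X) * h19⟩
  · exfalso
    have h5 : 5 * X = 7 := by linear_combination hX + h4
    have h31 : ((31 : ℕ) : F) = 0 := by
      push_cast
      linear_combination (-25) * hX + (5 * X - 8) * h5
    rcases hXY with h | h | h
    · refine false_of_coprime_cast_eq_zero (F := F) (m := 31) (n := 9) (by norm_num) h31 ?_
      push_cast
      linear_combination 5 * h - 2 * h5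
    · refine false_of_coprime_cast_eq_zero (F := F) (m := 31) (n := 4) (by norm_num) h31 ?_
      push_cast
      linear_combination 5 * h - 2 * h5
    · refine false_of_coprime_cast_eq_zero (F := F) (m := 31) (n := 27) (by norm_num) h31 ?_
      push_cast
      linear_combination 5 * (h - 4 * hX) - 6 * h5
  · exfalso
    have hYX : (Y - X) * (Y - (3 - X)) = 0 := by linear_combination hY - hX
    rcases mul_eq_zero.1 hYX with h | h
    · obtain rfl : Y = X := by linear_combination h
      have h3 : 3 * (3 * Y - 5) = 0 := by linear_combination h4 + hX
      rcases mul_eq_zero.1 h3 with h3 | h3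
      · exact not_isSquare_of_three_eq_zero h3 hrig hX hX sX
      · have h11 : ((11 : ℕ) : F) = 0 := by
          push_cast
          linear_combination (-9) * hX + (3 * Y - 4) * h3
        have h9 : Y = 9 := by
          push_cast at h11
          linear_combination 4 * h3 + (1 - Y) * h11
        subst h9
        push_cast at h11
        rcases hXY with h | h | h
        · refine false_of_coprime_cast_eq_zero (F := F) (m := 11) (n := 80) (by norm_num)
            (by exact_mod_cast h11) ?_
          push_cast; linear_combination h
        · refine false_of_coprime_cast_eq_zero (F := F) (m := 11) (n := 79) (by norm_num)
            (by exact_mod_cast h11) ?_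
          push_cast; linear_combination h
        · refine false_of_coprime_cast_eq_zero (F := F) (m := 11) (n := 81 * 81 - 3 * 81 + 1)
            (by norm_num) (by exact_mod_cast h11) ?_
          push_cast; linear_combination h
    · have h3 : X = 3 := by linear_combination h4 + hX - 4 * h
      rw [h3] at hX
      exact one_ne_zero (α := F) (by linear_combination hX)

/-- The diophantine analysis of the invariants of a generating quadruple. -/
theorem card_eq_of_invariants [Fintype F] (h2 : (2 : F) ≠ 0) {X Y Z : F}
    (hrig : ∀ σ : F →+* F, σ X = X → σ Z = Z → ∀ t, σ t = t)
    (hX : X = 1 ∨ X ^ 2 - 3 * X + 1 = 0) (hZ : Z = 1 ∨ Z ^ 2 - 3 * Z + 1 = 0)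
    (hY : Y = 1 ∨ Y = 2 ∨ Y ^ 2 - 3 * Y + 1 = 0)
    (hXY : X * Y = 1 ∨ X * Y = 2 ∨ (X * Y) ^ 2 - 3 * (X * Y) + 1 = 0)
    (hZY : Z * Y = 1 ∨ Z * Y = 2 ∨ (Z * Y) ^ 2 - 3 * (Z * Y) + 1 = 0)
    (h4 : 4 * Y = (4 - X) * (4 - Z)) (sY : IsSquare Y) (sX : IsSquare (4 - X)) :
    (Fintype.card F = 11 ∧ X = 1 ∧ Z = 1) ∨ (Fintype.card F = 19 ∧ X = 6 ∧ Z = 6) := by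
  rcases hX with hX | hX <;> rcases hZ with hZ | hZ
  · have pow : ∀ p : ℕ, p.Prime → (p : F) = 0 → ∀ t : F, t ^ p = t := fun p hp hpF =>
      forall_pow_eq_of_rigid hp hpF hrig (a := 1) (b := 1) (by simp [hX]) (by simp [hZ])
    rw [hX, hZ] at h4
    rcases hY with rfl | rfl | hY
    · exfalso
      have h5 : (5 : F) = 0 := by linear_combination -h4
      refine not_isSquare_three_of_five_eq_zero h5 (pow 5 (by norm_num) (by exact_mod_cast h5)) ?_
      rw [hX] at sX
      convert sX using 1
      norm_num
    · exfalso
      exact one_ne_zero (α := F) (by linear_combination -h4)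
    · have h11 : (11 : F) = 0 := by linear_combination (-16) * hY + (4 * Y - 3) * h4
      have h11' : ((11 : ℕ) : F) = 0 := by exact_mod_cast h11
      exact Or.inl ⟨card_eq_of_forall_pow_eq (by norm_num) h11' (pow 11 (by norm_num) h11'), hX, hZ⟩
  · exact (false_of_one_of_root h2 hX hrig hZ hY hZY h4 sY).elim
  · exact (false_of_one_of_root h2 hZ (fun σ h h' => hrig σ h' h) hX hY hXY
      (by rw [h4, mul_comm]) sY).elim
  · have hXZ : (Z - X) * (Z - (3 - X)) = 0 := by linear_combination hZ - hX
    rcases mul_eq_zero.1 hXZ with h | h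
    · obtain rfl : Z = X := by linear_combination h
      obtain ⟨h19, h6⟩ := eq_six_of_root hrig hX hY hXY h4 sX
      have h19' : ((19 : ℕ) : F) = 0 := by exact_mod_cast h19
      exact Or.inr ⟨card_eq_of_forall_pow_eq (by norm_num) h19' (forall_pow_eq_of_rigid
        (by norm_num) h19' hrig (a := 6) (b := 6) (by exact_mod_cast h6) (by exact_mod_cast h6)),
        h6, h6⟩
    · exfalso
      have h45 : 4 * Y = 5 := by linear_combination h4 - hX - (4 - X) * h
      rcases hY with rfl | rfl | hY
      · exact one_ne_zero (α := F) (by linear_combination -h45)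
      · have h3 : (3 : F) = 0 := by linear_combination h45
        exact not_isSquare_of_three_eq_zero h3 hrig hX hZ sX
      · have h19 : (19 : F) = 0 := by linear_combination (-16) * hY + (4 * Y - 7) * h45
        have h6 : Y = 6 := by linear_combination 5 * h45 - (Y - 1) * h19
        subst h6
        have key : ∀ W : F, W = 6 → W * 6 = 1 ∨ W * 6 = 2 ∨ (W * 6) ^ 2 - 3 * (W * 6) + 1 = 0 →
            False := by
          rintro W rfl h
          rcases h with h | h | h
          · refine false_of_coprime_cast_eq_zero (F := F) (m := 19) (n := 35) (by norm_num)
              (by exact_mod_cast h19) ?_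
            push_cast; linear_combination h
          · refine false_of_coprime_cast_eq_zero (F := F) (m := 19) (n := 34) (by norm_num)
              (by exact_mod_cast h19) ?_
            push_cast; linear_combination h
          · refine false_of_coprime_cast_eq_zero (F := F) (m := 19) (n := 36 * 36 - 3 * 36 + 1)
              (by norm_num) (by exact_mod_cast h19) ?_
            push_cast; linear_combination h
        have hX6 : (X - 6) * (X + 3) = 0 := by linear_combination hX - h19
        rcases mul_eq_zero.1 hX6 with hh | hh
        · exact key X (by linear_combination hh) hXY
        · exact key Z (by linear_combination h - hh) hZY

end Arithmetic

section ProjectiveLine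

open Matrix

variable {E : Type*} [Field E]

theorem sq_sub_trace_mul_of_mulVec {M : Matrix (Fin 2) (Fin 2) E} (hd : M.det = 1)
    {v : Fin 2 → E} (hv : v ≠ 0) {κ : E} (h : M *ᵥ v = κ • v) : κ ^ 2 - M.trace * κ + 1 = 0 := by
  have h1 := congrArg (· *ᵥ v) (mul_self_fin_two M)
  simp only [sub_mulVec, ← mulVec_mulVec, h, mulVec_smul, smul_mulVec, one_mulVec, hd,
    one_smul, smul_smul] at h1
  have h3 : (κ ^ 2 - M.trace * κ + 1) • v = 0 := by
    rw [add_smul, sub_smul, sq, h1, one_smul]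
    abel
  exact (smul_eq_zero.1 h3).resolve_right hv

theorem trace_sq_eq_four_iff_of_mulVec {M : Matrix (Fin 2) (Fin 2) E} (hd : M.det = 1)
    {v : Fin 2 → E} (hv : v ≠ 0) {κ : E} (h : M *ᵥ v = κ • v) : M.trace ^ 2 = 4 ↔ κ ^ 2 = 1 := by
  have h1 := sq_sub_trace_mul_of_mulVec hd hv h
  constructor
  · intro h4
    have : (κ ^ 2 - 1) ^ 2 = 0 := by
      linear_combination (κ ^ 2 + 1 + M.trace * κ) * h1 + κ ^ 2 * h4
    exact sub_eq_zero.1 (pow_eq_zero_iff two_ne_zero |>.1 this)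
  · intro h4
    linear_combination (M.trace ^ 2 - 4) * (-h4) - (κ ^ 2 + 1 + M.trace * κ) * h1
      + (κ ^ 2 - 1) * h4

theorem eq_smul_of_det_eq_zero {v w : Fin 2 → E} (hw : w ≠ 0) (h : v 0 * w 1 = v 1 * w 0) :
    ∃ c : E, v = c • w := by
  by_cases h0 : w 0 = 0
  · have h1 : w 1 ≠ 0 := by
      intro h1
      refine hw (funext fun i => ?_)
      fin_cases i <;> assumption
    refine ⟨v 1 / w 1, funext fun i => ?_⟩
    fin_cases i
    · have : v 0 = 0 := by
        rw [h0, mul_zero] at h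
        exact (mul_eq_zero.1 h).resolve_right h1
      simp [this, h0]
    · simp [h1]
  · refine ⟨v 0 / w 0, funext fun i => ?_⟩
    fin_cases i
    · simp [h0]
    · simp only [Pi.smul_apply, smul_eq_mul]
      change v 1 = v 0 / w 0 * w 1
      field_simp
      linear_combination -h

/-- Matrices agreeing on two independent vectors are equal. -/
theorem eq_of_mulVec_eq {M N : Matrix (Fin 2) (Fin 2) E} {v w : Fin 2 → E}
    (h : v 0 * w 1 ≠ v 1 * w 0) (hv : M *ᵥ v = N *ᵥ v) (hw : M *ᵥ w = N *ᵥ w) : M = N := by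
  have hu : IsUnit (!![v 0, w 0; v 1, w 1] : Matrix (Fin 2) (Fin 2) E) := by
    rw [isUnit_iff_isUnit_det, det_fin_two_of, isUnit_iff_ne_zero]
    intro h0
    exact h (by linear_combination h0)
  refine hu.mul_right_cancel ?_
  ext i j
  have hv' := congrFun hv i
  have hw' := congrFun hw i
  simp only [mulVec, dotProduct, Fin.sum_univ_two] at hv' hw'
  fin_cases j <;> simpa [Matrix.mul_apply, Fin.sum_univ_two]

/-- A nonscalar matrix of determinant one whose discriminant is a square has an eigenvector for
each of the two roots of its characteristic polynomial. -/
theorem exists_mulVec_eq_smul {M : Matrix (Fin 2) (Fin 2) E} (hd : M.det = 1)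
    (hM : ∀ r : E, M ≠ r • 1) {κ : E} (hκ : κ ^ 2 - M.trace * κ + 1 = 0) :
    ∃ v : Fin 2 → E, v ≠ 0 ∧ M *ᵥ v = κ • v := by
  have h1 : M ≠ (M.trace - κ) • 1 := hM _
  have h3 : (M - κ • 1) * (M - (M.trace - κ) • 1) = 0 := by
    have e : (M - κ • 1) * (M - (M.trace - κ) • 1) = M * M - M.trace • M
        + (κ * (M.trace - κ)) • 1 := by
      simp only [sub_mul, mul_sub, smul_mul_assoc, mul_smul_comm, one_mul, mul_one]
      module
    have h5 : κ * (M.trace - κ) = 1 := by linear_combination -hκ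
    rw [e, mul_self_fin_two M, hd, h5]
    module
  obtain ⟨j, hj⟩ : ∃ j, (M - (M.trace - κ) • 1).col j ≠ 0 := by
    by_contra! hc
    refine h1 (sub_eq_zero.1 ?_)
    ext i j
    exact congrFun (hc j) i
  refine ⟨_, hj, ?_⟩
  have h4 : (M - κ • 1) *ᵥ (M - (M.trace - κ) • 1).col j = 0 := by
    ext i
    have := congrFun (congrFun h3 i) j
    rw [Matrix.mul_apply] at this
    exact this
  rw [sub_mulVec, smul_mulVec, one_mulVec] at h4
  exact sub_eq_zero.1 h4

open scoped LinearAlgebra.Projectivization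

open LinearAlgebra in
theorem Projectivization.mk_eq_mk_of_mulVec {M : Matrix (Fin 2) (Fin 2) E}
    (hM : ∀ r : E, M ≠ r • 1) {v w : Fin 2 → E} (hv : v ≠ 0) (hw : w ≠ 0) {κ : E}
    (h : M *ᵥ v = κ • v) (h' : M *ᵥ w = κ • w) :
    Projectivization.mk E v hv = Projectivization.mk E w hw := by
  rw [Projectivization.mk_eq_mk_iff']
  by_cases hdet : v 0 * w 1 = v 1 * w 0
  · obtain ⟨c, hc⟩ := eq_smul_of_det_eq_zero hw hdet
    exact ⟨c, hc.symm⟩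
  · refine (hM κ (eq_of_mulVec_eq hdet ?_ ?_)).elim <;> rw [smul_mulVec, one_mulVec] <;> assumption

/-- The fixed points on the projective line of a nonscalar matrix of determinant one. -/
theorem ncard_setOf_fixed_of_isSquare (h2 : (2 : E) ≠ 0) {M : Matrix (Fin 2) (Fin 2) E}
    (hd : M.det = 1) (hM : ∀ r : E, M ≠ r • 1) (hs : IsSquare (M.trace ^ 2 - 4))
    (S : Set (ℙ E (Fin 2 → E)))
    (hS : ∀ v hv, Projectivization.mk E v hv ∈ S ↔ ∃ κ : E, M *ᵥ v = κ • v) :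
    (M.trace ^ 2 = 4 → S.ncard = 1) ∧ (M.trace ^ 2 ≠ 4 → S.ncard = 2) := by
  obtain ⟨δ, hδ⟩ := hs
  set lam := (M.trace + δ) / 2 with hlam
  set mu := (M.trace - δ) / 2 with hmu
  have hsum : lam + mu = M.trace := by rw [hlam, hmu]; field_simp; ring
  have hdiff : lam - mu = δ := by rw [hlam, hmu]; field_simp; ring
  have hprod : lam * mu = 1 := by
    rw [hlam, hmu]; field_simp; linear_combination hδ
  obtain ⟨v, hv, hvl⟩ := exists_mulVec_eq_smul hd hM (κ := lam)
    (by rw [← hsum]; linear_combination -hprod)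
  obtain ⟨w, hw, hwm⟩ := exists_mulVec_eq_smul hd hM (κ := mu)
    (by rw [← hsum]; linear_combination -hprod)
  have hSeq : S = {Projectivization.mk E v hv, Projectivization.mk E w hw} := by
    ext p
    induction p with | h u hu =>
    rw [hS, Set.mem_insert_iff, Set.mem_singleton_iff]
    constructor
    · rintro ⟨κ, hκ⟩
      have h1 := sq_sub_trace_mul_of_mulVec hd hu hκ
      have h3 : (κ - lam) * (κ - mu) = 0 := by
        linear_combination h1 - κ * hsum + hprod
      rcases mul_eq_zero.1 h3 with h | h
      · left
        rw [sub_eq_zero.1 h] at hκ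
        exact Projectivization.mk_eq_mk_of_mulVec hM hu hv hκ hvl
      · right
        rw [sub_eq_zero.1 h] at hκ
        exact Projectivization.mk_eq_mk_of_mulVec hM hu hw hκ hwm
    · rintro (h | h)
      · exact (hS u hu).1 (by rw [h, hS]; exact ⟨_, hvl⟩)
      · exact (hS u hu).1 (by rw [h, hS]; exact ⟨_, hwm⟩)
  constructor
  · intro h4
    have h0 : lam = mu := by
      rw [← sub_eq_zero, hdiff]
      rw [h4, sub_self] at hδ
      exact (mul_self_eq_zero.1 hδ.symm)
    rw [← h0] at hwm
    rw [hSeq, Projectivization.mk_eq_mk_of_mulVec hM hv hw hvl hwm, Set.pair_eq_singleton,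
      Set.ncard_singleton]
  · intro h4
    rw [hSeq, Set.ncard_pair]
    intro he
    rw [Projectivization.mk_eq_mk_iff'] at he
    obtain ⟨c, hc⟩ := he
    rw [← hc, mulVec_smul, hwm, smul_comm] at hvl
    have h5 : lam = mu := by
      have : (lam - mu) • (c • w) = 0 := by rw [sub_smul, ← hvl, sub_self]
      rw [hc] at this
      exact sub_eq_zero.1 ((smul_eq_zero.1 this).resolve_right hv)
    refine h4 ?_
    rw [h5, sub_self] at hdiff
    rw [← hdiff, mul_zero] at hδ
    exact sub_eq_zero.1 hδ

end ProjectiveLine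

section Action

open Matrix
open scoped LinearAlgebra.Projectivization

variable {F E : Type*} [Field F] [Field E]

/-- The homomorphism of projective special linear groups induced by a field homomorphism. -/
def pslMap (f : F →+* E) :
    ProjectiveSpecialLinearGroup (Fin 2) F →* ProjectiveSpecialLinearGroup (Fin 2) E :=
  QuotientGroup.map _ _ (Matrix.SpecialLinearGroup.map f) (by
    intro M hM
    rw [Subgroup.mem_comap, ← QuotientGroup.eq_one_iff, psl_mk_eq_one_iff]
    rw [← QuotientGroup.eq_one_iff, psl_mk_eq_one_iff] at hM
    rcases hM with h | h
    · left
      rw [Matrix.SpecialLinearGroup.map_apply_coe, h]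
      simp
    · right
      rw [Matrix.SpecialLinearGroup.map_apply_coe, h, map_neg, map_one])

theorem pslMap_smul_eq_self_iff (f : F →+* E) (M : Matrix.SpecialLinearGroup (Fin 2) F)
    {v : Fin 2 → E} (hv : v ≠ 0) :
    pslMap f M • Projectivization.mk E v hv = Projectivization.mk E v hv ↔
      ∃ κ : E, M.1.map f *ᵥ v = κ • v := by
  have e : pslMap f M • Projectivization.mk E v hv =
      Matrix.SpecialLinearGroup.map f M • Projectivization.mk E v hv := rfl
  rw [e, Projectivization.matrixSpecialLinearGroup_smul_def, Projectivization.smul_mk,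
    Projectivization.mk_eq_mk_iff']
  exact ⟨fun ⟨a, ha⟩ => ⟨a, ha.symm⟩, fun ⟨a, ha⟩ => ⟨a, ha.symm⟩⟩

theorem trace_map_eq (f : F →+* E) (M : Matrix (Fin 2) (Fin 2) F) :
    (M.map f).trace = f M.trace := by
  simp [trace_fin_two]

theorem det_map_eq_one (f : F →+* E) (M : Matrix.SpecialLinearGroup (Fin 2) F) :
    (M.1.map f).det = 1 := by
  have := f.map_det M.1
  rw [M.2, map_one] at this
  exact this.symm

theorem map_ne_smul_one (f : F →+* E) {M : Matrix.SpecialLinearGroup (Fin 2) F}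
    (h : (M : ProjectiveSpecialLinearGroup (Fin 2) F) ≠ 1) (r : E) : M.1.map f ≠ r • 1 := by
  intro hr
  have h00 := congrFun (congrFun hr 0) 0
  have h01 := congrFun (congrFun hr 0) 1
  have h10 := congrFun (congrFun hr 1) 0
  have h11 := congrFun (congrFun hr 1) 1
  simp only [map_apply, Matrix.smul_apply, one_apply_eq, smul_eq_mul, mul_one] at h00 h11
  simp only [map_apply, Matrix.smul_apply, smul_eq_mul, ne_eq, zero_ne_one, one_ne_zero,
    not_false_eq_true, one_apply_ne, mul_zero, map_eq_zero] at h01 h10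
  refine ne_smul_one_of_psl_ne_one h (M.1 0 0) ?_
  have : M.1 1 1 = M.1 0 0 := f.injective (h11.trans h00.symm)
  ext i j
  fin_cases i <;> fin_cases j <;> simp [h01, h10, this]

theorem pow_eq_of_trace_sq_eq_four {ℓ : ℕ} [Fact ℓ.Prime] [CharP F ℓ]
    {M : Matrix.SpecialLinearGroup (Fin 2) F} (h : M.1.trace ^ 2 = 4) :
    (M : ProjectiveSpecialLinearGroup (Fin 2) F) ^ ℓ = 1 := by
  obtain ⟨ε, hε, hε1⟩ : ∃ ε : F, M.1.trace = 2 * ε ∧ (ε = 1 ∨ ε = -1) := by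
    have : (M.1.trace - 2) * (M.1.trace + 2) = 0 := by linear_combination h
    rcases mul_eq_zero.1 this with h | h
    · exact ⟨1, by linear_combination h, Or.inl rfl⟩
    · exact ⟨-1, by linear_combination h, Or.inr rfl⟩
  have hε2 : ε * ε = 1 := by rcases hε1 with h | h <;> rw [h] <;> ring
  have hN : (M.1 - ε • 1) ^ 2 = 0 := by
    rw [sq]
    have e : (M.1 - ε • 1) * (M.1 - ε • 1) = M.1 * M.1 - (2 * ε) • M.1 + (ε * ε) • 1 := by
      simp only [sub_mul, mul_sub, smul_mul_assoc, mul_smul_comm, one_mul, mul_one]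
      module
    rw [e, mul_self_fin_two, hε, M.2, hε2]
    module
  have hMN : M.1 = ε • 1 + (M.1 - ε • 1) := by abel
  have hℓ2 : 2 ≤ ℓ := (Fact.out : ℓ.Prime).two_le
  have hcomm : Commute (ε • (1 : Matrix (Fin 2) (Fin 2) F)) (M.1 - ε • 1) := by
    rw [commute_iff_eq]
    simp
  have : CharP (Matrix (Fin 2) (Fin 2) F) ℓ := Matrix.charP ℓ
  have h3 : M.1 ^ ℓ = (ε ^ ℓ) • 1 := by
    rw [hMN, add_pow_char_of_commute _ hcomm, smul_pow, one_pow,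
      ← Nat.add_sub_cancel' hℓ2, pow_add (M.1 - ε • 1), hN, zero_mul, add_zero]
  rw [← QuotientGroup.mk_pow, psl_mk_eq_one_iff, Matrix.SpecialLinearGroup.coe_pow]
  exact eq_or_eq_neg_of_smul_one_mul h3 (by rw [det_pow, M.2, one_pow])

/-- If `M ^ n` is scalar modulo sign, so are its eigenvalues, and Frobenius-type powers fix
the square of the trace. -/
theorem trace_sq_pow_eq {ℓ : ℕ} [Fact ℓ.Prime] [CharP F ℓ] [CharP E ℓ] (f : F →+* E)
    (hsq : ∀ x : F, IsSquare (f x)) (h2 : (2 : F) ≠ 0) (m : ℕ)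
    {M : Matrix.SpecialLinearGroup (Fin 2) F}
    (h : (M : ProjectiveSpecialLinearGroup (Fin 2) F) ^ (ℓ ^ m - 1) = 1 ∨
      (M : ProjectiveSpecialLinearGroup (Fin 2) F) ^ (ℓ ^ m + 1) = 1) :
    (M.1.trace ^ 2) ^ ℓ ^ m = M.1.trace ^ 2 := by
  have hsub (a b : E) : (a + b) ^ ℓ ^ m = a ^ ℓ ^ m + b ^ ℓ ^ m := add_pow_char_pow a b ..
  have hQ : 1 ≤ ℓ ^ m := Nat.one_le_pow _ _ (Fact.out : ℓ.Prime).pos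
  by_cases hM1 : (M : ProjectiveSpecialLinearGroup (Fin 2) F) = 1
  · rw [← trSq_mk, hM1, trSq_one]
    have := map_ofNat (iterateFrobenius F ℓ m) 4
    rwa [iterateFrobenius_def] at this
  obtain ⟨δ, hδ⟩ := hsq (M.1.trace ^ 2 - 4)
  have h2E : (2 : E) ≠ 0 := by
    intro h0
    exact h2 (f.injective (by rw [map_zero, map_ofNat, h0]))
  rw [map_sub, map_pow, map_ofNat] at hδ
  set t := f M.1.trace with ht
  set lam := (t + δ) / 2 with hlam
  set mu := (t - δ) / 2 with hmu
  have hsum : lam + mu = t := by rw [hlam, hmu]; field_simp; ring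
  have hprod : lam * mu = 1 := by
    rw [hlam, hmu]; field_simp; linear_combination hδ
  obtain ⟨v, hv, hvl⟩ := exists_mulVec_eq_smul (det_map_eq_one f M) (map_ne_smul_one f hM1)
    (κ := lam) (by rw [trace_map_eq, ← ht, ← hsum]; linear_combination -hprod)
  have hpow (n : ℕ) (hn : (M : ProjectiveSpecialLinearGroup (Fin 2) F) ^ n = 1) :
      lam ^ n = 1 ∨ lam ^ n = -1 := by
    have h5 : (M.1.map f) ^ n *ᵥ v = lam ^ n • v := by
      clear hn
      induction n with
      | zero => simp
      | succ n ih => rw [pow_succ, ← mulVec_mulVec, hvl, mulVec_smul, ih, smul_smul, pow_succ, mul_comm]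
    rw [← QuotientGroup.mk_pow, psl_mk_eq_one_iff, Matrix.SpecialLinearGroup.coe_pow] at hn
    have h6 : (M.1.map f) ^ n = (M.1 ^ n).map f := (map_pow f.mapMatrix M.1 n).symm
    rw [h6] at h5
    rcases hn with hn | hn
    · left
      rw [hn] at h5
      have h7 : (lam ^ n - 1) • v = 0 := by
        rw [sub_smul, ← h5]; simp
      exact sub_eq_zero.1 ((smul_eq_zero.1 h7).resolve_right hv)
    · right
      rw [hn] at h5
      have h7 : (lam ^ n + 1) • v = 0 := by
        rw [add_smul, ← h5, one_smul]
        have : (-1 : Matrix (Fin 2) (Fin 2) F).map f = -1 := by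
          rw [← RingHom.mapMatrix_apply, map_neg, map_one]
        rw [this, neg_mulVec, one_mulVec, neg_add_cancel]
      exact eq_neg_of_add_eq_zero_left ((smul_eq_zero.1 h7).resolve_right hv)
  have hl0 : lam ≠ 0 := left_ne_zero_of_mul_eq_one hprod
  have hmu' : mu = lam⁻¹ := by field_simp; linear_combination hprod
  have key : t ^ ℓ ^ m = t ∨ t ^ ℓ ^ m = -t := by
    rw [← hsum, hsub, hmu']
    rcases h with h | h
    · have e : lam ^ ℓ ^ m = lam ^ (ℓ ^ m - 1) * lam := by rw [← pow_succ, Nat.sub_add_cancel hQ]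
      rcases hpow _ h with h | h
      · left; rw [inv_pow, e, h, one_mul]
      · right; rw [inv_pow, e, h]; field_simp; ring
    · have e : lam ^ ℓ ^ m = lam ^ (ℓ ^ m + 1) * lam⁻¹ := by rw [pow_succ]; field_simp
      rcases hpow _ h with h | h
      · left; rw [inv_pow, e, h]; field_simp; ring
      · right; rw [inv_pow, e, h]; field_simp; ring
  apply f.injective
  rw [map_pow, map_pow, ← ht, ← pow_mul, mul_comm, pow_mul]
  rcases key with h | h <;> rw [h]
  ring

end Action

section Dichotomy

open Matrix MulAction
open scoped LinearAlgebra.Projectivization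

variable {F E : Type*} [Field F] [Field E]

theorem trSq_eq_four_iff_of_smul_eq (f : F →+* E) (M : Matrix.SpecialLinearGroup (Fin 2) F)
    {v : Fin 2 → E} (hv : v ≠ 0) {κ : E} (h : M.1.map f *ᵥ v = κ • v) :
    trSq (M : ProjectiveSpecialLinearGroup (Fin 2) F) = 4 ↔ κ ^ 2 = 1 := by
  rw [← trace_sq_eq_four_iff_of_mulVec (det_map_eq_one f M) hv h, trace_map_eq, trSq_mk,
    ← map_pow, ← f.injective.eq_iff, map_ofNat]

/-- Apply the counting dichotomy to a subgroup acting on the projective line over an extension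
in which all elements of `F` are squares. -/
theorem subgroup_dichotomy [Finite F] [Finite E] {ℓ : ℕ} [Fact ℓ.Prime] [CharP F ℓ] [CharP E ℓ]
    (f : F →+* E) (hsq : ∀ x : F, IsSquare (f x)) (h2 : (2 : F) ≠ 0)
    (H : Subgroup (ProjectiveSpecialLinearGroup (Fin 2) F))
    (horb1 : ∀ x : ℙ E (Fin 2 → E), ∃ h ∈ H, pslMap f h • x ≠ x)
    (horb2 : ∀ x y : ℙ E (Fin 2 → E), x ≠ y → ∃ h ∈ H,
      ¬ ((pslMap f h • x = x ∧ pslMap f h • y = y) ∨ (pslMap f h • x = y ∧ pslMap f h • y = x))) :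
    (∀ h ∈ H, orderOf h ≤ 5) ∨
      ∃ m : ℕ, 1 ≤ m ∧ (ℓ ^ m) * ((ℓ ^ m) ^ 2 - 1) ≤ 2 * Nat.card H ∧
        ∀ h ∈ H, trSq h ^ ℓ ^ m = trSq h := by
  let φ : H →* ProjectiveSpecialLinearGroup (Fin 2) E := (pslMap f).comp H.subtype
  let _ : MulAction H (ℙ E (Fin 2 → E)) := MulAction.compHom _ φ
  have hact (h : H) (x : ℙ E (Fin 2 → E)) : h • x = pslMap f h.1 • x := rfl
  have : Finite (Matrix.SpecialLinearGroup (Fin 2) F) := inferInstance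
  have : Finite (ProjectiveSpecialLinearGroup (Fin 2) F) :=
    inferInstanceAs (Finite (Matrix.SpecialLinearGroup (Fin 2) F ⧸ _))
  have h2E : (2 : E) ≠ 0 := by
    intro h0
    exact h2 (f.injective (by rw [map_zero, map_ofNat, h0]))
  have hfix (h : H) (h1 : h ≠ 1) : (trSq h.1 = 4 → (fixedBy (ℙ E (Fin 2 → E)) h).ncard = 1) ∧
      (trSq h.1 ≠ 4 → (fixedBy (ℙ E (Fin 2 → E)) h).ncard = 2) := by
    obtain ⟨h, hh⟩ := h
    induction h using QuotientGroup.induction_on with | H M =>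
    have hM1 : (M : ProjectiveSpecialLinearGroup (Fin 2) F) ≠ 1 := fun e => h1 (Subtype.ext e)
    have := ncard_setOf_fixed_of_isSquare h2E (det_map_eq_one f M) (map_ne_smul_one f hM1)
      (by
        rw [trace_map_eq]
        have := hsq (M.1.trace ^ 2 - 4)
        rwa [map_sub, map_pow, map_ofNat] at this)
      (fixedBy (ℙ E (Fin 2 → E)) (⟨M, hh⟩ : H)) (fun v hv => by
        rw [mem_fixedBy, hact]
        exact pslMap_smul_eq_self_iff f M hv)
    rw [trace_map_eq, ← map_pow, ← map_ofNat f 4, ne_eq, f.injective.eq_iff] at this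
    exact this
  have hUpow (h : H) (hU : trSq h.1 = 4) : h ^ ℓ = 1 := by
    obtain ⟨h, hh⟩ := h
    induction h using QuotientGroup.induction_on with | H M =>
    exact Subtype.ext (pow_eq_of_trace_sq_eq_four hU)
  have key := counting_dichotomy (H := H) (X := ℙ E (Fin 2 → E)) (fun h => trSq h.1 = 4)
    (ℓ := ℓ) Fact.out
    (by
      rintro rfl
      exact h2 (by exact_mod_cast CharP.cast_eq_zero F 2))
    trSq_one (fun h h1 hU => (hfix h h1).1 hU) (fun h h1 hU => (hfix h h1).2 hU)
    (by
      rintro x ⟨g, hg⟩ ⟨h, hh⟩ hgx hhx hUg hUh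
      induction g using QuotientGroup.induction_on with | H M =>
      induction h using QuotientGroup.induction_on with | H N =>
      induction x using Projectivization.ind with | h v hv =>
      obtain ⟨κ, hκ⟩ := (pslMap_smul_eq_self_iff f M hv).1 hgx
      obtain ⟨μ, hμ⟩ := (pslMap_smul_eq_self_iff f N hv).1 hhx
      have hMN : (M * N).1.map f *ᵥ v = (μ * κ) • v := by
        have : (M * N).1.map f = M.1.map f * N.1.map f := map_mul f.mapMatrix M.1 N.1
        rw [this, ← mulVec_mulVec, hμ, mulVec_smul, hκ, smul_smul]
      refine (trSq_eq_four_iff_of_smul_eq f (M * N) hv hMN).2 ?_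
      rw [mul_pow, (trSq_eq_four_iff_of_smul_eq f M hv hκ).1 hUg,
        (trSq_eq_four_iff_of_smul_eq f N hv hμ).1 hUh, one_mul])
    hUpow
    (by
      intro x hx
      rw [Nat.card_coe_set_eq, Set.ncard_eq_one] at hx
      obtain ⟨a, ha⟩ := hx
      obtain ⟨h, hh, hne⟩ := horb1 x
      have e1 : x = a := by
        have := mem_orbit_self (M := H) x
        rwa [ha] at this
      have e2 : pslMap f h • x = a := by
        have := mem_orbit x (⟨h, hh⟩ : H)
        rwa [ha] at this
      exact hne (e2.trans e1.symm))
    (by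
      intro z hz
      rw [Nat.card_coe_set_eq, Set.ncard_eq_two] at hz
      obtain ⟨x, y, hxy, he⟩ := hz
      obtain ⟨h, hh, hne⟩ := horb2 x y hxy
      have hx : x ∈ orbit H z := by rw [he]; exact Or.inl rfl
      have hy : y ∈ orbit H z := by rw [he]; exact Or.inr rfl
      have hx' : pslMap f h • x = x ∨ pslMap f h • x = y := by
        have : (⟨h, hh⟩ : H) • x ∈ orbit H z := mem_orbit_of_mem_orbit _ hx
        rwa [he] at this
      have hy' : pslMap f h • y = x ∨ pslMap f h • y = y := by
        have : (⟨h, hh⟩ : H) • y ∈ orbit H z := mem_orbit_of_mem_orbit _ hy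
        rwa [he] at this
      rcases hx' with hx' | hx' <;> rcases hy' with hy' | hy'
      · exact hxy (smul_left_cancel _ (hx'.trans hy'.symm))
      · exact hne (Or.inl ⟨hx', hy'⟩)
      · exact hne (Or.inr ⟨hx', hy'⟩)
      · exact hxy (smul_left_cancel _ (hx'.trans hy'.symm)))
  rcases key with key | ⟨m, hm1, hm, hall⟩
  · left
    intro h hh
    have := key ⟨h, hh⟩
    rwa [Subgroup.orderOf_mk] at this
  · refine Or.inr ⟨m, hm1, hm, fun h hh => ?_⟩
    have h4 : trSq h = 4 → trSq h ^ ℓ ^ m = trSq h := fun e => by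
      rw [e]
      have := map_ofNat (iterateFrobenius F ℓ m) 4
      rwa [iterateFrobenius_def] at this
    rcases hall ⟨h, hh⟩ with hU | hpow
    · exact h4 hU
    · induction h using QuotientGroup.induction_on with | H M =>
      exact trace_sq_pow_eq f hsq h2 m (by
        rcases hpow with hp | hp
        · exact Or.inl (congrArg Subtype.val hp)
        · exact Or.inr (congrArg Subtype.val hp))

end Dichotomy

section Orbits

open Matrix
open scoped LinearAlgebra.Projectivization

variable {F E : Type*} [Field F] [Field E]

theorem mul_comm_of_pslMap_smul_eq (f : F →+* E) {M N : Matrix.SpecialLinearGroup (Fin 2) F}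
    {x y : ℙ E (Fin 2 → E)} (hxy : x ≠ y) (hMx : pslMap f M • x = x) (hMy : pslMap f M • y = y)
    (hNx : pslMap f N • x = x) (hNy : pslMap f N • y = y) : M.1 * N.1 = N.1 * M.1 := by
  induction x using Projectivization.ind with | h v hv =>
  induction y using Projectivization.ind with | h w hw =>
  rw [pslMap_smul_eq_self_iff] at *
  obtain ⟨α, hα⟩ := hMx
  obtain ⟨β, hβ⟩ := hMy
  obtain ⟨γ, hγ⟩ := hNx
  obtain ⟨δ, hδ⟩ := hNy
  have hinj : Function.Injective (f.mapMatrix (m := Fin 2)) := by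
    rw [RingHom.mapMatrix]
    exact fun X Y h => Matrix.map_injective f.injective h
  apply hinj
  rw [map_mul, map_mul]
  refine eq_of_mulVec_eq (v := v) (w := w) ?_ ?_ ?_
  · intro h
    obtain ⟨c, hc⟩ := eq_smul_of_det_eq_zero hw h
    exact hxy ((Projectivization.mk_eq_mk_iff' E v w hv hw).2 ⟨c, hc.symm⟩)
  · rw [← mulVec_mulVec, ← mulVec_mulVec]
    simp only [RingHom.mapMatrix_apply, hα, hγ, mulVec_smul, smul_smul, mul_comm]
  · rw [← mulVec_mulVec, ← mulVec_mulVec]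
    simp only [RingHom.mapMatrix_apply, hβ, hδ, mulVec_smul, smul_smul, mul_comm]

namespace IsGenQuad

variable {A B C D : Matrix.SpecialLinearGroup (Fin 2) F}

theorem mul_ne_smul_one (h2 : (2 : F) ≠ 0) (h : IsGenQuad A B C D) (r : F) :
    A.1 * B.1 ≠ r • 1 := by
  intro hr
  have h4 := h.trace_sq_ne_four h2
  have hd : (A.1 * B.1).det = 1 := by rw [det_mul, A.2, B.2, one_mul]
  rcases eq_or_eq_neg_of_smul_one_mul hr hd with h | h <;> rw [h] at h4 <;>
    exact h4 (by simp; norm_num)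

theorem exists_smul_ne (h2 : (2 : F) ≠ 0) (h : IsGenQuad A B C D) (f : F →+* E)
    (x : ℙ E (Fin 2 → E)) :
    ∃ g ∈ Subgroup.closure {(A : ProjectiveSpecialLinearGroup (Fin 2) F),
      (B : ProjectiveSpecialLinearGroup (Fin 2) F),
      (C : ProjectiveSpecialLinearGroup (Fin 2) F)}, pslMap f g • x ≠ x := by
  by_contra! hc
  have hA := hc A (Subgroup.subset_closure (by simp))
  have hB := hc B (Subgroup.subset_closure (by simp))
  induction x using Projectivization.ind with | h v hv =>
  rw [pslMap_smul_eq_self_iff] at hA hB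
  obtain ⟨α, hα⟩ := hA
  obtain ⟨β, hβ⟩ := hB
  have hker : (A.1 * B.1 - B.1 * A.1).map f *ᵥ v = 0 := by
    have e : (A.1 * B.1 - B.1 * A.1).map f =
        A.1.map f * B.1.map f - B.1.map f * A.1.map f := by
      simp only [← RingHom.mapMatrix_apply, map_sub, map_mul]
    rw [e, sub_mulVec, ← mulVec_mulVec, ← mulVec_mulVec, hα, hβ, mulVec_smul, mulVec_smul, hα, hβ,
      smul_smul, smul_smul, mul_comm, sub_self]
  have hdet : ((A.1 * B.1 - B.1 * A.1).map f).det = 0 :=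
    exists_mulVec_eq_zero_iff.1 ⟨v, hv, hker⟩
  have hdet' : (A.1 * B.1 - B.1 * A.1).det = 0 := by
    apply f.injective
    rw [map_zero, ← hdet]
    exact f.map_det _
  refine h.trace_sq_ne_four h2 ?_
  have hA := A.2
  have hB := B.2
  have tA := h.quad.trA
  have tB := h.quad.trB
  rw [det_fin_two] at hA hB hdet'
  rw [trace_fin_two] at tA tB ⊢
  simp only [Matrix.sub_apply, Matrix.mul_apply, Fin.sum_univ_two] at hdet' ⊢
  have eA := eq_neg_of_add_eq_zero_right tA
  have eB := eq_neg_of_add_eq_zero_right tB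
  rw [eA] at hA hdet' ⊢
  rw [eB] at hB hdet' ⊢
  linear_combination (4 * (B.1 0 0 * -B.1 0 0 - B.1 0 1 * B.1 1 0)) * hA + 4 * hB - hdet'

theorem exists_not_stabilize (h2 : (2 : F) ≠ 0) (h : IsGenQuad A B C D) (f : F →+* E)
    (x y : ℙ E (Fin 2 → E)) (hxy : x ≠ y) :
    ∃ g ∈ Subgroup.closure {(A : ProjectiveSpecialLinearGroup (Fin 2) F),
      (B : ProjectiveSpecialLinearGroup (Fin 2) F),
      (C : ProjectiveSpecialLinearGroup (Fin 2) F)},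
      ¬ ((pslMap f g • x = x ∧ pslMap f g • y = y) ∨
        (pslMap f g • x = y ∧ pslMap f g • y = x)) := by
  by_contra! hc
  have hq := h.quad
  have mA : (A : ProjectiveSpecialLinearGroup (Fin 2) F) ∈ Subgroup.closure
    {(A : ProjectiveSpecialLinearGroup (Fin 2) F), (B : ProjectiveSpecialLinearGroup (Fin 2) F),
      (C : ProjectiveSpecialLinearGroup (Fin 2) F)} := Subgroup.subset_closure (by simp)
  have mC : (C : ProjectiveSpecialLinearGroup (Fin 2) F) ∈ Subgroup.closure
    {(A : ProjectiveSpecialLinearGroup (Fin 2) F), (B : ProjectiveSpecialLinearGroup (Fin 2) F),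
      (C : ProjectiveSpecialLinearGroup (Fin 2) F)} := Subgroup.subset_closure (by simp)
  have hA := hc A mA
  have hB := hc B (Subgroup.subset_closure (by simp))
  have hC := hc C mC
  have hP := h.mul_ne_smul_one h2
  have ht := h.trace_ne_zero
  have hadd : A.1 * B.1 + B.1 * A.1 = (A.1 * B.1).trace • 1 :=
    mul_add_mul_of_trace_eq_zero hq.trA hq.trB
  have hBA : B.1 * A.1 = (A.1 * B.1).trace • 1 - A.1 * B.1 := by rw [← hadd]; abel
  have hswap : A.1 * B.1 * (A.1 * B.1) ≠ B.1 * A.1 * (B.1 * A.1) := by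
    intro he
    rw [hBA] at he
    have e2 : ((A.1 * B.1).trace • (1 : Matrix (Fin 2) (Fin 2) F) - A.1 * B.1) *
        ((A.1 * B.1).trace • 1 - A.1 * B.1) = A.1 * B.1 * (A.1 * B.1)
          - (2 * (A.1 * B.1).trace) • (A.1 * B.1) + ((A.1 * B.1).trace * (A.1 * B.1).trace) • 1 := by
      generalize A.1 * B.1 = P
      simp only [sub_mul, mul_sub, smul_mul_assoc, mul_smul_comm, one_mul, mul_one]
      module
    rw [e2] at he
    have e3 : (2 * (A.1 * B.1).trace) • (A.1 * B.1) =
        ((A.1 * B.1).trace * (A.1 * B.1).trace) • 1 := by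
      have := sub_eq_zero.2 he
      rw [← sub_eq_zero, ← this]
      abel
    have e4 := congrArg ((2 * (A.1 * B.1).trace)⁻¹ • ·) e3
    simp only [smul_smul] at e4
    rw [inv_mul_cancel₀ (mul_ne_zero h2 ht), one_smul] at e4
    exact hP _ e4
  have hne : A.1 * B.1 ≠ B.1 * A.1 := by
    intro he
    exact hswap (by rw [he])
  rcases hA with ⟨hAx, hAy⟩ | ⟨hAx, hAy⟩ <;> rcases hB with ⟨hBx, hBy⟩ | ⟨hBx, hBy⟩
  · exact hne (mul_comm_of_pslMap_smul_eq f hxy hAx hAy hBx hBy)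
  · have := mul_comm_of_pslMap_smul_eq f (M := A) (N := B * A * B) hxy hAx hAy
      (by simp only [QuotientGroup.mk_mul, map_mul, mul_smul, hBx, hAy, hBy])
      (by simp only [QuotientGroup.mk_mul, map_mul, mul_smul, hBx, hAx, hBy])
    simp only [Matrix.SpecialLinearGroup.coe_mul] at this
    exact hswap (by simpa only [mul_assoc] using this)
  · have := mul_comm_of_pslMap_smul_eq f (M := B) (N := A * B * A) hxy hBx hBy
      (by simp only [QuotientGroup.mk_mul, map_mul, mul_smul, hAx, hAy, hBy])
      (by simp only [QuotientGroup.mk_mul, map_mul, mul_smul, hAx, hAy, hBx])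
    simp only [Matrix.SpecialLinearGroup.coe_mul] at this
    exact hswap.symm (by simpa only [mul_assoc] using this)
  · have hPx : pslMap f ((A * B : Matrix.SpecialLinearGroup (Fin 2) F) :
        ProjectiveSpecialLinearGroup (Fin 2) F) • x = x := by
      simp only [QuotientGroup.mk_mul, map_mul, mul_smul, hBx, hAy]
    have hPy : pslMap f ((A * B : Matrix.SpecialLinearGroup (Fin 2) F) :
        ProjectiveSpecialLinearGroup (Fin 2) F) • y = y := by
      simp only [QuotientGroup.mk_mul, map_mul, mul_smul, hAx, hBy]
    have hAC := mul_eq_neg_mul_of_trace hq.trA hq.trC hq.trAC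
    rcases hC with ⟨hCx, hCy⟩ | ⟨hCx, hCy⟩
    · have e := mul_comm_of_pslMap_smul_eq f hxy hCx hCy hPx hPy
      rw [Matrix.SpecialLinearGroup.coe_mul, ← mul_assoc, hAC] at e
      have e1 : A.1 * (B.1 * C.1 + C.1 * B.1) = 0 := by
        rw [mul_add, ← mul_assoc, ← e, ← mul_assoc, neg_mul, neg_add_cancel]
      rw [mul_add_mul_of_trace_eq_zero hq.trB hq.trC, mul_smul_comm, mul_one] at e1
      rcases smul_eq_zero.1 e1 with e2 | e2
      · exact h.trace_middle_ne_zero h2 e2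
      · have := hq.detA
        rw [e2] at this
        simp at this
    · have e := mul_comm_of_pslMap_smul_eq f (M := A * B) (N := A * C) hxy hPx hPy
        (by simp only [QuotientGroup.mk_mul, map_mul, mul_smul, hCx, hAy])
        (by simp only [QuotientGroup.mk_mul, map_mul, mul_smul, hCy, hAx])
      have hAD := mul_eq_neg_mul_of_trace hq.trA hq.trD hq.trAD
      have hBD := mul_eq_neg_mul_of_trace hq.trB hq.trD hq.trBD
      have e1 : (A * B).1 * D.1 = D.1 * (A * B).1 := by
        rw [Matrix.SpecialLinearGroup.coe_mul, ← mul_assoc, hAD, neg_mul, mul_assoc A.1 D.1, hBD,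
          mul_neg, neg_neg, mul_assoc]
      have e2 := commute_of_commute_of_ne_smul hP e e1
      have e3 := psl_mk_eq_of_mul_comm h2 (M := A * C) (N := D) hq.trAC hq.trD (by
        intro h1
        have htr := hq.trAC
        rcases (psl_mk_eq_one_iff _).1 h1 with h1 | h1 <;>
          rw [Matrix.SpecialLinearGroup.coe_mul] at h1 <;> rw [h1] at htr <;>
            simp at htr
        · exact h2 htr
        · exact h2 htr) e2
      refine h.last ?_
      rw [← e3]
      exact mul_mem mA mC

end IsGenQuad

end Orbits

section OrderBound

open Matrix

open Polynomial in
theorem exists_field_forall_isSquare (F : Type*) [Field F] [Finite F] :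
    ∃ (p : F[X]), Finite p.SplittingField ∧
      ∀ x : F, IsSquare (algebraMap F p.SplittingField x) := by
  have := Fintype.ofFinite F
  let p : F[X] := ∏ δ : F, (X ^ 2 - C δ)
  have hp : p ≠ 0 := Finset.prod_ne_zero_iff.2 fun δ _ => X_pow_sub_C_ne_zero two_pos δ
  refine ⟨p, Module.finite_of_finite F, fun δ => ?_⟩
  have hs := Polynomial.SplittingField.splits p
  have hd : (X ^ 2 - C δ).map (algebraMap F p.SplittingField) ∣
      p.map (algebraMap F p.SplittingField) :=
    Polynomial.map_dvd _ (Finset.dvd_prod_of_mem _ (Finset.mem_univ δ))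
  have hs' := hs.of_dvd (Polynomial.map_ne_zero hp) hd
  obtain ⟨y, hy⟩ := hs'.exists_eval_eq_zero (by
    rw [degree_map, degree_X_pow_sub_C two_pos]; norm_num)
  refine ⟨y, ?_⟩
  simp at hy
  linear_combination -hy

variable {F : Type*} [Field F]

instance [Finite F] : Finite (ProjectiveSpecialLinearGroup (Fin 2) F) :=
  inferInstanceAs (Finite (Matrix.SpecialLinearGroup (Fin 2) F ⧸ _))

theorem two_mul_card_psl_le [Fintype F] (h2 : (2 : F) ≠ 0) :
    2 * Nat.card (ProjectiveSpecialLinearGroup (Fin 2) F) ≤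
      Fintype.card F * (Fintype.card F ^ 2 - 1) := by
  set q := Fintype.card F with hq
  have hq1 : 2 ≤ q := Fintype.one_lt_card
  have hGL : Nat.card (GL (Fin 2) F) = (q - 1) * (q * (q ^ 2 - 1)) := by
    rw [card_GL_field, Fin.prod_univ_two]
    obtain ⟨r, hr⟩ := Nat.exists_eq_add_of_le hq1
    simp only [Fin.val_zero, Fin.val_one, pow_zero, pow_one]
    have : q ^ 2 - q = (q - 1) * q := by rw [Nat.sub_mul, sq, one_mul]
    rw [← hq, this]
    ring
  have hinj : Function.Injective (fun x : Matrix.SpecialLinearGroup (Fin 2) F × Fˣ =>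
      (x.1 : GL (Fin 2) F) *
        Matrix.GeneralLinearGroup.mkOfDetNeZero !![x.2.1, 0; 0, 1] (by simp [det_fin_two_of])) := by
    rintro ⟨M, a⟩ ⟨N, b⟩ h
    have h1 := congrArg (fun g : GL (Fin 2) F => g.1) h
    have hM : (M.1 * !![a.1, 0; 0, 1] : Matrix (Fin 2) (Fin 2) F) = N.1 * !![b.1, 0; 0, 1] := h1
    have hd := congrArg Matrix.det hM
    rw [det_mul, det_mul, M.2, N.2, one_mul, one_mul, det_fin_two_of, det_fin_two_of] at hd
    have hab : a = b := Units.ext (by linear_combination hd)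
    subst hab
    have hu : IsUnit (!![a.1, 0; 0, 1] : Matrix (Fin 2) (Fin 2) F) := by
      rw [isUnit_iff_isUnit_det, det_fin_two_of, isUnit_iff_ne_zero]
      simp
    exact Prod.ext (Subtype.ext (hu.mul_right_cancel hM)) rfl
  have hle := Nat.card_le_card_of_injective _ hinj
  rw [Nat.card_prod, hGL, Nat.card_units, Nat.card_eq_fintype_card (α := F), ← hq,
    mul_comm] at hle
  have hSL := Nat.le_of_mul_le_mul_left hle (by omega)
  rw [Subgroup.card_eq_card_quotient_mul_card_subgroup
    (Subgroup.center (Matrix.SpecialLinearGroup (Fin 2) F))] at hSL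
  have hc : 2 ≤ Nat.card (Subgroup.center (Matrix.SpecialLinearGroup (Fin 2) F)) := by
    have hneg : (-1 : Matrix.SpecialLinearGroup (Fin 2) F) ∈ Subgroup.center _ := by
      rw [Matrix.SpecialLinearGroup.mem_center_iff]
      refine ⟨-1, by simp, ?_⟩
      ext i j
      fin_cases i <;> fin_cases j <;> simp
    have : Nontrivial (Subgroup.center (Matrix.SpecialLinearGroup (Fin 2) F)) := by
      refine ⟨⟨-1, hneg⟩, 1, fun h => h2 ?_⟩
      have h3 := congrArg (fun g : Subgroup.center (Matrix.SpecialLinearGroup (Fin 2) F) =>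
        g.1.1 0 0) h
      simp at h3
      linear_combination -h3
    exact Finite.one_lt_card
  calc _ = Nat.card (ProjectiveSpecialLinearGroup (Fin 2) F) * 2 := mul_comm ..
    _ ≤ _ := (Nat.mul_le_mul_left _ hc).trans hSL

theorem IsGenQuad.orderOf_le [Fintype F] (h2 : (2 : F) ≠ 0)
    {A B C D : Matrix.SpecialLinearGroup (Fin 2) F} (h : IsGenQuad A B C D) :
    ∀ g ∈ Subgroup.closure {(A : ProjectiveSpecialLinearGroup (Fin 2) F),
      (B : ProjectiveSpecialLinearGroup (Fin 2) F),
      (C : ProjectiveSpecialLinearGroup (Fin 2) F)}, orderOf g ≤ 5 := by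
  obtain ⟨p, hfin, hsq⟩ := exists_field_forall_isSquare F
  obtain ⟨ℓ, hchar⟩ := CharP.exists F
  have hℓ : Fact ℓ.Prime := ⟨CharP.char_is_prime F ℓ⟩
  have : CharP p.SplittingField ℓ :=
    charP_of_injective_algebraMap (algebraMap F p.SplittingField).injective ℓ
  set H := Subgroup.closure {(A : ProjectiveSpecialLinearGroup (Fin 2) F),
      (B : ProjectiveSpecialLinearGroup (Fin 2) F),
      (C : ProjectiveSpecialLinearGroup (Fin 2) F)} with hH
  have mA : (A : ProjectiveSpecialLinearGroup (Fin 2) F) ∈ H := Subgroup.subset_closure (by simp)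
  have mB : (B : ProjectiveSpecialLinearGroup (Fin 2) F) ∈ H := Subgroup.subset_closure (by simp)
  have mC : (C : ProjectiveSpecialLinearGroup (Fin 2) F) ∈ H := Subgroup.subset_closure (by simp)
  rcases subgroup_dichotomy (ℓ := ℓ) (algebraMap F p.SplittingField) hsq h2 H
    (h.exists_smul_ne h2 _) (h.exists_not_stabilize h2 _) with h5 | ⟨m, hm1, hm, hall⟩
  · exact h5
  exfalso
  have hX : iterateFrobenius F ℓ m ((A.1 * B.1).trace ^ 2) = (A.1 * B.1).trace ^ 2 := by
    rw [iterateFrobenius_def]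
    exact hall (A * B : Matrix.SpecialLinearGroup (Fin 2) F) (mul_mem mA mB)
  have hY : iterateFrobenius F ℓ m ((B.1 * C.1).trace ^ 2) = (B.1 * C.1).trace ^ 2 := by
    rw [iterateFrobenius_def]
    exact hall (B * C : Matrix.SpecialLinearGroup (Fin 2) F) (mul_mem mB mC)
  have h4 := h.four_mul_trace_sq h2
  have hX4 := h.trace_sq_ne_four h2
  have hZ : iterateFrobenius F ℓ m ((C.1 * D.1).trace ^ 2) = (C.1 * D.1).trace ^ 2 := by
    have h4' := congrArg (iterateFrobenius F ℓ m) h4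
    rw [map_mul, map_mul, map_sub, map_sub, hX, hY, map_ofNat, h4] at h4'
    have := mul_left_cancel₀ (sub_ne_zero.2 hX4.symm) h4'
    linear_combination this
  have hid := h.ringHom_eq h2 _ hX hZ
  have hQ2 : 2 ≤ ℓ ^ m := hℓ.out.two_le.trans (Nat.le_self_pow (by omega) ℓ)
  have hle := card_le_of_forall_pow_eq hQ2 fun t => by
    have := hid t
    rwa [iterateFrobenius_def] at this
  have hcard := two_mul_card_psl_le h2
  have hmono : Fintype.card F * (Fintype.card F ^ 2 - 1) ≤ ℓ ^ m * ((ℓ ^ m) ^ 2 - 1) :=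
    Nat.mul_le_mul hle (Nat.sub_le_sub_right (Nat.pow_le_pow_left hle 2) 1)
  have hm' : ℓ ^ m * ((ℓ ^ m) ^ 2 - 1) ≤ 2 * Nat.card H := hm
  have hN : Nat.card (ProjectiveSpecialLinearGroup (Fin 2) F) ≤ Nat.card H := by omega
  have htop := Subgroup.eq_top_of_le_card H hN
  exact h.last (by rw [← hH, htop]; trivial)

end OrderBound

section Classification

open Matrix

variable {F : Type*} [Field F]

theorem IsGenQuad.card_eq [Fintype F] (h2 : (2 : F) ≠ 0)
    {A B C D : Matrix.SpecialLinearGroup (Fin 2) F} (h : IsGenQuad A B C D) :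
    (Fintype.card F = 11 ∧ (A.1 * B.1).trace ^ 2 = 1 ∧ (C.1 * D.1).trace ^ 2 = 1) ∨
      (Fintype.card F = 19 ∧ (A.1 * B.1).trace ^ 2 = 6 ∧ (C.1 * D.1).trace ^ 2 = 6) := by
  obtain ⟨⟨hX, hY⟩, hXY⟩ := h.trace_sq_mem h2 (h.orderOf_le h2)
  obtain ⟨⟨hZ, -⟩, hZY⟩ := h.reverse.trace_sq_mem h2 (h.reverse.orderOf_le h2)
  rw [trace_mul_comm D.1 C.1] at hZ hZY
  rw [trace_mul_comm C.1 B.1] at hZY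
  exact card_eq_of_invariants h2 (fun σ hX hZ => h.ringHom_eq h2 σ hX hZ) hX hZ hY hXY hZY
    (h.four_mul_trace_sq h2) ⟨_, sq _⟩ (h.isSquare_sub h2)

/-- The automorphism of `SL(2, F)` induced by conjugation by an invertible matrix. -/
def slConj (u : (Matrix (Fin 2) (Fin 2) F)ˣ) :
    Matrix.SpecialLinearGroup (Fin 2) F ≃* Matrix.SpecialLinearGroup (Fin 2) F where
  toFun M := ⟨u.1 * M.1 * u⁻¹.1, by rw [det_units_conj, M.2]⟩
  invFun M := ⟨u⁻¹.1 * M.1 * u.1, by rw [det_units_conj', M.2]⟩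
  left_inv M := Subtype.ext (by simp [mul_assoc])
  right_inv M := Subtype.ext (by simp [mul_assoc])
  map_mul' M N := Subtype.ext (by
    change u.1 * (M.1 * N.1) * u⁻¹.1 = (u.1 * M.1 * u⁻¹.1) * (u.1 * N.1 * u⁻¹.1)
    simp [mul_assoc])

/-- The automorphism of `PSL(2, F)` induced by conjugation by an invertible matrix. -/
def pslConj (u : (Matrix (Fin 2) (Fin 2) F)ˣ) :
    ProjectiveSpecialLinearGroup (Fin 2) F ≃* ProjectiveSpecialLinearGroup (Fin 2) F :=
  QuotientGroup.congr _ _ (slConj u) (Subgroup.characteristic_iff_map_eq.1 inferInstance _)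

theorem pslConj_mk_eq {u : (Matrix (Fin 2) (Fin 2) F)ˣ} {M N : Matrix.SpecialLinearGroup (Fin 2) F}
    (h : u.1 * M.1 = N.1 * u.1 ∨ u.1 * M.1 = -(N.1 * u.1)) :
    pslConj u (M : ProjectiveSpecialLinearGroup (Fin 2) F) = N := by
  have e : pslConj u (M : ProjectiveSpecialLinearGroup (Fin 2) F) =
    (slConj u M : Matrix.SpecialLinearGroup (Fin 2) F) := rfl
  rw [e, psl_mk_eq_iff]
  rcases h with h | h
  · left
    change N.1 = u.1 * M.1 * u⁻¹.1
    rw [h, mul_assoc, Units.mul_inv, mul_one]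
  · right
    change N.1 = -(u.1 * M.1 * u⁻¹.1)
    rw [h, neg_mul, neg_neg, mul_assoc, Units.mul_inv, mul_one]

theorem IsStringCGroupRep.card_eq [Fintype F] {ρ : Fin 4 → ProjectiveSpecialLinearGroup (Fin 2) F}
    (h : IsStringCGroupRep ρ) : Fintype.card F = 11 ∨ Fintype.card F = 19 := by
  obtain ⟨h2, A, B, C, D, hq, -⟩ := h.exists_isGenQuad
  exact (hq.card_eq h2).imp And.left And.left

theorem IsStringCGroupRep.exists_mulEquiv [Fintype F]
    {ρ σ : Fin 4 → ProjectiveSpecialLinearGroup (Fin 2) F}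
    (hρ : IsStringCGroupRep ρ) (hσ : IsStringCGroupRep σ) :
    ∃ φ : ProjectiveSpecialLinearGroup (Fin 2) F ≃* ProjectiveSpecialLinearGroup (Fin 2) F,
      φ '' Set.range ρ = Set.range σ := by
  obtain ⟨h2, A, B, C, D, hq, hA, hB, hC, hD⟩ := hρ.exists_isGenQuad
  obtain ⟨-, A', B', C', D', hq', hA', hB', hC', hD'⟩ := hσ.exists_isGenQuad
  have hXZ : (A.1 * B.1).trace ^ 2 = (A'.1 * B'.1).trace ^ 2 ∧
      (C.1 * D.1).trace ^ 2 = (C'.1 * D'.1).trace ^ 2 := by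
    rcases hq.card_eq h2 with ⟨hc, hX, hZ⟩ | ⟨hc, hX, hZ⟩ <;>
      rcases hq'.card_eq h2 with ⟨hc', hX', hZ'⟩ | ⟨hc', hX', hZ'⟩
    · exact ⟨hX.trans hX'.symm, hZ.trans hZ'.symm⟩
    · omega
    · omega
    · exact ⟨hX.trans hX'.symm, hZ.trans hZ'.symm⟩
  obtain ⟨u, uA, uB, uC, uD⟩ := hq.quad.exists_conj h2 hq'.quad hXZ.1 hXZ.2
  refine ⟨pslConj u, ?_⟩
  rw [← Set.range_comp]
  congr 1
  funext i
  fin_cases i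
  · exact (congrArg _ hA).trans ((pslConj_mk_eq uA).trans hA'.symm)
  · exact (congrArg _ hB).trans ((pslConj_mk_eq uB).trans hB'.symm)
  · exact (congrArg _ hC).trans ((pslConj_mk_eq uC).trans hC'.symm)
  · exact (congrArg _ hD).trans ((pslConj_mk_eq uD).trans hD'.symm)

end Classification

section Coding

open Matrix

/-- The base `p` code of a quadruple of digits. -/
def quadCode (p a b c d : ℕ) : ℕ := ((a * p + b) * p + c) * p + d

/-- The smaller of the codes of a quadruple of residues and its negative. -/
def signedCode (p a b c d : ℕ) : ℕ :=
  min (quadCode p a b c d) (quadCode p ((p - a) % p) ((p - b) % p) ((p - c) % p) ((p - d) % p))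

/-- Left multiplication by the matrix with rows `(x, y)` and `(z, w)`, on codes. -/
def stepCode (p x y z w n : ℕ) : ℕ :=
  let a := n / p / p / p
  let b := n / p / p % p
  let c := n / p % p
  let d := n % p
  signedCode p ((x * a + y * c) % p) ((x * b + y * d) % p) ((z * a + w * c) % p)
    ((z * b + w * d) % p)

variable {p : ℕ} [Fact p.Prime]

def matCode (M : Matrix (Fin 2) (Fin 2) (ZMod p)) : ℕ :=
  quadCode p (M 0 0).val (M 0 1).val (M 1 0).val (M 1 1).val

def slCode (M : Matrix.SpecialLinearGroup (Fin 2) (ZMod p)) : ℕ :=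
  min (matCode M.1) (matCode (-M.1))

theorem quadCode_digits {a b c d : ℕ} (hb : b < p) (hc : c < p) (hd : d < p) :
    quadCode p a b c d / p / p / p = a ∧ quadCode p a b c d / p / p % p = b ∧
      quadCode p a b c d / p % p = c ∧ quadCode p a b c d % p = d := by
  have hp : 0 < p := (Fact.out : p.Prime).pos
  have h1 : quadCode p a b c d / p = (a * p + b) * p + c := by
    rw [quadCode, mul_comm _ p, Nat.mul_add_div hp, Nat.div_eq_of_lt hd, add_zero]
  have h2 : ((a * p + b) * p + c) / p = a * p + b := by
    rw [mul_comm _ p, Nat.mul_add_div hp, Nat.div_eq_of_lt hc, add_zero]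
  rw [h1, h2]
  refine ⟨?_, ?_, ?_, ?_⟩
  · rw [mul_comm, Nat.mul_add_div hp, Nat.div_eq_of_lt hb, add_zero]
  · rw [mul_comm, Nat.mul_add_mod, Nat.mod_eq_of_lt hb]
  · rw [mul_comm, Nat.mul_add_mod, Nat.mod_eq_of_lt hc]
  · rw [quadCode, mul_comm, Nat.mul_add_mod, Nat.mod_eq_of_lt hd]

theorem matCode_injective : Function.Injective (matCode (p := p)) := by
  intro M N h
  obtain ⟨hM0, hM1, hM2, hM3⟩ := quadCode_digits (a := (M 0 0).val) (ZMod.val_lt (M 0 1))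
    (ZMod.val_lt (M 1 0)) (ZMod.val_lt (M 1 1))
  obtain ⟨hN0, hN1, hN2, hN3⟩ := quadCode_digits (a := (N 0 0).val) (ZMod.val_lt (N 0 1))
    (ZMod.val_lt (N 1 0)) (ZMod.val_lt (N 1 1))
  rw [matCode, matCode] at h
  rw [h] at hM0 hM1 hM2 hM3
  ext i j
  fin_cases i <;> fin_cases j <;> refine ZMod.val_injective p ?_
  · exact hM0.symm.trans hN0
  · exact hM1.symm.trans hN1
  · exact hM2.symm.trans hN2
  · exact hM3.symm.trans hN3

theorem slCode_eq_iff (M N : Matrix.SpecialLinearGroup (Fin 2) (ZMod p)) :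
    slCode M = slCode N ↔ (M : ProjectiveSpecialLinearGroup (Fin 2) (ZMod p)) = N := by
  rw [psl_mk_eq_iff]
  constructor
  · intro h
    rw [slCode, slCode] at h
    rcases min_choice (matCode M.1) (matCode (-M.1)) with hM | hM <;>
      rcases min_choice (matCode N.1) (matCode (-N.1)) with hN | hN <;> rw [hM, hN] at h <;>
      have := matCode_injective h
    · exact Or.inl this.symm
    · exact Or.inr (by rw [this, neg_neg])
    · exact Or.inr this.symm
    · exact Or.inl (neg_injective this).symm
  · rintro (h | h)
    · rw [slCode, slCode, h]
    · rw [slCode, slCode, h, neg_neg, min_comm]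

theorem signedCode_val (M : Matrix (Fin 2) (Fin 2) (ZMod p)) :
    signedCode p (M 0 0).val (M 0 1).val (M 1 0).val (M 1 1).val =
      min (matCode M) (matCode (-M)) := by
  simp only [signedCode, matCode, Matrix.neg_apply, ZMod.neg_val']

theorem stepCode_matCode (R M : Matrix (Fin 2) (Fin 2) (ZMod p)) :
    stepCode p (R 0 0).val (R 0 1).val (R 1 0).val (R 1 1).val (matCode M) =
      min (matCode (R * M)) (matCode (-(R * M))) := by
  obtain ⟨hM0, hM1, hM2, hM3⟩ := quadCode_digits (a := (M 0 0).val) (ZMod.val_lt (M 0 1))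
    (ZMod.val_lt (M 1 0)) (ZMod.val_lt (M 1 1))
  rw [← signedCode_val, stepCode, matCode, hM0, hM1, hM2, hM3]
  simp only [Matrix.mul_apply, Fin.sum_univ_two, ZMod.val_add, ZMod.val_mul, Nat.add_mod,
    Nat.mod_mod]

theorem slCode_mul (R M : Matrix.SpecialLinearGroup (Fin 2) (ZMod p)) :
    slCode (R * M) =
      stepCode p (R.1 0 0).val (R.1 0 1).val (R.1 1 0).val (R.1 1 1).val (slCode M) := by
  rw [slCode, slCode, Matrix.SpecialLinearGroup.coe_mul]
  rcases min_choice (matCode M.1) (matCode (-M.1)) with hM | hM <;> rw [hM, stepCode_matCode]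
  rw [mul_neg, neg_neg, min_comm]

end Coding

section Reach

/-- The closure of a list under finitely many maps, computed in a given number of rounds. -/
def reach {α : Type*} [DecidableEq α] (s : List (α → α)) : ℕ → List α → List α
  | 0, l => l
  | k + 1, l => reach s k
      (s.foldl (fun acc f => acc ++ (acc.map f).filter (fun x => !acc.contains x)) l)

theorem reach_induction {α : Type*} [DecidableEq α] {P : α → Prop} {s : List (α → α)}
    (hs : ∀ f ∈ s, ∀ x, P x → P (f x)) (k : ℕ) {l : List α} (hl : ∀ x ∈ l, P x) :
    ∀ x ∈ reach s k l, P x := by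
  induction k generalizing l with
  | zero => exact hl
  | succ k ih =>
    rw [reach]
    refine ih ?_
    clear ih
    induction s generalizing l with
    | nil => exact hl
    | cons f s ihs =>
      rw [List.foldl_cons]
      refine ihs (fun g hg => hs g (List.mem_cons_of_mem _ hg)) ?_
      intro x hx
      rcases List.mem_append.1 hx with hx | hx
      · exact hl x hx
      · obtain ⟨y, hy, rfl⟩ := List.mem_map.1 (List.mem_filter.1 hx).1
        exact hs f (List.mem_cons_self ..) y (hl y hy)

theorem mem_reach_of_mem {α : Type*} [DecidableEq α] {s : List (α → α)} (k : ℕ) {l : List α}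
    {x : α} (hx : x ∈ l) : x ∈ reach s k l := by
  induction k generalizing l with
  | zero => exact hx
  | succ k ih =>
    rw [reach]
    refine ih ?_
    clear ih
    induction s generalizing l with
    | nil => exact hx
    | cons f s ihs =>
      rw [List.foldl_cons]
      exact ihs (List.mem_append_left _ hx)

end Reach

section Existence

open Matrix

/-- The codes of the subgroup generated by the involutions selected by `b`. -/
def subgroupCodes (st : Fin 4 → ℕ → ℕ) (e : ℕ) (b : Fin 4 → Bool) : List ℕ :=
  reach (((List.finRange 4).filter b).map st) 8 [e]

def codesClosed (st : Fin 4 → ℕ → ℕ) (e : ℕ) (b : Fin 4 → Bool) : Bool :=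
  (subgroupCodes st e b).all fun x =>
    (List.finRange 4).all fun i => !b i || (subgroupCodes st e b).contains (st i x)

def codesInter (st : Fin 4 → ℕ → ℕ) (e : ℕ) (b c : Fin 4 → Bool) : Bool :=
  (subgroupCodes st e b).all fun x => !(subgroupCodes st e c).contains x ||
    (subgroupCodes st e fun i => b i && c i).contains x

variable {p : ℕ} [Fact p.Prime]

theorem mem_closure_of_mem_subgroupCodes {R : Fin 4 → Matrix.SpecialLinearGroup (Fin 2) (ZMod p)}
    {st : Fin 4 → ℕ → ℕ} (hst : ∀ i M, slCode (R i * M) = st i (slCode M)) {e : ℕ}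
    (he : slCode (1 : Matrix.SpecialLinearGroup (Fin 2) (ZMod p)) = e) {b : Fin 4 → Bool}
    {M : Matrix.SpecialLinearGroup (Fin 2) (ZMod p)} (hM : slCode M ∈ subgroupCodes st e b) :
    (M : ProjectiveSpecialLinearGroup (Fin 2) (ZMod p)) ∈ Subgroup.closure
      ((fun i => (R i : ProjectiveSpecialLinearGroup (Fin 2) (ZMod p))) '' {i | b i = true}) := by
  have key : ∀ n ∈ subgroupCodes st e b, ∃ N : Matrix.SpecialLinearGroup (Fin 2) (ZMod p),
      (N : ProjectiveSpecialLinearGroup (Fin 2) (ZMod p)) ∈ Subgroup.closure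
        ((fun i => (R i : ProjectiveSpecialLinearGroup (Fin 2) (ZMod p))) '' {i | b i = true}) ∧
      slCode N = n := by
    refine reach_induction ?_ 8 ?_
    · rintro f hf x ⟨N, hN, rfl⟩
      obtain ⟨i, hi, rfl⟩ := List.mem_map.1 hf
      refine ⟨R i * N, ?_, hst i N⟩
      rw [QuotientGroup.mk_mul]
      exact mul_mem (Subgroup.subset_closure (Set.mem_image_of_mem _ (List.mem_filter.1 hi).2)) hN
    · intro x hx
      rw [List.mem_singleton] at hx
      exact ⟨1, one_mem _, he.trans hx.symm⟩
  obtain ⟨N, hN, h⟩ := key _ hM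
  rwa [(slCode_eq_iff N M).1 h] at hN

theorem mem_subgroupCodes_of_mem_closure {R : Fin 4 → Matrix.SpecialLinearGroup (Fin 2) (ZMod p)}
    {st : Fin 4 → ℕ → ℕ} (hst : ∀ i M, slCode (R i * M) = st i (slCode M)) {e : ℕ}
    (he : slCode (1 : Matrix.SpecialLinearGroup (Fin 2) (ZMod p)) = e) {b : Fin 4 → Bool}
    (hR : ∀ i, ((R i : ProjectiveSpecialLinearGroup (Fin 2) (ZMod p)))⁻¹ = R i)
    (hb : codesClosed st e b = true) {x : ProjectiveSpecialLinearGroup (Fin 2) (ZMod p)}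
    (hx : x ∈ Subgroup.closure
      ((fun i => (R i : ProjectiveSpecialLinearGroup (Fin 2) (ZMod p))) '' {i | b i = true})) :
    ∃ M : Matrix.SpecialLinearGroup (Fin 2) (ZMod p),
      (M : ProjectiveSpecialLinearGroup (Fin 2) (ZMod p)) = x ∧
        slCode M ∈ subgroupCodes st e b := by
  have step : ∀ i, b i = true → ∀ y : ProjectiveSpecialLinearGroup (Fin 2) (ZMod p),
      (∃ M : Matrix.SpecialLinearGroup (Fin 2) (ZMod p),
        (M : ProjectiveSpecialLinearGroup (Fin 2) (ZMod p)) = y ∧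
          slCode M ∈ subgroupCodes st e b) →
      ∃ M : Matrix.SpecialLinearGroup (Fin 2) (ZMod p),
        (M : ProjectiveSpecialLinearGroup (Fin 2) (ZMod p)) = R i * y ∧
          slCode M ∈ subgroupCodes st e b := by
    rintro i hi _ ⟨M, rfl, hM⟩
    refine ⟨R i * M, rfl, ?_⟩
    have := List.all_eq_true.1 (List.all_eq_true.1 hb _ hM) i (List.mem_finRange i)
    rw [hi, Bool.not_true, Bool.false_or, List.contains_iff_mem] at this
    rwa [hst]
  induction hx using Subgroup.closure_induction_left with
  | one => exact ⟨1, rfl, by rw [he]; exact mem_reach_of_mem 8 (List.mem_singleton_self e)⟩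
  | mul_left x hx y _ ih =>
    obtain ⟨i, hi, rfl⟩ := hx
    exact step i hi y ih
  | inv_mul_cancel x hx y _ ih =>
    obtain ⟨i, hi, rfl⟩ := hx
    simp only [hR]
    exact step i hi y ih

theorem closure_inf_closure_of_codes {R : Fin 4 → Matrix.SpecialLinearGroup (Fin 2) (ZMod p)}
    {st : Fin 4 → ℕ → ℕ} (hst : ∀ i M, slCode (R i * M) = st i (slCode M)) {e : ℕ}
    (he : slCode (1 : Matrix.SpecialLinearGroup (Fin 2) (ZMod p)) = e)
    (hR : ∀ i, ((R i : ProjectiveSpecialLinearGroup (Fin 2) (ZMod p)))⁻¹ = R i)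
    (htop : Subgroup.closure (Set.range fun i =>
      (R i : ProjectiveSpecialLinearGroup (Fin 2) (ZMod p))) = ⊤)
    (hclosed : ∀ b : Fin 4 → Bool, (∃ i, b i = false) → codesClosed st e b = true)
    (hinter : ∀ b c : Fin 4 → Bool, (∃ i, b i = false) → (∃ i, c i = false) →
      codesInter st e b c = true) (I J : Set (Fin 4)) :
    Subgroup.closure
        ((fun i => (R i : ProjectiveSpecialLinearGroup (Fin 2) (ZMod p))) '' I) ⊓
      Subgroup.closure ((fun i => (R i : ProjectiveSpecialLinearGroup (Fin 2) (ZMod p))) '' J) =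
    Subgroup.closure
      ((fun i => (R i : ProjectiveSpecialLinearGroup (Fin 2) (ZMod p))) '' (I ∩ J)) := by
  classical
  rcases eq_or_ne I Set.univ with rfl | hI
  · rw [Set.image_univ, htop, top_inf_eq, Set.univ_inter]
  rcases eq_or_ne J Set.univ with rfl | hJ
  · rw [Set.image_univ, htop, inf_top_eq, Set.inter_univ]
  have proper : ∀ K : Set (Fin 4), K ≠ Set.univ →
      ∃ b : Fin 4 → Bool, {i | b i = true} = K ∧ ∃ i, b i = false := by
    intro K hK
    obtain ⟨i, hi⟩ := (Set.ne_univ_iff_exists_notMem K).1 hK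
    exact ⟨fun i => decide (i ∈ K), by simp, i, decide_eq_false hi⟩
  obtain ⟨b, rfl, hb⟩ := proper I hI
  obtain ⟨c, rfl, hc⟩ := proper J hJ
  refine le_antisymm ?_ (le_inf (Subgroup.closure_mono (Set.image_mono Set.inter_subset_left))
    (Subgroup.closure_mono (Set.image_mono Set.inter_subset_right)))
  rintro x ⟨hx, hx'⟩
  obtain ⟨M, rfl, hM⟩ := mem_subgroupCodes_of_mem_closure hst he hR (hclosed b hb) hx
  obtain ⟨N, hN, hN'⟩ := mem_subgroupCodes_of_mem_closure hst he hR (hclosed c hc) hx'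
  rw [(slCode_eq_iff N M).2 hN] at hN'
  have h := List.all_eq_true.1 (hinter b c hb hc) _ hM
  rw [List.contains_iff_mem.2 hN', Bool.not_true, Bool.false_or, List.contains_iff_mem] at h
  have hset : {i | b i = true} ∩ {i | c i = true} = {i | (b i && c i) = true} := by
    ext i
    simp
  rw [hset]
  exact mem_closure_of_mem_subgroupCodes hst he h

theorem closure_eq_top_of_transvections {R : Fin 4 → Matrix.SpecialLinearGroup (Fin 2) (ZMod p)}
    {st : Fin 4 → ℕ → ℕ} (hst : ∀ i M, slCode (R i * M) = st i (slCode M)) {e : ℕ}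
    (he : slCode (1 : Matrix.SpecialLinearGroup (Fin 2) (ZMod p)) = e)
    (h : ∀ i j : Fin 2, ∀ hij : i ≠ j, ∃ w : List (Fin 4), w.foldr st e =
      slCode (Matrix.SpecialLinearGroup.transvection hij (1 : ZMod p))) :
    Subgroup.closure (Set.range fun i =>
      (R i : ProjectiveSpecialLinearGroup (Fin 2) (ZMod p))) = ⊤ := by
  have hword : ∀ w : List (Fin 4), slCode (w.map R).prod = w.foldr st e := by
    intro w
    induction w with
    | nil => exact he
    | cons i w ih => rw [List.map_cons, List.prod_cons, hst, ih, List.foldr_cons]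
  have hmem : ∀ w : List (Fin 4), (((w.map R).prod : Matrix.SpecialLinearGroup (Fin 2) (ZMod p)) :
      ProjectiveSpecialLinearGroup (Fin 2) (ZMod p)) ∈ Subgroup.closure (Set.range fun i =>
        (R i : ProjectiveSpecialLinearGroup (Fin 2) (ZMod p))) := by
    intro w
    induction w with
    | nil => exact one_mem _
    | cons i w ih =>
      rw [List.map_cons, List.prod_cons, QuotientGroup.mk_mul]
      exact mul_mem (Subgroup.subset_closure (Set.mem_range_self i)) ih
  rw [eq_top_iff]
  rintro x -
  obtain ⟨M, rfl⟩ := QuotientGroup.mk_surjective x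
  induction M using SL2.transvection_induction with
  | htransvec i j hij c =>
    have hc : ∀ n : ℕ, ((Matrix.SpecialLinearGroup.transvection hij (n : ZMod p)) :
        ProjectiveSpecialLinearGroup (Fin 2) (ZMod p)) ∈ Subgroup.closure (Set.range fun i =>
          (R i : ProjectiveSpecialLinearGroup (Fin 2) (ZMod p))) := by
      intro n
      induction n with
      | zero =>
        have h0 : Matrix.SpecialLinearGroup.transvection hij ((0 : ℕ) : ZMod p) = 1 := by
          ext; simp
        rw [h0]
        exact one_mem _
      | succ n ih =>
        obtain ⟨w, hw⟩ := h i j hij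
        rw [← hword] at hw
        rw [Nat.cast_succ, Matrix.SpecialLinearGroup.transvection_add, QuotientGroup.mk_mul]
        refine mul_mem ih ?_
        rw [← (slCode_eq_iff _ _).1 hw]
        exact hmem w
    have := hc c.val
    rwa [ZMod.natCast_zmod_val] at this
  | hmul A B hA hB =>
    rw [QuotientGroup.mk_mul]
    exact mul_mem hA hB

end Existence

section Examples

open Matrix

theorem orderOf_psl_mk_eq_two {F : Type*} [Field F]
    {M : Matrix.SpecialLinearGroup (Fin 2) F} (h : M * M = -1) (h1 : M.1 ≠ 1) (h2 : M.1 ≠ -1) :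
    orderOf (M : ProjectiveSpecialLinearGroup (Fin 2) F) = 2 := by
  refine orderOf_eq_prime ?_ fun hM => ((psl_mk_eq_one_iff M).1 hM).elim h1 h2
  rw [pow_two, ← QuotientGroup.mk_mul, psl_mk_eq_one_iff, h]
  exact Or.inr rfl

/-- A decidable criterion for four matrices to give a string C-group representation. -/
theorem isStringCGroupRep_of_codes {p : ℕ} [Fact p.Prime]
    {R : Fin 4 → Matrix.SpecialLinearGroup (Fin 2) (ZMod p)}
    {st : Fin 4 → ℕ → ℕ} (hst : ∀ i, st i = stepCode p ((R i).1 0 0).val ((R i).1 0 1).val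
      ((R i).1 1 0).val ((R i).1 1 1).val) {e : ℕ}
    (he : slCode (1 : Matrix.SpecialLinearGroup (Fin 2) (ZMod p)) = e)
    (hsq : ∀ i, R i * R i = -1) (hne : ∀ i, (R i).1 ≠ 1 ∧ (R i).1 ≠ -1)
    (hcomm : ∀ i j : Fin 4, i.val + 1 < j.val → (R i).1 * (R j).1 = -((R j).1 * (R i).1))
    (htrans : ∀ i j : Fin 2, ∀ hij : i ≠ j, ∃ w : List (Fin 4), w.foldr st e =
      slCode (Matrix.SpecialLinearGroup.transvection hij (1 : ZMod p)))
    (hclosed : ∀ b0 b1 b2 b3 : Bool, (b0 && b1 && b2 && b3) = false →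
      codesClosed st e ![b0, b1, b2, b3] = true)
    (hinter : ∀ b0 b1 b2 b3 c0 c1 c2 c3 : Bool, (b0 && b1 && b2 && b3) = false →
      (c0 && c1 && c2 && c3) = false →
      codesInter st e ![b0, b1, b2, b3] ![c0, c1, c2, c3] = true) :
    IsStringCGroupRep fun i =>
      (R i : ProjectiveSpecialLinearGroup (Fin 2) (ZMod p)) := by
  have hord : ∀ i, orderOf (R i : ProjectiveSpecialLinearGroup (Fin 2) (ZMod p)) = 2 :=
    fun i => orderOf_psl_mk_eq_two (hsq i) (hne i).1 (hne i).2
  have hst' : ∀ i M, slCode (R i * M) = st i (slCode M) := fun i M => by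
    rw [hst, slCode_mul]
  have hinv : ∀ i, ((R i : ProjectiveSpecialLinearGroup (Fin 2) (ZMod p)))⁻¹ = R i := by
    intro i
    rw [inv_eq_iff_mul_eq_one, ← pow_two]
    exact orderOf_dvd_iff_pow_eq_one.1 (hord i).dvd
  have hvec : ∀ b : Fin 4 → Bool, b = ![b 0, b 1, b 2, b 3] := by
    intro b
    ext i
    fin_cases i <;> rfl
  have hfalse : ∀ b : Fin 4 → Bool, (∃ i, b i = false) → (b 0 && b 1 && b 2 && b 3) = false := by
    rintro b ⟨i, hi⟩
    have hi' : b 0 = false ∨ b 1 = false ∨ b 2 = false ∨ b 3 = false := by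
      fin_cases i
      exacts [Or.inl hi, Or.inr (Or.inl hi), Or.inr (Or.inr (Or.inl hi)),
        Or.inr (Or.inr (Or.inr hi))]
    rcases hi' with h | h | h | h <;> rw [h] <;> simp only [Bool.false_and, Bool.and_false]
  have htop := closure_eq_top_of_transvections hst' he htrans
  refine ⟨hord, htop, ?_, closure_inf_closure_of_codes hst' he hinv htop ?_ ?_⟩
  · intro i j hij
    exact (psl_commute_iff _ _).2 (Or.inr (hcomm i j hij))
  · intro b hb
    rw [hvec b]
    exact hclosed _ _ _ _ (hfalse b hb)
  · intro b c hb hc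
    rw [hvec b, hvec c]
    exact hinter _ _ _ _ _ _ _ _ (hfalse b hb) (hfalse c hc)

def elevenMatrices : Fin 4 → Matrix.SpecialLinearGroup (Fin 2) (ZMod 11) :=
  ![⟨!![0, 10; 1, 0], by decide⟩, ⟨!![8, 3; 4, 3], by decide⟩, ⟨!![4, 4; 4, 7], by decide⟩,
    ⟨!![3, 1; 1, 8], by decide⟩]

def elevenSteps : Fin 4 → ℕ → ℕ :=
  ![stepCode 11 0 10 1 0, stepCode 11 8 3 4 3, stepCode 11 4 4 4 7, stepCode 11 3 1 1 8]

instance fact_prime_eleven : Fact (Nat.Prime 11) := ⟨by norm_num⟩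

theorem isStringCGroupRep_eleven : IsStringCGroupRep fun i =>
    (elevenMatrices i : ProjectiveSpecialLinearGroup (Fin 2) (ZMod 11)) := by
  refine isStringCGroupRep_of_codes (st := elevenSteps) (e := 1332) ?_ ?_ ?_ ?_ ?_ ?_ ?_ ?_
  · intro i
    fin_cases i <;> rfl
  · decide +kernel
  · decide +kernel
  · decide +kernel
  · decide +kernel
  · intro i j hij
    fin_cases i <;> fin_cases j
    · exact absurd rfl hij
    · exact ⟨[3, 2, 1, 2, 1, 0], by revert hij; decide +kernel⟩
    · exact ⟨[1, 2, 1, 2, 3, 0], by revert hij; decide +kernel⟩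
    · exact absurd rfl hij
  · decide +kernel
  · decide +kernel

def nineteenMatrices : Fin 4 → Matrix.SpecialLinearGroup (Fin 2) (ZMod 19) :=
  ![⟨!![0, 18; 1, 0], by decide⟩, ⟨!![10, 2; 16, 9], by decide⟩, ⟨!![12, 11; 11, 7], by decide⟩,
    ⟨!![3, 3; 3, 16], by decide⟩]

def nineteenSteps : Fin 4 → ℕ → ℕ :=
  ![stepCode 19 0 18 1 0, stepCode 19 10 2 16 9, stepCode 19 12 11 11 7, stepCode 19 3 3 3 16]

instance fact_prime_nineteen : Fact (Nat.Prime 19) := ⟨by norm_num⟩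

theorem isStringCGroupRep_nineteen : IsStringCGroupRep fun i =>
    (nineteenMatrices i : ProjectiveSpecialLinearGroup (Fin 2) (ZMod 19)) := by
  refine isStringCGroupRep_of_codes (st := nineteenSteps) (e := 6860) ?_ ?_ ?_ ?_ ?_ ?_ ?_ ?_
  · intro i
    fin_cases i <;> rfl
  · decide +kernel
  · decide +kernel
  · decide +kernel
  · decide +kernel
  · intro i j hij
    fin_cases i <;> fin_cases j
    · exact absurd rfl hij
    · exact ⟨[2, 3, 0, 1, 2, 3, 1, 0, 1, 2, 3, 0, 1, 0], by revert hij; decide +kernel⟩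
    · exact ⟨[3, 1, 2, 3, 0, 1, 0, 1, 2, 3, 1, 2], by revert hij; decide +kernel⟩
    · exact absurd rfl hij
  · decide +kernel
  · decide +kernel

end Examples

section Transfer

open Matrix

theorem IsStringCGroupRep.map {G H : Type*} [Group G] [Group H] {n : ℕ} {ρ : Fin n → G}
    (h : IsStringCGroupRep ρ) (φ : G ≃* H) : IsStringCGroupRep fun i => φ (ρ i) := by
  obtain ⟨hord, htop, hcomm, hint⟩ := h
  have himg : ∀ K : Set (Fin n), Subgroup.closure ((fun i => φ (ρ i)) '' K) =
      (Subgroup.closure (ρ '' K)).map φ.toMonoidHom := by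
    intro K
    rw [MonoidHom.map_closure, Set.image_image]
    rfl
  refine ⟨fun i => ?_, ?_, fun i j hij => (hcomm i j hij).map φ, fun I J => ?_⟩
  · rw [MulEquiv.orderOf_eq, hord]
  · rw [← Set.image_univ, himg, Set.image_univ, htop]
    exact Subgroup.map_top_of_surjective _ φ.surjective
  · rw [himg, himg, himg, ← hint, Subgroup.map_inf _ _ _ φ.injective]

def pslEquiv {E F : Type*} [Field E] [Field F] (e : E ≃+* F) :
    ProjectiveSpecialLinearGroup (Fin 2) E ≃* ProjectiveSpecialLinearGroup (Fin 2) F where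
  toFun := pslMap e.toRingHom
  invFun := pslMap e.symm.toRingHom
  map_mul' := map_mul _
  left_inv x := by
    obtain ⟨M, rfl⟩ := QuotientGroup.mk_surjective x
    refine congrArg (QuotientGroup.mk (s := Subgroup.center _)) ?_
    ext i j
    exact e.symm_apply_apply _
  right_inv x := by
    obtain ⟨M, rfl⟩ := QuotientGroup.mk_surjective x
    refine congrArg (QuotientGroup.mk (s := Subgroup.center _)) ?_
    ext i j
    exact e.apply_symm_apply _

theorem exists_isStringCGroupRep {F : Type*} [Field F] [Fintype F]
    (hF : Fintype.card F = 11 ∨ Fintype.card F = 19) :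
    ∃ ρ : Fin 4 → ProjectiveSpecialLinearGroup (Fin 2) F, IsStringCGroupRep ρ := by
  rcases hF with hF | hF
  · exact ⟨_, isStringCGroupRep_eleven.map (pslEquiv (ZMod.ringEquivOfPrime F (by norm_num) hF))⟩
  · exact ⟨_, isStringCGroupRep_nineteen.map (pslEquiv (ZMod.ringEquivOfPrime F (by norm_num) hF))⟩

end Transfer

/-- `PSL(2, q)` has a string C-group representation of rank four iff `q = 11` or
`q = 19`, and in these cases the representation is unique up to isomorphism. -/
theorem psl2_rank_four_iff (F : Type*) [Field F] [Fintype F] :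
    ((∃ ρ : Fin 4 → Matrix.ProjectiveSpecialLinearGroup (Fin 2) F, IsStringCGroupRep ρ) ↔
      (Fintype.card F = 11 ∨ Fintype.card F = 19)) ∧
    ((Fintype.card F = 11 ∨ Fintype.card F = 19) →
      ∀ ρ σ : Fin 4 → Matrix.ProjectiveSpecialLinearGroup (Fin 2) F,
        IsStringCGroupRep ρ → IsStringCGroupRep σ →
        ∃ φ : Matrix.ProjectiveSpecialLinearGroup (Fin 2) F ≃*
            Matrix.ProjectiveSpecialLinearGroup (Fin 2) F,
          φ '' Set.range ρ = Set.range σ) := by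
  exact ⟨⟨fun ⟨_, h⟩ => h.card_eq, exists_isStringCGroupRep⟩,
    fun _ _ _ hρ hσ => hρ.exists_mulEquiv hσ⟩
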